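/- arXiv:1807.10710 — 2 statements merged into one kernel-verified Lean document; each statement's English description precedes it below -/
import Mathlib

section
/- Assume in addition that F is monotone: ∫_{𝕋^d} (F(x,m₁) − F(x,m₂)) d(m₁ − m₂)(x) ≥ 0 for all m₁, m₂ ∈ P(𝕋^d). Then the limit value equals the ergodic value: λ = λ̄. -/
/- Common framework for "On the long time convergence of potential MFG" (M. Masoero).

We work on the flat torus `𝕋^d`, modeled as `Td d := Fin d → AddCircle 1`.
Smooth functions on the torus are represented by `ℤ^d`-periodic functions on
`Vd d := Fin d → ℝ`; a function on `Vd d` is transported to the torus through the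
canonical (measurable) section `secT : Td d → Vd d`.  Probability measures on the
torus are `PTd d := ProbabilityMeasure (Td d)`, endowed with the 1-Wasserstein
distance `W1` defined through Kantorovich duality.  The Fokker--Planck equations
and their stationary analogues are stated in the sense of distributions, i.e.
against smooth periodic test functions; `σ` is the viscosity parameter
(everywhere `σ = 1` except in the non-convex example). -/

open MeasureTheory Real Set Filter

noncomputable section

abbrev Vd (d : ℕ) : Type := Fin d → ℝ
abbrev Td (d : ℕ) : Type := Fin d → AddCircle (1 : ℝ)

instance factOneposR : Fact ((0:ℝ) < 1) := ⟨one_pos⟩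

/-- The canonical measurable section of the torus, with values in `[0,1)^d`. -/
def secT {d : ℕ} (y : Td d) : Vd d := fun i => ((AddCircle.equivIco 1 0) (y i)).1

/-- The vector of `ℝ^d` associated with an integer vector. -/
def intVec {d : ℕ} (z : Fin d → ℤ) : Vd d := fun i => (z i : ℝ)

/-- Euclidean scalar product on `ℝ^d`. -/
def dotp {d : ℕ} (a b : Vd d) : ℝ := ∑ i, a i * b i

/-- Squared euclidean norm on `ℝ^d`. -/
def sqnorm {d : ℕ} (a : Vd d) : ℝ := ∑ i, (a i)^2

/-- Spatial gradient. -/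
def gradv {d : ℕ} (g : Vd d → ℝ) (x : Vd d) : Vd d := fun i => fderiv ℝ g x (Pi.single i 1)

/-- Second derivative of `g` at `x` in the directions `v, w`. -/
def D2 {d : ℕ} (g : Vd d → ℝ) (x v w : Vd d) : ℝ := fderiv ℝ (fun y => fderiv ℝ g y v) x w

/-- Laplacian. -/
def lapl {d : ℕ} (g : Vd d → ℝ) (x : Vd d) : ℝ := ∑ i, D2 g x (Pi.single i 1) (Pi.single i 1)

/-- Divergence of a vector field. -/
def divv {d : ℕ} (b : Vd d → Vd d) (x : Vd d) : ℝ :=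
  ∑ i, fderiv ℝ (fun y => b y i) x (Pi.single i 1)

/-- Time derivative of a time dependent function. -/
def tderiv {d : ℕ} (u : ℝ → Vd d → ℝ) (t : ℝ) (x : Vd d) : ℝ := deriv (fun s => u s x) t

abbrev PTd (d : ℕ) := ProbabilityMeasure (Td d)

/-- The 1-Wasserstein (Monge--Kantorovich) distance, via Kantorovich duality. -/
def W1 {d : ℕ} (μ ν : PTd d) : ℝ :=
  sSup { r | ∃ φ : Td d → ℝ, LipschitzWith 1 φ ∧
    r = (∫ y, φ y ∂(μ : Measure (Td d))) - ∫ y, φ y ∂(ν : Measure (Td d)) }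

/-- The convex combination `(1-t) μ + t ν`. -/
def lineComb {d : ℕ} (t : ℝ) (μ ν : PTd d) : Measure (Td d) :=
  ENNReal.ofReal (1 - t) • (μ : Measure (Td d)) + ENNReal.ofReal t • (ν : Measure (Td d))

/-- The standing assumptions of the paper: a Hamiltonian `H` (a `ℤ^d`-periodic function of
`(x,p)`), its convex conjugate `Hstar` in the `p` variable, a `C²` coupling function
`Fc` on `P(𝕋^d)` with flat derivative `Fd` (represented by periodic functions on `ℝ^d`),
with the regularity and growth conditions of the paper. -/
structure MFGSetting (d : ℕ) where
  H : Vd d → Vd d → ℝ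
  Hstar : Vd d → Vd d → ℝ
  Fc : PTd d → ℝ
  Fd : Measure (Td d) → Vd d → ℝ
  Cbar : ℝ
  Cbar_pos : 0 < Cbar
  θ : ℝ
  θ_mem : θ ∈ Set.Ioo (0:ℝ) 1
  Cg : ℝ
  Cg_pos : 0 < Cg
  CF : ℝ
  H_smooth : ContDiff ℝ 2 (fun q : Vd d × Vd d => H q.1 q.2)
  H_per : ∀ (x : Vd d) (z : Fin d → ℤ) (p : Vd d), H (x + intVec z) p = H x p
  Dpp_lip : ∃ L : ℝ, 0 ≤ L ∧ ∀ (x p₁ p₂ v w : Vd d),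
    |D2 (fun p => H x p) p₁ v w - D2 (fun p => H x p) p₂ v w| ≤ L * ‖p₁ - p₂‖ * ‖v‖ * ‖w‖
  Dpp_lower : ∀ x p v : Vd d, Cbar⁻¹ * sqnorm v ≤ D2 (fun p' => H x p') p v v
  Dpp_upper : ∀ x p v : Vd d, D2 (fun p' => H x p') p v v ≤ Cbar * sqnorm v
  Dxx_growth : ∀ x p v w : Vd d,
    |D2 (fun x' => H x' p) x v w| ≤ Cg * (1 + ‖p‖) ^ (1 + θ) * ‖v‖ * ‖w‖
  Dxp_growth : ∀ x p v w : Vd d,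
    |fderiv ℝ (fun x' => fderiv ℝ (fun p' => H x' p') p v) x w| ≤ Cg * (1 + ‖p‖) ^ θ * ‖v‖ * ‖w‖
  Hstar_eq : ∀ x q : Vd d, IsLUB (Set.range fun p => dotp q p - H x p) (Hstar x q)
  Fd_per : ∀ (μ : Measure (Td d)) (x : Vd d) (z : Fin d → ℤ), Fd μ (x + intVec z) = Fd μ x
  Fd_smooth : ∀ μ : Measure (Td d), IsProbabilityMeasure μ → ContDiff ℝ 2 (Fd μ)
  Fd_D2_bound : ∀ μ : Measure (Td d), IsProbabilityMeasure μ →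
    ∀ x v w : Vd d, |D2 (Fd μ) x v w| ≤ CF * ‖v‖ * ‖w‖
  flat_deriv : ∀ μ ν : PTd d,
    Fc ν - Fc μ = ∫ t in Set.Icc (0:ℝ) 1,
      ((∫ y, Fd (lineComb t μ ν) (secT y) ∂(ν : Measure (Td d))) -
        ∫ y, Fd (lineComb t μ ν) (secT y) ∂(μ : Measure (Td d)))
  Fd_normalized : ∀ μ : PTd d, (∫ y, Fd (μ : Measure (Td d)) (secT y) ∂(μ : Measure (Td d))) = 0
  Fc_bounded : ∃ M : ℝ, ∀ μ : PTd d, |Fc μ| ≤ M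
  Fd_bounded : ∃ M : ℝ, ∀ (μ : PTd d) (x : Vd d), |Fd (μ : Measure (Td d)) x| ≤ M

/-- Smooth periodic test functions on `[0,∞) × 𝕋^d` (resp. `ℝ × 𝕋^d`). -/
def IsTestFun {d : ℕ} (φ : ℝ → Vd d → ℝ) : Prop :=
  ContDiff ℝ 2 (fun q : ℝ × Vd d => φ q.1 q.2) ∧
  ∀ (t : ℝ) (x : Vd d) (z : Fin d → ℤ), φ t (x + intVec z) = φ t x

/-- The weak (distributional) formulation of the Fokker--Planck equation
`-∂ₜ m + σ Δ m + div(m α) = 0` between times `s₁` and `s₂`. -/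
def FPeq {d : ℕ} (σ : ℝ) (m : ℝ → PTd d) (α : ℝ → Td d → Vd d) (s₁ s₂ : ℝ) : Prop :=
  ∀ φ : ℝ → Vd d → ℝ, IsTestFun φ →
    (∫ y, φ s₂ (secT y) ∂(m s₂ : Measure (Td d))) -
      (∫ y, φ s₁ (secT y) ∂(m s₁ : Measure (Td d))) =
    ∫ s in s₁..s₂, ∫ y, (tderiv φ s (secT y) + σ * lapl (φ s) (secT y)
        - dotp (α s y) (gradv (φ s) (secT y))) ∂(m s : Measure (Td d))

/-- Continuity of a curve of measures with respect to the 1-Wasserstein distance. -/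
def W1ContOn {d : ℕ} (m : ℝ → PTd d) (I : Set ℝ) : Prop :=
  ∀ t ∈ I, ∀ ε > 0, ∃ η > 0, ∀ s ∈ I, |s - t| < η → W1 (m s) (m t) < ε

/-- Continuity of a function on `P(𝕋^d)` with respect to the 1-Wasserstein distance. -/
def W1Continuous {d : ℕ} (χ : PTd d → ℝ) : Prop :=
  ∀ μ : PTd d, ∀ ε > 0, ∃ η > 0, ∀ ν : PTd d, W1 μ ν < η → |χ ν - χ μ| < ε

/-- W1-closed subsets of `P(𝕋^d)`. -/
def IsClosedW1 {d : ℕ} (C : Set (PTd d)) : Prop :=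
  ∀ μ : PTd d, (∀ ε > 0, ∃ ν ∈ C, W1 μ ν < ε) → μ ∈ C

/-- The running cost `∫ H*(x,α(s)) dm(s) + 𝓕(m(s))`. -/
def runCost {d : ℕ} (S : MFGSetting d) (m : ℝ → PTd d) (α : ℝ → Td d → Vd d) (s : ℝ) : ℝ :=
  (∫ y, S.Hstar (secT y) (α s y) ∂(m s : Measure (Td d))) + S.Fc (m s)

/-- Admissible pairs `(m,α)` on `[0,T]` starting from `m₀` (with `α ∈ L²_m`). -/
def AdmOn {d : ℕ} (S : MFGSetting d) (σ : ℝ) (m₀ : PTd d) (T : ℝ)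
    (m : ℝ → PTd d) (α : ℝ → Td d → Vd d) : Prop :=
  m 0 = m₀ ∧ W1ContOn m (Set.Icc 0 T) ∧
  (∀ s₁ s₂ : ℝ, 0 ≤ s₁ → s₁ ≤ s₂ → s₂ ≤ T → FPeq σ m α s₁ s₂) ∧
  Measurable (fun q : ℝ × Td d => α q.1 q.2) ∧
  (∫⁻ s in Set.Ioc (0:ℝ) T, ∫⁻ y, ENNReal.ofReal (sqnorm (α s y)) ∂(m s : Measure (Td d))) < ⊤ ∧
  IntervalIntegrable (runCost S m α) volume 0 T

/-- Admissible pairs `(m,α)` on `[0,T]` starting from `m₀`, with `α` merely in `L¹_m`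
(the class `Π_T` used for problems with prescribed endpoints). -/
def AdmOn1 {d : ℕ} (S : MFGSetting d) (σ : ℝ) (m₀ : PTd d) (T : ℝ)
    (m : ℝ → PTd d) (α : ℝ → Td d → Vd d) : Prop :=
  m 0 = m₀ ∧ W1ContOn m (Set.Icc 0 T) ∧
  (∀ s₁ s₂ : ℝ, 0 ≤ s₁ → s₁ ≤ s₂ → s₂ ≤ T → FPeq σ m α s₁ s₂) ∧
  Measurable (fun q : ℝ × Td d => α q.1 q.2) ∧
  (∫⁻ s in Set.Ioc (0:ℝ) T, ∫⁻ y, ENNReal.ofReal (Real.sqrt (sqnorm (α s y)))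
      ∂(m s : Measure (Td d))) < ⊤ ∧
  IntervalIntegrable (runCost S m α) volume 0 T

/-- The finite horizon cost. -/
def costT {d : ℕ} (S : MFGSetting d) (m : ℝ → PTd d) (α : ℝ → Td d → Vd d) (T : ℝ) : ℝ :=
  ∫ s in (0:ℝ)..T, runCost S m α s

/-- The value `𝒰(T,m₀)` of the finite horizon problem. -/
def Ufun {d : ℕ} (S : MFGSetting d) (σ : ℝ) (T : ℝ) (m₀ : PTd d) : ℝ :=
  sInf { r | ∃ m α, AdmOn S σ m₀ T m α ∧ r = costT S m α T }

/-- Admissible pairs for the infinite horizon `δ`-discounted problem. -/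
def AdmDisc {d : ℕ} (S : MFGSetting d) (σ : ℝ) (δ : ℝ) (m₀ : PTd d)
    (m : ℝ → PTd d) (α : ℝ → Td d → Vd d) : Prop :=
  m 0 = m₀ ∧ W1ContOn m (Set.Ici 0) ∧
  (∀ s₁ s₂ : ℝ, 0 ≤ s₁ → s₁ ≤ s₂ → FPeq σ m α s₁ s₂) ∧
  Measurable (fun q : ℝ × Td d => α q.1 q.2) ∧
  (∫⁻ s in Set.Ioi (0:ℝ), ENNReal.ofReal (Real.exp (-δ * s)) *
      ∫⁻ y, ENNReal.ofReal (sqnorm (α s y)) ∂(m s : Measure (Td d))) < ⊤ ∧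
  Integrable (fun s => Real.exp (-δ * s) * runCost S m α s) (volume.restrict (Set.Ioi 0))

/-- The discounted cost. -/
def costDisc {d : ℕ} (S : MFGSetting d) (δ : ℝ) (m : ℝ → PTd d) (α : ℝ → Td d → Vd d) : ℝ :=
  ∫ s in Set.Ioi (0:ℝ), Real.exp (-δ * s) * runCost S m α s

/-- The value `𝒱_δ(m₀)` of the discounted problem. -/
def Vfun {d : ℕ} (S : MFGSetting d) (σ : ℝ) (δ : ℝ) (m₀ : PTd d) : ℝ :=
  sInf { r | ∃ m α, AdmDisc S σ δ m₀ m α ∧ r = costDisc S δ m α }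

/-- `D_p H (x, p)`. -/
def DpH {d : ℕ} (S : MFGSetting d) (x p : Vd d) : Vd d :=
  fun i => fderiv ℝ (fun p' => S.H x p') p (Pi.single i 1)

/-- `C^{1,2}` regularity on `I × 𝕋^d` of a (periodic) time-dependent function. -/
def Creg12 {d : ℕ} (u : ℝ → Vd d → ℝ) (I : Set ℝ) : Prop :=
  ContinuousOn (fun q : ℝ × Vd d => u q.1 q.2) (I ×ˢ Set.univ) ∧
  (∀ x : Vd d, ∀ t ∈ I, DifferentiableAt ℝ (fun s => u s x) t) ∧
  (∀ t ∈ I, ContDiff ℝ 2 (u t)) ∧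
  (∀ t ∈ I, ∀ (x : Vd d) (z : Fin d → ℤ), u t (x + intVec z) = u t x)

/-- `(u,m)` is a classical solution of the `δ`-discounted MFG system on `[0,∞) × 𝕋^d`:
`-∂ₜ u - Δ u + δ u + H(x,Du) = F(x,m)` and `-∂ₜ m + Δ m + div(m D_pH(x,Du)) = 0`. -/
def SolvesDiscMFG {d : ℕ} (S : MFGSetting d) (δ : ℝ) (u : ℝ → Vd d → ℝ) (m : ℝ → PTd d) : Prop :=
  Creg12 u (Set.Ici 0) ∧
  (∀ t ∈ Set.Ici (0:ℝ), ∀ x : Vd d,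
    - tderiv u t x - lapl (u t) x + δ * u t x + S.H x (gradv (u t) x)
      = S.Fd (m t : Measure (Td d)) x) ∧
  W1ContOn m (Set.Ici 0) ∧
  (∀ s₁ s₂ : ℝ, 0 ≤ s₁ → s₁ ≤ s₂ →
    FPeq 1 m (fun s y => DpH S (secT y) (gradv (u s) (secT y))) s₁ s₂)

/-- Admissible pairs for the stationary (ergodic) problem:
`σ Δ m + div(m α) = 0` in the sense of distributions and `α ∈ L²_m`. -/
def StatAdm {d : ℕ} (σ : ℝ) (m : PTd d) (α : Td d → Vd d) : Prop :=
  Measurable α ∧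
  (∫⁻ y, ENNReal.ofReal (sqnorm (α y)) ∂(m : Measure (Td d))) < ⊤ ∧
  ∀ g : Vd d → ℝ, ContDiff ℝ 2 g → (∀ (x : Vd d) (z : Fin d → ℤ), g (x + intVec z) = g x) →
    (∫ y, (σ * lapl g (secT y) - dotp (α y) (gradv g (secT y))) ∂(m : Measure (Td d))) = 0

/-- `ergInf S σ = -λ̄`, the value of the stationary minimization problem. -/
def ergInf {d : ℕ} (S : MFGSetting d) (σ : ℝ) : ℝ :=
  sInf { r | ∃ m α, StatAdm σ m α ∧
    r = (∫ y, S.Hstar (secT y) (α y) ∂(m : Measure (Td d))) + S.Fc m }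

/-- The set of values over which the dynamic programming principle for a corrector
`χ` takes its infimum. -/
def DPPval {d : ℕ} (S : MFGSetting d) (σ : ℝ) (χ : PTd d → ℝ) (lam t : ℝ) (m₀ : PTd d) :
    Set ℝ :=
  { r | ∃ m α, AdmOn S σ m₀ t m α ∧
      r = (∫ s in (0:ℝ)..t, runCost S m α s) + χ (m t) + lam * t }

/-- `χ` is a corrector function: it is continuous and satisfies the dynamic
programming principle with the critical value `λ`. -/
def IsCorrector {d : ℕ} (S : MFGSetting d) (σ : ℝ) (lam : ℝ) (χ : PTd d → ℝ) : Prop :=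
  W1Continuous χ ∧ ∀ (m₀ : PTd d) (t : ℝ), 0 < t → χ m₀ = sInf (DPPval S σ χ lam t m₀)

/-- `(m,α)` is a calibrated curve (defined on all of `ℝ`). -/
def IsCalibrated {d : ℕ} (S : MFGSetting d) (σ : ℝ) (lam : ℝ)
    (m : ℝ → PTd d) (α : ℝ → Td d → Vd d) : Prop :=
  W1ContOn m Set.univ ∧
  (∀ s₁ s₂ : ℝ, s₁ ≤ s₂ → FPeq σ m α s₁ s₂) ∧
  Measurable (fun q : ℝ × Td d => α q.1 q.2) ∧
  (∀ t₁ t₂ : ℝ, (∫⁻ s in Set.Ioc t₁ t₂,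
      ∫⁻ y, ENNReal.ofReal (sqnorm (α s y)) ∂(m s : Measure (Td d))) < ⊤) ∧
  (∀ t₁ t₂ : ℝ, IntervalIntegrable (runCost S m α) volume t₁ t₂) ∧
  ∃ χ : PTd d → ℝ, IsCorrector S σ lam χ ∧ ∀ t₁ t₂ : ℝ, t₁ < t₂ →
    χ (m t₁) = lam * (t₂ - t₁) + (∫ s in t₁..t₂, runCost S m α s) + χ (m t₂)

/-- The projected Mather set. -/
def MatherSet {d : ℕ} (S : MFGSetting d) (σ : ℝ) (lam : ℝ) : Set (PTd d) :=
  { μ | ∃ m α, IsCalibrated S σ lam m α ∧ m 0 = μ }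

/-- Invariant subsets of the projected Mather set. -/
def IsInvariantMFG {d : ℕ} (S : MFGSetting d) (σ : ℝ) (lam : ℝ) (C : Set (PTd d)) : Prop :=
  ∀ μ ∈ C, ∃ m α, IsCalibrated S σ lam m α ∧ m 0 = μ ∧ ∀ t : ℝ, m t ∈ C

/-- Minimal invariant subsets of the projected Mather set. -/
def IsMinimalInvariant {d : ℕ} (S : MFGSetting d) (σ : ℝ) (lam : ℝ) (N : Set (PTd d)) : Prop :=
  N.Nonempty ∧ N ⊆ MatherSet S σ lam ∧ IsClosedW1 N ∧ IsInvariantMFG S σ lam N ∧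
  ∀ C : Set (PTd d), C ⊆ N → C.Nonempty → IsClosedW1 C → IsInvariantMFG S σ lam C → C = N

/-- `δ 𝒱_δ → -λ` uniformly as `δ → 0⁺`. -/
def IsLimitValueV {d : ℕ} (S : MFGSetting d) (σ : ℝ) (lam : ℝ) : Prop :=
  ∀ ε > 0, ∃ δ₀ > 0, ∀ δ : ℝ, 0 < δ → δ ≤ δ₀ → ∀ μ : PTd d,
    |δ * Vfun S σ δ μ - (-lam)| < ε

/-- `𝒰(T,·)/T → -λ` uniformly as `T → ∞`. -/
def IsLimitValueU {d : ℕ} (S : MFGSetting d) (σ : ℝ) (lam : ℝ) : Prop :=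
  ∀ ε > 0, ∃ T₀ : ℝ, ∀ T : ℝ, T₀ ≤ T → ∀ μ : PTd d,
    |Ufun S σ T μ / T - (-lam)| < ε

/-- A function `Φ` on `P(𝕋^d)` is `C¹` with flat derivative `dΦ` (normalized so that
`∫ dΦ(m,·) dm = 0`, periodic in the space variable and jointly continuous). -/
def IsC1Flat {d : ℕ} (Φ : PTd d → ℝ) (dΦ : Measure (Td d) → Vd d → ℝ) : Prop :=
  (∀ (μ : Measure (Td d)) (x : Vd d) (z : Fin d → ℤ), dΦ μ (x + intVec z) = dΦ μ x) ∧
  (∀ μ ν : PTd d,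
    Φ ν - Φ μ = ∫ t in Set.Icc (0:ℝ) 1,
      ((∫ y, dΦ (lineComb t μ ν) (secT y) ∂(ν : Measure (Td d))) -
        ∫ y, dΦ (lineComb t μ ν) (secT y) ∂(μ : Measure (Td d)))) ∧
  (∀ μ : PTd d, (∫ y, dΦ (μ : Measure (Td d)) (secT y) ∂(μ : Measure (Td d))) = 0) ∧
  (∀ ε > 0, ∀ (μ : PTd d) (x : Vd d), ∃ η > 0, ∀ (ν : PTd d) (x' : Vd d),
    W1 μ ν < η → ‖x' - x‖ < η → |dΦ (ν : Measure (Td d)) x' - dΦ (μ : Measure (Td d)) x| < ε)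

open scoped Topology

/-- projection to the torus -/
def prT {d : ℕ} (x : Vd d) : Td d := fun i => (x i : AddCircle (1:ℝ))

lemma prT_quot (d : ℕ) : IsOpenQuotientMap (prT (d := d)) := by
  have : IsOpenQuotientMap (Pi.map (fun (i : Fin d) (x : ℝ) => (x : AddCircle (1:ℝ)))) :=
    IsOpenQuotientMap.piMap (fun i => QuotientAddGroup.isOpenQuotientMap_mk)
  exact this

lemma prT_secT {d : ℕ} (y : Td d) : prT (secT y) = y := by
  funext i
  exact AddCircle.coe_equivIco

lemma secT_prT {d : ℕ} (x : Vd d) : ∃ z : Fin d → ℤ, secT (prT x) = x + intVec z := by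
  refine ⟨fun i => -⌊x i⌋, ?_⟩
  funext i
  have h := AddCircle.coe_equivIco_mk_apply (p := (1:ℝ)) (x i)
  simp only [secT, prT, intVec, Pi.add_apply]
  refine h.trans ?_
  push_cast
  rw [div_one, mul_one, Int.fract]; ring

lemma secT_mem {d : ℕ} (y : Td d) : secT y ∈ Set.Icc (0 : Vd d) 1 := by
  have h : ∀ i, secT y i ∈ Set.Ico (0:ℝ) (0+1) := fun i => ((AddCircle.equivIco 1 0) (y i)).2
  exact ⟨fun i => (h i).1, fun i => by have := (h i).2.le; simpa using this⟩

lemma secT_meas (d : ℕ) : Measurable (secT (d := d)) := by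
  refine measurable_pi_lambda _ fun i => ?_
  have : Measurable (fun y : AddCircle (1:ℝ) => ((AddCircle.equivIco 1 0 y : Set.Ico (0:ℝ) (0+1)) : ℝ)) :=
    measurable_subtype_coe.comp (AddCircle.measurableEquivIco (1:ℝ) 0).measurable
  exact this.comp (measurable_pi_apply i)

/-- periodic in the first variable -/
lemma per_secT {d : ℕ} {β : Type*} {f : Vd d → β} (hf : ∀ (x : Vd d) (z : Fin d → ℤ), f (x + intVec z) = f x)
    (x : Vd d) : f (secT (prT x)) = f x := by
  obtain ⟨z, hz⟩ := secT_prT x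
  rw [hz, hf]

lemma cont_secT {d : ℕ} {β : Type*} [TopologicalSpace β] {f : Vd d → β} (hc : Continuous f)
    (hf : ∀ (x : Vd d) (z : Fin d → ℤ), f (x + intVec z) = f x) :
    Continuous (fun y : Td d => f (secT y)) := by
  rw [← (prT_quot d).continuous_comp_iff]
  refine hc.congr fun x => ?_
  exact (per_secT hf x).symm

lemma cont_secT2 {d : ℕ} {X β : Type*} [TopologicalSpace X] [TopologicalSpace β] {f : Vd d → X → β}
    (hc : Continuous (fun q : Vd d × X => f q.1 q.2))
    (hf : ∀ (x : Vd d) (z : Fin d → ℤ) p, f (x + intVec z) p = f x p) :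
    Continuous (fun q : Td d × X => f (secT q.1) q.2) := by
  rw [← ((prT_quot d).prodMap (IsOpenQuotientMap.id (X := X))).continuous_comp_iff]
  refine hc.congr fun q => ?_
  exact (congrFun (per_secT (f := f) (fun x z => funext (hf x z)) q.1) q.2).symm

/-- bounded by periodicity -/
lemma per_bdd {d : ℕ} {f : Vd d → ℝ} (hc : Continuous f)
    (hf : ∀ (x : Vd d) (z : Fin d → ℤ), f (x + intVec z) = f x) :
    ∃ M, 0 ≤ M ∧ ∀ x, |f x| ≤ M := by
  obtain ⟨M, hM⟩ := (isCompact_Icc (a := (0 : Vd d)) (b := 1)).exists_bound_of_continuousOn hc.continuousOn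
  refine ⟨M, (norm_nonneg _).trans (hM 0 ⟨le_rfl, fun i => zero_le_one⟩), fun x => ?_⟩
  rw [← per_secT hf x]
  exact hM _ (secT_mem _)

lemma fderiv_per {d : ℕ} {f : Vd d → ℝ}
    (hf : ∀ (x : Vd d) (z : Fin d → ℤ), f (x + intVec z) = f x) (x : Vd d) (z : Fin d → ℤ) :
    fderiv ℝ f (x + intVec z) = fderiv ℝ f x := by
  have : (fun x => f (x + intVec z)) = f := funext fun x => hf x z
  rw [← fderiv_comp_add_right, this]

lemma gradv_per {d : ℕ} {f : Vd d → ℝ}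
    (hf : ∀ (x : Vd d) (z : Fin d → ℤ), f (x + intVec z) = f x) (x : Vd d) (z : Fin d → ℤ) :
    gradv f (x + intVec z) = gradv f x := by
  funext i
  simp only [gradv, fderiv_per hf]

lemma D2_per {d : ℕ} {f : Vd d → ℝ}
    (hf : ∀ (x : Vd d) (z : Fin d → ℤ), f (x + intVec z) = f x) (v w x : Vd d) (z : Fin d → ℤ) :
    D2 f (x + intVec z) v w = D2 f x v w := by
  unfold D2
  rw [fderiv_per (f := fun y => fderiv ℝ f y v) (fun x z => by rw [fderiv_per hf])]

lemma lapl_per {d : ℕ} {f : Vd d → ℝ}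
    (hf : ∀ (x : Vd d) (z : Fin d → ℤ), f (x + intVec z) = f x) (x : Vd d) (z : Fin d → ℤ) :
    lapl f (x + intVec z) = lapl f x := by
  simp only [lapl, D2_per hf]

lemma contDiff_fderiv_apply {d : ℕ} {f : Vd d → ℝ} (hf : ContDiff ℝ 2 f) (v : Vd d) :
    ContDiff ℝ 1 (fun y => fderiv ℝ f y v) :=
  (hf.fderiv_right (m := 1) (by norm_num)).clm_apply contDiff_const

lemma gradv_cont {d : ℕ} {f : Vd d → ℝ} (hf : ContDiff ℝ 2 f) : Continuous (gradv f) :=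
  continuous_pi fun i => (contDiff_fderiv_apply hf _).continuous

lemma D2_cont {d : ℕ} {f : Vd d → ℝ} (hf : ContDiff ℝ 2 f) (v w : Vd d) :
    Continuous (fun x => D2 f x v w) := by
  have h := ((contDiff_fderiv_apply hf v).fderiv_right (m := 0) (by norm_num)).continuous
  exact h.clm_apply continuous_const

lemma lapl_cont {d : ℕ} {f : Vd d → ℝ} (hf : ContDiff ℝ 2 f) : Continuous (lapl f) :=
  continuous_finsetSum _ fun i _ => D2_cont hf _ _

lemma fderiv_eq_dotp {d : ℕ} (f : Vd d → ℝ) (x v : Vd d) :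
    fderiv ℝ f x v = dotp (gradv f x) v := by
  conv_lhs => rw [pi_eq_sum_univ' v]
  simp only [map_sum, map_smul, dotp, gradv]
  refine Finset.sum_congr rfl fun i _ => ?_
  rw [smul_eq_mul, mul_comm]

/-- integrals of pure derivatives against Lebesgue vanish -/
lemma integral_fderiv_zero {d : ℕ} {f : Vd d → ℝ} (hf : ContDiff ℝ 1 f)
    (hp : ∀ (x : Vd d) (z : Fin d → ℤ), f (x + intVec z) = f x) (v : Vd d) :
    ∫ y : Td d, fderiv ℝ f (secT y) v = 0 := by
  have hc : Continuous (fun x => fderiv ℝ f x v) := (hf.continuous_fderiv (by norm_num)).clm_apply continuous_const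
  have hper : ∀ (x : Vd d) (z : Fin d → ℤ), fderiv ℝ f (x + intVec z) v = fderiv ℝ f x v :=
    fun x z => by rw [fderiv_per hp]
  obtain ⟨M, hM0, hM⟩ := per_bdd hc hper
  have key := hasDerivAt_integral_of_dominated_loc_of_deriv_le (μ := (volume : Measure (Td d))) (𝕜 := ℝ)
    (F := fun t y => f (secT y + t • v)) (F' := fun t y => fderiv ℝ f (secT y + t • v) v)
    (x₀ := 0) (s := univ) (bound := fun _ => M) univ_mem
    (Eventually.of_forall fun t => (hf.continuous.measurable.comp
        ((secT_meas d).add_const _)).aestronglyMeasurable)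
    (by
      simp only [zero_smul, add_zero]
      exact ((cont_secT hf.continuous hp).integrable_of_hasCompactSupport
        (HasCompactSupport.of_compactSpace _)))
    ((hc.measurable.comp ((secT_meas d).add_const _)).aestronglyMeasurable)
    (ae_of_all _ fun y t _ => hM _) (integrable_const _)
    (ae_of_all _ fun y t _ => by
      have h1 : HasDerivAt (fun t : ℝ => secT y + t • v) v t := by
        simpa using ((hasDerivAt_id t).smul_const v).const_add (secT y)
      exact ((hf.differentiable (by norm_num)) _).hasFDerivAt.comp_hasDerivAt t h1)
  have h2 : ∀ t : ℝ, ∫ y : Td d, f (secT y + t • v) = ∫ y : Td d, f (secT y) := by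
    intro t
    have : ∀ y : Td d, f (secT y + t • v) = f (secT (y + prT (t • v))) := by
      intro y
      rw [← per_secT hp (secT y + t • v)]
      congr 2
      funext i
      have := congrFun (prT_secT y) i
      simp only [prT, Pi.add_apply] at this ⊢
      rw [AddCircle.coe_add, this]
    simp_rw [this]
    exact integral_add_right_eq_self (μ := (volume : Measure (Td d))) (fun y => f (secT y)) (prT (t • v))
  have h3 := key.2
  simp only [h2] at h3
  have := h3.unique (hasDerivAt_const _ _)
  simpa using this

lemma abs_le_sqnorm {d : ℕ} (a : Vd d) (i : Fin d) : (a i)^2 ≤ sqnorm a :=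
  Finset.single_le_sum (f := fun i => (a i)^2) (fun _ _ => sq_nonneg _) (Finset.mem_univ i)

lemma sqnorm_nonneg {d : ℕ} (a : Vd d) : 0 ≤ sqnorm a := Finset.sum_nonneg fun _ _ => sq_nonneg _

lemma sqnorm_cont {d : ℕ} : Continuous (sqnorm (d := d)) := by unfold sqnorm; fun_prop

lemma dotp_cont {d : ℕ} : Continuous (fun q : Vd d × Vd d => dotp q.1 q.2) := by
  unfold dotp; fun_prop

lemma integrable_cont {d : ℕ} (μ : Measure (Td d)) [IsFiniteMeasure μ] {f : Td d → ℝ} (hf : Continuous f) :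
    Integrable f μ := hf.integrable_of_hasCompactSupport (HasCompactSupport.of_compactSpace _)

/-- L² control gives integrable components -/
lemma comp_memLp {Ω : Type*} [MeasurableSpace Ω] {d : ℕ} (μ : Measure Ω) {a : Ω → Vd d}
    (ha : Measurable a) (h2 : (∫⁻ y, ENNReal.ofReal (sqnorm (a y)) ∂μ) < ⊤) (i : Fin d) :
    MemLp (fun y => a y i) 2 μ := by
  have hm : Measurable (fun y => a y i) := (measurable_pi_apply i).comp ha
  rw [memLp_two_iff_integrable_sq hm.aestronglyMeasurable]
  refine ⟨(hm.pow_const 2).aestronglyMeasurable, ?_⟩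
  refine lt_of_le_of_lt ?_ h2
  refine lintegral_mono fun y => ?_
  rw [Real.enorm_eq_ofReal (sq_nonneg _)]
  exact ENNReal.ofReal_le_ofReal (abs_le_sqnorm _ i)

lemma dotp_integrable {Ω : Type*} [MeasurableSpace Ω] {d : ℕ} (μ : Measure Ω) {a b : Ω → Vd d}
    (ha : ∀ i, MemLp (fun y => a y i) 2 μ) (hb : ∀ i, MemLp (fun y => b y i) 2 μ) :
    Integrable (fun y => dotp (a y) (b y)) μ := by
  unfold dotp
  exact integrable_finsetSum _ fun i _ => (ha i).integrable_mul (hb i)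

lemma cont_memLp {d : ℕ} (μ : Measure (Td d)) [IsFiniteMeasure μ] {f : Td d → ℝ} (hf : Continuous f) :
    MemLp f 2 μ := by
  rw [memLp_two_iff_integrable_sq (hf.measurable.aestronglyMeasurable)]
  exact integrable_cont μ (hf.pow 2)

instance volProb (d : ℕ) : IsProbabilityMeasure (volume : Measure (Td d)) := by
  constructor
  rw [← Set.pi_univ univ, volume_pi_pi]
  simp [AddCircle.measure_univ]

/-- Lebesgue measure on the torus -/
def volT (d : ℕ) : PTd d := ⟨volume, volProb d⟩

lemma stat_vol (d : ℕ) : StatAdm 1 (volT d) (fun _ => 0) := by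
  refine ⟨measurable_const, by simp [sqnorm], fun g hg hp => ?_⟩
  have h0 : ∀ b : Vd d, dotp 0 b = 0 := fun b => by simp [dotp]
  simp only [h0, one_mul, sub_zero]
  change ∫ y : Td d, lapl g (secT y) = 0
  unfold lapl
  rw [integral_finsetSum _ fun i _ => integrable_cont volume (cont_secT (D2_cont hg _ _) (fun x z => D2_per hp _ _ x z))]
  refine Finset.sum_eq_zero fun i _ => ?_
  exact integral_fderiv_zero (contDiff_fderiv_apply hg _) (fun x z => by rw [fderiv_per hp]) _

lemma tderiv_eq {d : ℕ} {φ : ℝ → Vd d → ℝ} (hφ : IsTestFun φ) (s : ℝ) (x : Vd d) :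
    HasDerivAt (fun s => φ s x) (fderiv ℝ (fun q : ℝ × Vd d => φ q.1 q.2) (s, x) (1, 0)) s := by
  have h1 : HasDerivAt (fun s : ℝ => (s, x)) ((1:ℝ), (0: Vd d)) s :=
    (hasDerivAt_id s).prodMk (hasDerivAt_const _ _)
  exact ((hφ.1.differentiable (by norm_num)) (s, x)).hasFDerivAt.comp_hasDerivAt s h1

lemma tderiv_cont {d : ℕ} {φ : ℝ → Vd d → ℝ} (hφ : IsTestFun φ) :
    Continuous (fun q : ℝ × Vd d => tderiv φ q.1 q.2) := by
  have : (fun q : ℝ × Vd d => tderiv φ q.1 q.2) =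
      fun q => fderiv ℝ (fun q : ℝ × Vd d => φ q.1 q.2) q (1, 0) := by
    funext q
    exact (tderiv_eq hφ q.1 q.2).deriv
  rw [this]
  exact (hφ.1.continuous_fderiv (by norm_num)).clm_apply continuous_const

lemma tderiv_cont_secT {d : ℕ} {φ : ℝ → Vd d → ℝ} (hφ : IsTestFun φ) :
    Continuous (fun q : ℝ × Td d => tderiv φ q.1 (secT q.2)) := by
  have h := cont_secT2 (f := fun (x : Vd d) (s : ℝ) => tderiv φ s x)
    ((tderiv_cont hφ).comp continuous_swap) (fun x z s => by
      simp only [tderiv, hφ.2])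
  exact h.comp continuous_swap

lemma const_FP {d : ℕ} {μ : PTd d} {a : Td d → Vd d} (h : StatAdm 1 μ a) {s₁ s₂ : ℝ} (hs : s₁ ≤ s₂) :
    FPeq 1 (fun _ => μ) (fun _ => a) s₁ s₂ := by
  intro φ hφ
  obtain ⟨ha, ha2, hst⟩ := h
  have hC : ∀ s, ContDiff ℝ 2 (φ s) := fun s => hφ.1.comp (contDiff_prodMk_right s)
  have inner : ∀ s, (∫ y, (tderiv φ s (secT y) + 1 * lapl (φ s) (secT y)
        - dotp (a y) (gradv (φ s) (secT y))) ∂(μ : Measure (Td d))) =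
      ∫ y, tderiv φ s (secT y) ∂(μ : Measure (Td d)) := by
    intro s
    have h1 : Integrable (fun y => tderiv φ s (secT y)) (μ : Measure (Td d)) :=
      integrable_cont _ ((tderiv_cont_secT hφ).comp (Continuous.prodMk_right s))
    have h2 : Integrable (fun y => 1 * lapl (φ s) (secT y) - dotp (a y) (gradv (φ s) (secT y))) (μ : Measure (Td d)) := by
      refine Integrable.sub ((integrable_cont _ (cont_secT (lapl_cont (hC s)) (lapl_per (hφ.2 s)))).const_mul 1) ?_
      refine dotp_integrable _ (comp_memLp _ ha ha2) fun i => cont_memLp _ ?_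
      exact (continuous_apply i).comp (cont_secT (gradv_cont (hC s)) (gradv_per (hφ.2 s)))
    have h3 := integral_add h1 h2
    rw [hst _ (hC s) (hφ.2 s), add_zero] at h3
    rw [← h3]
    congr 1; funext y; ring
  simp only [inner]
  rw [intervalIntegral.integral_of_le hs, integral_integral_swap]
  · rw [← integral_sub (integrable_cont _ (cont_secT (hC s₂).continuous (hφ.2 s₂)))
      (integrable_cont _ (cont_secT (hC s₁).continuous (hφ.2 s₁)))]
    congr 1; funext y
    rw [← intervalIntegral.integral_of_le hs]
    symm
    refine intervalIntegral.integral_eq_sub_of_hasDerivAt (f := fun s => φ s (secT y)) (fun s _ => ?_) ?_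
    · have := tderiv_eq hφ s (secT y)
      have h2 : tderiv φ s (secT y) = _ := this.deriv
      rw [h2]; exact this
    · exact ((tderiv_cont hφ).comp (Continuous.prodMk_left (secT y))).intervalIntegrable _ _
  · obtain ⟨M, hM⟩ := (isCompact_Icc (a := s₁) (b := s₂)).prod (isCompact_univ (X := Td d)) |>.exists_bound_of_continuousOn
      (tderiv_cont_secT hφ).continuousOn
    refine Integrable.of_bound (C := M) (tderiv_cont_secT hφ).aestronglyMeasurable ?_
    have : ((volume.restrict (Ioc s₁ s₂)).prod (μ : Measure (Td d))) =
      (volume.prod (μ : Measure (Td d))).restrict (Ioc s₁ s₂ ×ˢ univ) := by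
      rw [← Measure.prod_restrict, Measure.restrict_univ]
    rw [this]
    refine (ae_restrict_iff' (measurableSet_Ioc.prod MeasurableSet.univ)).2 (ae_of_all _ fun q hq => ?_)
    exact hM q ⟨Ioc_subset_Icc_self hq.1, hq.2⟩

lemma W1_self {d : ℕ} (μ : PTd d) : W1 μ μ = 0 := by
  unfold W1
  have : { r | ∃ φ : Td d → ℝ, LipschitzWith 1 φ ∧
    r = (∫ y, φ y ∂(μ : Measure (Td d))) - ∫ y, φ y ∂(μ : Measure (Td d)) } = {0} := by
    ext r
    simp only [sub_self, mem_ofPred_eq, mem_singleton_iff]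
    constructor
    · rintro ⟨φ, _, h⟩; exact h
    · intro h; exact ⟨fun _ => 0, (LipschitzWith.const (0:ℝ)).weaken zero_le_one, h⟩
  rw [this, csSup_singleton]

lemma const_adm {d : ℕ} (S : MFGSetting d) {μ : PTd d} {a : Td d → Vd d} (h : StatAdm 1 μ a) {T : ℝ} :
    AdmOn S 1 μ T (fun _ => μ) (fun _ => a) := by
  refine ⟨rfl, ?_, fun s₁ s₂ _ hs _ => const_FP h hs, h.1.comp measurable_snd, ?_, ?_⟩
  · intro t _ ε hε
    exact ⟨1, one_pos, fun s _ _ => by rw [W1_self]; exact hε⟩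
  · rw [lintegral_const]
    refine ENNReal.mul_lt_top h.2.1 ?_
    simp
  · exact intervalIntegrable_const

lemma H_cont {d : ℕ} (S : MFGSetting d) : Continuous (fun q : Vd d × Vd d => S.H q.1 q.2) := S.H_smooth.continuous

lemma H0_bdd {d : ℕ} (S : MFGSetting d) : ∃ M, 0 ≤ M ∧ ∀ x, |S.H x 0| ≤ M :=
  per_bdd ((H_cont S).comp (Continuous.prodMk_left 0)) fun x z => S.H_per x z 0

lemma cost_lower {d : ℕ} (S : MFGSetting d) : ∃ M, ∀ (μ : PTd d) (a : Td d → Vd d),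
    -M ≤ (∫ y, S.Hstar (secT y) (a y) ∂(μ : Measure (Td d))) + S.Fc μ := by
  obtain ⟨M, hM0, hM⟩ := H0_bdd S
  obtain ⟨N, hN⟩ := S.Fc_bounded
  refine ⟨M + N, fun μ a => ?_⟩
  have h1 : -M ≤ ∫ y, S.Hstar (secT y) (a y) ∂(μ : Measure (Td d)) := by
    by_cases hi : Integrable (fun y => S.Hstar (secT y) (a y)) (μ : Measure (Td d))
    · have : ∫ y, (-M) ∂(μ : Measure (Td d)) ≤ ∫ y, S.Hstar (secT y) (a y) ∂(μ : Measure (Td d)) := by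
        refine integral_mono (integrable_const _) hi fun y => ?_
        have h := (S.Hstar_eq (secT y) (a y)).1 (mem_range_self 0)
        have h2 : dotp (a y) 0 = 0 := by simp [dotp]
        simp only [h2, zero_sub] at h
        have := (abs_le.1 (hM (secT y))).2
        show -M ≤ _
        linarith
      simpa using this
    · rw [integral_undef hi]; linarith
  have := (abs_le.1 (hN μ)).1
  linarith

lemma costT_lower {d : ℕ} (S : MFGSetting d) : ∃ M, ∀ (T : ℝ) (_ : 0 ≤ T) (m : ℝ → PTd d) (α : ℝ → Td d → Vd d),
    IntervalIntegrable (runCost S m α) volume 0 T → -M * T ≤ costT S m α T := by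
  obtain ⟨M, hM⟩ := cost_lower S
  refine ⟨M, fun T hT m α hi => ?_⟩
  have := intervalIntegral.integral_mono_on (μ := volume) hT (f := fun _ => -M) (g := runCost S m α)
    intervalIntegrable_const hi (fun s _ => hM (m s) (α s))
  simp only [intervalIntegral.integral_const, smul_eq_mul, sub_zero] at this
  unfold costT
  linarith

lemma dir1 {d : ℕ} (S : MFGSetting d) {lam : ℝ} (hlam : IsLimitValueU S 1 lam) {μ : PTd d} {a : Td d → Vd d}
    (h : StatAdm 1 μ a) : -lam ≤ (∫ y, S.Hstar (secT y) (a y) ∂(μ : Measure (Td d))) + S.Fc μ := by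
  refine le_of_forall_pos_lt_add fun ε hε => ?_
  obtain ⟨T₀, hT₀⟩ := hlam ε hε
  obtain ⟨M, hM⟩ := costT_lower S
  set T := max T₀ 1 with hTdef
  have hT1 : 1 ≤ T := le_max_right _ _
  have h1 := hT₀ T (le_max_left _ _) μ
  set c := (∫ y, S.Hstar (secT y) (a y) ∂(μ : Measure (Td d))) + S.Fc μ with hc
  have h2 : Ufun S 1 T μ ≤ T * c := by
    refine csInf_le ⟨-M * T, ?_⟩ ⟨_, _, const_adm S h, ?_⟩
    · rintro r ⟨m, α, hadm, rfl⟩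
      exact hM T (by linarith) m α hadm.2.2.2.2.2
    · unfold costT runCost
      simp [hc, mul_add]
  have h3 : Ufun S 1 T μ / T ≤ c := by
    rw [div_le_iff₀ (by linarith)]; linarith
  have := (abs_lt.1 h1).1
  linarith

lemma exists_good {d : ℕ} (S : MFGSetting d) {lam : ℝ} (hlam : IsLimitValueU S 1 lam) {ε : ℝ} (hε : 0 < ε) :
    ∃ T m α, ε⁻¹ ≤ T ∧ 1 ≤ T ∧ AdmOn S 1 (volT d) T m α ∧ costT S m α T ≤ T * (-lam + ε) := by
  obtain ⟨T₀, hT₀⟩ := hlam (ε/2) (by positivity)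
  set T := max T₀ (max 1 ε⁻¹) with hTdef
  have hT1 : 1 ≤ T := (le_max_left _ _).trans (le_max_right _ _)
  have hT2 : ε⁻¹ ≤ T := (le_max_right _ _).trans (le_max_right _ _)
  have h1 := hT₀ T (le_max_left _ _) (volT d)
  have hne : { r | ∃ m α, AdmOn S 1 (volT d) T m α ∧ r = costT S m α T }.Nonempty :=
    ⟨_, _, _, const_adm S (stat_vol d), rfl⟩
  have h2 : Ufun S 1 T (volT d) < T * (-lam + ε) := by
    have := (abs_lt.1 h1).2
    have h3 : Ufun S 1 T (volT d) / T < -lam + ε := by linarith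
    rw [div_lt_iff₀ (by linarith)] at h3
    linarith
  obtain ⟨r, ⟨m, α, hadm, rfl⟩, hr⟩ := exists_lt_of_csInf_lt hne h2
  exact ⟨T, m, α, hT2, hT1, hadm, hr.le⟩

lemma taylor1 {h h' h'' : ℝ → ℝ} (d1 : ∀ t, HasDerivAt h (h' t) t) (d2 : ∀ t, HasDerivAt h' (h'' t) t)
    {a : ℝ} (ha : ∀ t, a ≤ h'' t) : h 0 + h' 0 + a / 2 ≤ h 1 := by
  have k1 : ∀ t, HasDerivAt (fun t => h' t - a * t) (h'' t - a) t := fun t => by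
    have := (d2 t).fun_sub ((hasDerivAt_id' t).const_mul a)
    rwa [mul_one] at this
  have km : Monotone (fun t => h' t - a * t) :=
    monotone_of_deriv_nonneg (fun t => (k1 t).differentiableAt) (fun t => by
      rw [(k1 t).deriv]; linarith [ha t])
  have l1 : ∀ t, HasDerivAt (fun t => h t - h' 0 * t - a / 2 * t ^ 2) (h' t - h' 0 - a * t) t := fun t => by
    have := ((d1 t).fun_sub ((hasDerivAt_id' t).const_mul (h' 0))).fun_sub ((hasDerivAt_pow 2 t).const_mul (a/2))
    have e : h' t - h' 0 - a * t = h' t - h' 0 * 1 - a / 2 * (((2:ℕ):ℝ) * t ^ (2 - 1)) := by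
      norm_num; ring
    rw [e]; exact this
  have lm : MonotoneOn (fun t => h t - h' 0 * t - a / 2 * t ^ 2) (Icc 0 1) := by
    refine monotoneOn_of_deriv_nonneg (convex_Icc 0 1) (fun t _ => (l1 t).continuousAt.continuousWithinAt)
      (fun t _ => (l1 t).differentiableAt.differentiableWithinAt) fun t ht => ?_
    rw [(l1 t).deriv]
    rw [interior_Icc] at ht
    have := km ht.1.le
    simp at this
    linarith
  have := lm (left_mem_Icc.2 zero_le_one) (right_mem_Icc.2 zero_le_one) zero_le_one
  simp at this
  linarith

lemma taylor1' {h h' h'' : ℝ → ℝ} (d1 : ∀ t, HasDerivAt h (h' t) t) (d2 : ∀ t, HasDerivAt h' (h'' t) t)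
    {a : ℝ} (ha : ∀ t, h'' t ≤ a) : h 1 ≤ h 0 + h' 0 + a / 2 := by
  have := taylor1 (h := fun t => - h t) (h' := fun t => - h' t) (h'' := fun t => - h'' t) (a := -a)
    (fun t => (d1 t).fun_neg) (fun t => (d2 t).fun_neg) (fun t => neg_le_neg (ha t))
  linarith

lemma line_deriv {d : ℕ} {f : Vd d → ℝ} (hf : ContDiff ℝ 2 f) (p v : Vd d) (t : ℝ) :
    HasDerivAt (fun t : ℝ => f (p + t • v)) (fderiv ℝ f (p + t • v) v) t ∧
    HasDerivAt (fun t : ℝ => fderiv ℝ f (p + t • v) v) (D2 f (p + t • v) v v) t := by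
  have h1 : HasDerivAt (fun t : ℝ => p + t • v) v t := by
    simpa using ((hasDerivAt_id t).smul_const v).const_add p
  refine ⟨((hf.differentiable (by norm_num)) _).hasFDerivAt.comp_hasDerivAt t h1, ?_⟩
  exact (((contDiff_fderiv_apply hf v).differentiable (by norm_num)) (p + t • v)).hasFDerivAt.comp_hasDerivAt t h1

lemma Hp_smooth {d : ℕ} (S : MFGSetting d) (x : Vd d) : ContDiff ℝ 2 (fun p => S.H x p) :=
  S.H_smooth.comp (contDiff_prodMk_right x)

lemma DpH_eq {d : ℕ} (S : MFGSetting d) (x p : Vd d) : DpH S x p = gradv (fun p => S.H x p) p := rfl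

lemma H_low {d : ℕ} (S : MFGSetting d) (x p p' : Vd d) :
    S.H x p + dotp (DpH S x p) (p' - p) + S.Cbar⁻¹ / 2 * sqnorm (p' - p) ≤ S.H x p' := by
  have := taylor1 (fun t => (line_deriv (Hp_smooth S x) p (p' - p) t).1)
    (fun t => (line_deriv (Hp_smooth S x) p (p' - p) t).2) (fun t => S.Dpp_lower x _ _)
  rw [DpH_eq, ← fderiv_eq_dotp]
  simp only [zero_smul, add_zero, one_smul, add_sub_cancel] at this
  linarith

lemma H_up {d : ℕ} (S : MFGSetting d) (x p p' : Vd d) :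
    S.H x p' ≤ S.H x p + dotp (DpH S x p) (p' - p) + S.Cbar / 2 * sqnorm (p' - p) := by
  have := taylor1' (fun t => (line_deriv (Hp_smooth S x) p (p' - p) t).1)
    (fun t => (line_deriv (Hp_smooth S x) p (p' - p) t).2) (fun t => S.Dpp_upper x _ _)
  rw [DpH_eq, ← fderiv_eq_dotp]
  simp only [zero_smul, add_zero, one_smul, add_sub_cancel] at this
  linarith

lemma dotp_le {d : ℕ} (a b : Vd d) (c : ℝ) (hc : 0 < c) : dotp a b ≤ c / 2 * sqnorm a + c⁻¹ / 2 * sqnorm b := by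
  unfold dotp sqnorm
  rw [Finset.mul_sum, Finset.mul_sum, ← Finset.sum_add_distrib]
  refine Finset.sum_le_sum fun i _ => ?_
  have : 0 ≤ c⁻¹ / 2 * (c * a i - b i)^2 := by positivity
  have h2 : c⁻¹ / 2 * (c * a i - b i)^2 = c / 2 * a i ^ 2 + c⁻¹ / 2 * b i ^ 2 - a i * b i := by
    field_simp; ring
  linarith

lemma sqnorm_sub_le {d : ℕ} (a b : Vd d) : sqnorm (a - b) ≤ 2 * sqnorm a + 2 * sqnorm b := by
  unfold sqnorm
  rw [Finset.mul_sum, Finset.mul_sum, ← Finset.sum_add_distrib]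
  refine Finset.sum_le_sum fun i _ => ?_
  simp only [Pi.sub_apply]
  nlinarith [sq_nonneg (a i + b i)]

lemma sqnorm_neg {d : ℕ} (a : Vd d) : sqnorm (-a) = sqnorm a := by simp [sqnorm]

lemma dotp_sub_left {d : ℕ} (a b c : Vd d) : dotp (a - b) c = dotp a c - dotp b c := by
  simp [dotp, sub_mul]

lemma dotp_sub_right {d : ℕ} (a b c : Vd d) : dotp a (b - c) = dotp a b - dotp a c := by
  simp [dotp, mul_sub]

/-- existence of the maximiser -/
lemma exists_P {d : ℕ} (S : MFGSetting d) (x q : Vd d) : ∃ P, DpH S x P = q ∧ S.Hstar x q = dotp q P - S.H x P := by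
  have hcont : Continuous (fun p => dotp q p - S.H x p) :=
    (dotp_cont.comp (Continuous.prodMk_right q)).sub ((Hp_smooth S x).continuous)
  have hC := S.Cbar_pos
  set g := q - DpH S x 0 with hg
  have hbd : ∀ p, dotp q p - S.H x p ≤ S.Cbar * sqnorm g - S.H x 0 - S.Cbar⁻¹ / 4 * sqnorm p := by
    intro p
    have h1 := H_low S x 0 p
    have h2 := dotp_le g p (2 * S.Cbar) (by positivity)
    rw [hg, dotp_sub_left, ← hg] at h2
    simp only [sub_zero] at h1
    have : (2 * S.Cbar)⁻¹ / 2 = S.Cbar⁻¹ / 4 := by field_simp; norm_num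
    rw [this] at h2
    linarith
  obtain ⟨P, hP⟩ : ∃ P, ∀ p, dotp q p - S.H x p ≤ dotp q P - S.H x P := by
    refine hcont.exists_forall_ge ?_
    have hn : ∀ p : Vd d, ‖p‖ ^ 2 ≤ sqnorm p := by
      intro p
      have : ‖p‖ ≤ Real.sqrt (sqnorm p) := by
        rw [pi_norm_le_iff_of_nonneg (Real.sqrt_nonneg _)]
        intro i
        rw [Real.norm_eq_abs]
        exact Real.abs_le_sqrt (abs_le_sqnorm p i)
      calc ‖p‖^2 ≤ (Real.sqrt (sqnorm p))^2 := by gcongr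
        _ = _ := Real.sq_sqrt (sqnorm_nonneg p)
    have ht : Tendsto (fun p : Vd d => S.Cbar⁻¹ / 4 * ‖p‖ ^ 2) (cocompact (Vd d)) atTop :=
      Tendsto.const_mul_atTop (by positivity) ((tendsto_pow_atTop (by norm_num)).comp (tendsto_norm_cocompact_atTop))
    have ht2 : Tendsto (fun p : Vd d => S.Cbar * sqnorm g - S.H x 0 - S.Cbar⁻¹ / 4 * ‖p‖ ^ 2) (cocompact (Vd d)) atBot :=
      tendsto_atBot_add_const_left _ _ (tendsto_neg_atTop_atBot.comp ht)
    refine tendsto_atBot_mono (fun p => (hbd p).trans ?_) ht2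
    have := mul_le_mul_of_nonneg_left (hn p) (show 0 ≤ S.Cbar⁻¹ / 4 by positivity)
    linarith
  refine ⟨P, ?_, ?_⟩
  · have hloc : IsLocalMax (fun p => dotp q p - S.H x p) P := Eventually.of_forall hP
    have h0 := hloc.fderiv_eq_zero
    have hlin : HasFDerivAt (fun p => dotp q p) (∑ i, q i • (ContinuousLinearMap.proj (R := ℝ) (φ := fun _ : Fin d => ℝ) i)) P := by
      unfold dotp
      refine HasFDerivAt.fun_sum fun i _ => ?_
      exact (hasFDerivAt_apply i P).const_mul (q i)
    have hH := ((Hp_smooth S x).differentiable (by norm_num) P).hasFDerivAt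
    have h1 := (hlin.sub hH).fderiv
    have h2 : fderiv ℝ (fun p => dotp q p - S.H x p) P = 0 := h0
    funext i
    have h3 := h1.symm.trans h2
    have h4 := congrArg (fun L => L (Pi.single i 1)) h3
    simp [Pi.single_apply] at h4
    simp only [DpH]
    linarith
  · refine (S.Hstar_eq x q).unique ⟨?_, ?_⟩
    · rintro _ ⟨p, rfl⟩; exact hP p
    · intro b hb; exact hb (mem_range_self P)

/-- maximiser -/
def Pst {d : ℕ} (S : MFGSetting d) (x q : Vd d) : Vd d := (exists_P S x q).choose

lemma Pst1 {d : ℕ} (S : MFGSetting d) (x q : Vd d) : DpH S x (Pst S x q) = q := (exists_P S x q).choose_spec.1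
lemma Pst2 {d : ℕ} (S : MFGSetting d) (x q : Vd d) : S.Hstar x q = dotp q (Pst S x q) - S.H x (Pst S x q) :=
  (exists_P S x q).choose_spec.2

lemma Pst_dist {d : ℕ} (S : MFGSetting d) (x q p : Vd d) :
    sqnorm (Pst S x q - p) ≤ S.Cbar ^ 2 * sqnorm (q - DpH S x p) := by
  have hC := S.Cbar_pos
  set P := Pst S x q with hP
  have h1 := H_low S x p P
  have h2 := H_low S x P p
  rw [hP, Pst1, ← hP] at h2
  have h3 : sqnorm (p - P) = sqnorm (P - p) := by rw [← sqnorm_neg, neg_sub]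
  have h4 : dotp q (p - P) = - dotp q (P - p) := by rw [dotp_sub_right, dotp_sub_right]; ring
  have h5 := dotp_le (q - DpH S x p) (P - p) S.Cbar hC
  rw [dotp_sub_left] at h5
  rw [h3, h4] at h2
  have h6 : S.Cbar⁻¹ / 2 * sqnorm (P - p) ≤ S.Cbar / 2 * sqnorm (q - DpH S x p) := by linarith
  have h7 := mul_le_mul_of_nonneg_left h6 (show 0 ≤ 2 * S.Cbar by positivity)
  have h8 : 2 * S.Cbar * (S.Cbar⁻¹ / 2 * sqnorm (P - p)) = sqnorm (P - p) := by field_simp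
  rw [h8] at h7
  refine h7.trans (le_of_eq ?_)
  ring

lemma DpH_cont {d : ℕ} (S : MFGSetting d) : Continuous (fun q : Vd d × Vd d => DpH S q.1 q.2) := by
  refine continuous_pi fun i => ?_
  have h1 := (S.H_smooth.continuous_fderiv (by norm_num)).clm_apply
    (continuous_const (y := ((0 : Vd d), (Pi.single i 1 : Vd d))))
  refine h1.congr fun q => ?_
  have h2 : HasFDerivAt (fun p : Vd d => (q.1, p)) (ContinuousLinearMap.inr ℝ (Vd d) (Vd d)) q.2 :=
    hasFDerivAt_prodMk_right _ _
  have h3 := ((S.H_smooth.differentiable (by norm_num)) (q.1, q.2)).hasFDerivAt.comp q.2 h2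
  have h4 := h3.fderiv
  simp only [DpH]
  change _ = (fderiv ℝ ((fun q : Vd d × Vd d => S.H q.1 q.2) ∘ fun p : Vd d => (q.1, p)) q.2) (Pi.single i 1)
  rw [h4]
  simp

lemma DpH_per {d : ℕ} (S : MFGSetting d) (x : Vd d) (z : Fin d → ℤ) (p : Vd d) :
    DpH S (x + intVec z) p = DpH S x p := by
  funext i
  simp only [DpH, S.H_per]

lemma G0_bdd {d : ℕ} (S : MFGSetting d) : ∃ M, 0 ≤ M ∧ ∀ x, sqnorm (DpH S x 0) ≤ M := by
  obtain ⟨M, h0, h⟩ := per_bdd (f := fun x => sqnorm (DpH S x 0))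
    (sqnorm_cont.comp ((DpH_cont S).comp (Continuous.prodMk_left 0))) (fun x z => by simp only [DpH_per])
  exact ⟨M, h0, fun x => (le_abs_self _).trans (h x)⟩

lemma Pst_cont {d : ℕ} (S : MFGSetting d) : Continuous (fun q : Vd d × Vd d => Pst S q.1 q.2) := by
  rw [continuous_iff_continuousAt]
  intro r
  have hlim : Tendsto (fun q : Vd d × Vd d => S.Cbar ^ 2 * sqnorm (q.2 - DpH S q.1 (Pst S r.1 r.2))) (𝓝 r) (𝓝 0) := by
    have hc : Continuous (fun q : Vd d × Vd d => S.Cbar ^ 2 * sqnorm (q.2 - DpH S q.1 (Pst S r.1 r.2))) :=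
      continuous_const.mul (sqnorm_cont.comp (continuous_snd.sub
        ((DpH_cont S).comp (continuous_fst.prodMk continuous_const))))
    have := hc.tendsto r
    rw [Pst1] at this
    simpa [sqnorm] using this
  refine tendsto_pi_nhds.2 fun i => ?_
  rw [tendsto_iff_dist_tendsto_zero]
  have h2 : Tendsto (fun q : Vd d × Vd d => Real.sqrt (S.Cbar ^ 2 * sqnorm (q.2 - DpH S q.1 (Pst S r.1 r.2)))) (𝓝 r) (𝓝 0) := by
    have := (Real.continuous_sqrt.tendsto 0).comp hlim
    rw [Real.sqrt_zero] at this
    exact this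
  refine squeeze_zero (fun _ => dist_nonneg) (fun q => ?_) h2
  rw [Real.dist_eq]
  refine Real.abs_le_sqrt ?_
  exact (abs_le_sqnorm (Pst S q.1 q.2 - Pst S r.1 r.2) i).trans (Pst_dist S _ _ _)

lemma Hstar_cont {d : ℕ} (S : MFGSetting d) : Continuous (fun q : Vd d × Vd d => S.Hstar q.1 q.2) := by
  have : (fun q : Vd d × Vd d => S.Hstar q.1 q.2) =
    fun q => dotp q.2 (Pst S q.1 q.2) - S.H q.1 (Pst S q.1 q.2) := funext fun q => Pst2 S _ _
  rw [this]
  exact (dotp_cont.comp (continuous_snd.prodMk (Pst_cont S))).sub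
    ((H_cont S).comp (continuous_fst.prodMk (Pst_cont S)))

lemma Hstar_young {d : ℕ} (S : MFGSetting d) (x q p : Vd d) : dotp q p - S.H x p ≤ S.Hstar x q :=
  (S.Hstar_eq x q).1 (mem_range_self p)

lemma Hstar_young' {d : ℕ} (S : MFGSetting d) (x q p : Vd d) :
    S.Hstar x q - S.Cbar / 2 * sqnorm (p - Pst S x q) ≤ dotp q p - S.H x p := by
  have := H_up S x (Pst S x q) p
  rw [Pst1, dotp_sub_right] at this
  rw [Pst2]
  linarith

lemma Hstar_bounds {d : ℕ} (S : MFGSetting d) : ∃ c C, 0 < c ∧ 0 ≤ C ∧ ∀ x q,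
    c * sqnorm q - C ≤ S.Hstar x q ∧ |S.Hstar x q| ≤ C * (1 + sqnorm q) := by
  obtain ⟨M, hM0, hM⟩ := H0_bdd S
  obtain ⟨G, hG0, hG⟩ := G0_bdd S
  have hC := S.Cbar_pos
  have hCi : 0 < S.Cbar⁻¹ := by positivity
  refine ⟨S.Cbar⁻¹ / 4, M + S.Cbar⁻¹ * G + S.Cbar * (1 + G), by positivity, by positivity, fun x q => ?_⟩
  have hMx := abs_le.1 (hM x)
  have hlow : S.Cbar⁻¹ / 4 * sqnorm q - (M + S.Cbar⁻¹ * G) ≤ S.Hstar x q := by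
    have h1 := Hstar_young S x q (S.Cbar⁻¹ • q)
    have h2 := H_up S x 0 (S.Cbar⁻¹ • q)
    have h3 := dotp_le (DpH S x 0) q 2 two_pos
    have e1 : dotp q (S.Cbar⁻¹ • q) = S.Cbar⁻¹ * sqnorm q := by
      simp only [dotp, sqnorm, Finset.mul_sum, Pi.smul_apply, smul_eq_mul]
      exact Finset.sum_congr rfl fun i _ => by ring
    have e2 : dotp (DpH S x 0) (S.Cbar⁻¹ • q) = S.Cbar⁻¹ * dotp (DpH S x 0) q := by
      simp only [dotp, Finset.mul_sum, Pi.smul_apply, smul_eq_mul]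
      exact Finset.sum_congr rfl fun i _ => by ring
    have e3 : S.Cbar / 2 * sqnorm (S.Cbar⁻¹ • q) = S.Cbar⁻¹ / 2 * sqnorm q := by
      have : sqnorm (S.Cbar⁻¹ • q) = S.Cbar⁻¹ ^ 2 * sqnorm q := by
        simp only [sqnorm, Finset.mul_sum, Pi.smul_apply, smul_eq_mul]
        exact Finset.sum_congr rfl fun i _ => by ring
      rw [this]; field_simp
    rw [sub_zero, e2, e3] at h2
    rw [e1] at h1
    have h4 := mul_le_mul_of_nonneg_left (h3.trans (add_le_add_left (mul_le_mul_of_nonneg_left (hG x) (by norm_num)) _)) hCi.le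
    linarith
  have hup : S.Hstar x q ≤ S.Cbar * (sqnorm q + G) + M := by
    rw [Pst2]
    have h1 := H_low S x 0 (Pst S x q)
    have h2 := dotp_le (q - DpH S x 0) (Pst S x q) S.Cbar hC
    rw [dotp_sub_left] at h2
    rw [sub_zero] at h1
    have h3 := sqnorm_sub_le q (DpH S x 0)
    have h4 : S.Cbar / 2 * sqnorm (q - DpH S x 0) ≤ S.Cbar / 2 * (2 * sqnorm q + 2 * G) :=
      mul_le_mul_of_nonneg_left (h3.trans (by linarith [hG x])) (by positivity)
    linarith
  have hq := sqnorm_nonneg q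
  have a1 : 0 ≤ S.Cbar⁻¹ * G := by positivity
  have a2 : 0 ≤ S.Cbar * G := by positivity
  have a3 : 0 ≤ M * sqnorm q := by positivity
  have a4 : 0 ≤ S.Cbar⁻¹ * G * sqnorm q := by positivity
  have a5 : 0 ≤ S.Cbar * G * sqnorm q := by positivity
  have a6 : 0 ≤ S.Cbar * sqnorm q := by positivity
  have a7 : 0 ≤ S.Cbar⁻¹ / 4 * sqnorm q := by positivity
  refine ⟨by linarith, abs_le.2 ⟨by nlinarith, by nlinarith⟩⟩

lemma lineComb_prob {d : ℕ} {t : ℝ} (ht : t ∈ Icc (0:ℝ) 1) (μ ν : PTd d) :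
    IsProbabilityMeasure (lineComb t μ ν) := by
  constructor
  simp only [lineComb, Measure.coe_add, Measure.coe_smul, Pi.add_apply, Pi.smul_apply, measure_univ,
    smul_eq_mul, mul_one]
  rw [← ENNReal.ofReal_add (by linarith [ht.2]) ht.1]
  simp

lemma lineComb_integral {d : ℕ} {t : ℝ} (ht : t ∈ Icc (0:ℝ) 1) (μ ν : PTd d) {f : Td d → ℝ} (hf : Continuous f) :
    ∫ y, f y ∂(lineComb t μ ν) = (1 - t) * (∫ y, f y ∂(μ : Measure (Td d))) + t * ∫ y, f y ∂(ν : Measure (Td d)) := by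
  unfold lineComb
  rw [integral_add_measure ((integrable_cont _ hf).smul_measure ENNReal.ofReal_ne_top)
    ((integrable_cont _ hf).smul_measure ENNReal.ofReal_ne_top), integral_smul_measure, integral_smul_measure,
    ENNReal.toReal_ofReal (by linarith [ht.2]), ENNReal.toReal_ofReal ht.1]
  rfl

lemma Fd_cont {d : ℕ} (S : MFGSetting d) (μ : Measure (Td d)) [h : IsProbabilityMeasure μ] :
    Continuous (fun y => S.Fd μ (secT y)) :=
  cont_secT (S.Fd_smooth μ h).continuous (S.Fd_per μ)

lemma F_tangent {d : ℕ} (S : MFGSetting d)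
    (hmono : ∀ μ ν : PTd d,
      0 ≤ ((∫ y, (S.Fd (μ : Measure (Td d)) (secT y) - S.Fd (ν : Measure (Td d)) (secT y))
              ∂(μ : Measure (Td d))) -
            ∫ y, (S.Fd (μ : Measure (Td d)) (secT y) - S.Fd (ν : Measure (Td d)) (secT y))
              ∂(ν : Measure (Td d)))) (μ ν : PTd d) :
    S.Fc μ + ∫ y, S.Fd (μ : Measure (Td d)) (secT y) ∂(ν : Measure (Td d)) ≤ S.Fc ν := by
  set A : ℝ → ℝ := fun t => ((∫ y, S.Fd (lineComb t μ ν) (secT y) ∂(ν : Measure (Td d))) -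
        ∫ y, S.Fd (lineComb t μ ν) (secT y) ∂(μ : Measure (Td d))) with hA
  have hmonoA : MonotoneOn A (Icc 0 1) := by
    intro s hs t ht hst
    rcases hst.eq_or_lt with rfl | hlt
    · exact le_rfl
    have := lineComb_prob hs μ ν
    have := lineComb_prob ht μ ν
    have h := hmono ⟨lineComb t μ ν, lineComb_prob ht μ ν⟩ ⟨lineComb s μ ν, lineComb_prob hs μ ν⟩
    have c1 := Fd_cont S (lineComb t μ ν)
    have c2 := Fd_cont S (lineComb s μ ν)
    have c3 : Continuous (fun y => S.Fd (lineComb t μ ν) (secT y) - S.Fd (lineComb s μ ν) (secT y)) := c1.sub c2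
    simp only [ProbabilityMeasure.coe_mk] at h
    rw [lineComb_integral ht μ ν c3, lineComb_integral hs μ ν c3,
      integral_sub (integrable_cont _ c1) (integrable_cont _ c2),
      integral_sub (integrable_cont _ c1) (integrable_cont _ c2)] at h
    have h2 : 0 ≤ (t - s) * (A t - A s) := by
      simp only [hA]
      refine h.trans (le_of_eq ?_)
      ring
    have := nonneg_of_mul_nonneg_right h2 (sub_pos.2 hlt)
    linarith
  have h0 : lineComb 0 μ ν = (μ : Measure (Td d)) := by simp [lineComb]
  have hint : IntegrableOn A (Icc 0 1) := hmonoA.integrableOn_isCompact isCompact_Icc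
  have h1 := S.flat_deriv μ ν
  have h2 : ∫ t in Icc (0:ℝ) 1, A 0 ≤ ∫ t in Icc (0:ℝ) 1, A t := by
    refine setIntegral_mono_on (by simp) hint measurableSet_Icc fun t ht => ?_
    exact hmonoA (left_mem_Icc.2 zero_le_one) ht ht.1
  have h3 : A 0 = ∫ y, S.Fd (μ : Measure (Td d)) (secT y) ∂(ν : Measure (Td d)) := by
    simp only [hA, h0]
    rw [S.Fd_normalized μ, sub_zero]
  simp at h2
  rw [h3] at h2
  change _ = ∫ t in Icc (0:ℝ) 1, A t at h1
  linarith

lemma W1_bdd {d : ℕ} (μ ν : PTd d) : BddAbove { r | ∃ φ : Td d → ℝ, LipschitzWith 1 φ ∧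
    r = (∫ y, φ y ∂(μ : Measure (Td d))) - ∫ y, φ y ∂(ν : Measure (Td d)) } := by
  refine ⟨2 * Metric.diam (univ : Set (Td d)), ?_⟩
  rintro r ⟨φ, hφ, rfl⟩
  have hb : ∀ y, |φ y - φ 0| ≤ Metric.diam (univ : Set (Td d)) := by
    intro y
    have h1 := hφ.dist_le_mul y 0
    rw [Real.dist_eq] at h1
    simp only [NNReal.coe_one, one_mul] at h1
    exact h1.trans (Metric.dist_le_diam_of_mem (isCompact_univ.isBounded) (mem_univ _) (mem_univ _))
  have key : ∀ ρ : PTd d, |(∫ y, φ y ∂(ρ : Measure (Td d))) - φ 0| ≤ Metric.diam (univ : Set (Td d)) := by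
    intro ρ
    have h2 : (∫ y, φ y ∂(ρ : Measure (Td d))) - φ 0 = ∫ y, (φ y - φ 0) ∂(ρ : Measure (Td d)) := by
      rw [integral_sub (integrable_cont _ hφ.continuous) (integrable_const _)]; simp
    rw [h2]
    have := norm_integral_le_of_norm_le_const (μ := (ρ : Measure (Td d))) (f := fun y => φ y - φ 0) (C := Metric.diam (univ : Set (Td d))) (ae_of_all _ fun y => hb y)
    simpa using this
  have k1 := abs_le.1 (key μ)
  have k2 := abs_le.1 (key ν)
  linarith [k1.2, k2.1]

lemma W1_lip {d : ℕ} (μ ν : PTd d) {φ : Td d → ℝ} (hφ : LipschitzWith 1 φ) :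
    |(∫ y, φ y ∂(μ : Measure (Td d))) - ∫ y, φ y ∂(ν : Measure (Td d))| ≤ W1 μ ν := by
  rw [abs_le]
  constructor
  · have h : _ ≤ W1 μ ν := le_csSup (W1_bdd μ ν) ⟨fun y => - φ y, hφ.neg, rfl⟩
    rw [integral_neg, integral_neg] at h
    linarith
  · exact le_csSup (W1_bdd μ ν) ⟨φ, hφ, rfl⟩

lemma lip_contOn {d : ℕ} {m : ℝ → PTd d} {I : Set ℝ} (hm : W1ContOn m I) {φ : Td d → ℝ} {K : NNReal}
    (hφ : LipschitzWith K φ) : ContinuousOn (fun s => ∫ y, φ y ∂(m s : Measure (Td d))) I := by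
  have h1 : ∀ {ψ : Td d → ℝ}, LipschitzWith 1 ψ → ContinuousOn (fun s => ∫ y, ψ y ∂(m s : Measure (Td d))) I := by
    intro ψ hψ
    rw [Metric.continuousOn_iff]
    intro t ht ε hε
    obtain ⟨η, hη, h⟩ := hm t ht ε hε
    refine ⟨η, hη, fun s hs hst => ?_⟩
    rw [Real.dist_eq] at *
    exact (W1_lip _ _ hψ).trans_lt (h s hs hst)
  have hK : (0:ℝ) < K + 1 := by positivity
  have h2 : LipschitzWith 1 (fun y => ((K:ℝ) + 1)⁻¹ * φ y) := by
    refine LipschitzWith.of_dist_le_mul fun x y => ?_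
    rw [Real.dist_eq, ← mul_sub, abs_mul, abs_of_pos (by positivity), ← Real.dist_eq, inv_mul_le_iff₀ hK]
    refine (hφ.dist_le_mul x y).trans ?_
    simp only [NNReal.coe_one, one_mul]
    nlinarith [dist_nonneg (x := x) (y := y)]
  have h3 := (h1 h2).const_smul ((K:ℝ) + 1)
  refine h3.congr fun s _ => ?_
  simp only [Pi.smul_apply, smul_eq_mul]
  rw [integral_const_mul, ← mul_assoc, mul_inv_cancel₀ hK.ne', one_mul]

lemma kernel_meas {d : ℕ} {m : ℝ → PTd d} (hm : W1ContOn m univ) :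
    Measurable (fun s => (m s : Measure (Td d))) := by
  refine Measurable.measure_of_isPiSystem_of_isProbabilityMeasure
    (S := {F : Set (Td d) | IsClosed F}) ?_ isPiSystem_isClosed ?_
  · rw [BorelSpace.measurable_eq (α := Td d)]; exact borel_eq_generateFrom_isClosed
  · intro F hF
    have hδ : ∀ n : ℕ, (0:ℝ) < 1 / ((n:ℝ) + 1) := fun n => by positivity
    have hlim := fun s => tendsto_lintegral_thickenedIndicator_of_isClosed (m s : Measure (Td d)) hF hδ
      tendsto_one_div_add_atTop_nhds_zero_nat
    refine measurable_of_tendsto_metrizable (f := fun (n : ℕ) s => ∫⁻ y, (thickenedIndicator (hδ n) F y : ENNReal) ∂(m s : Measure (Td d))) ?_ (tendsto_pi_nhds.2 hlim)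
    intro n
    have hl : LipschitzWith (1 / ((n:ℝ) + 1)).toNNReal⁻¹ (fun y => ((thickenedIndicator (hδ n) F y : NNReal) : ℝ)) := by
      intro x y
      exact lipschitzWith_thickenedIndicator (hδ n) F x y
    have hc := continuousOn_univ.1 (lip_contOn hm hl)
    have he : ∀ s, ∫⁻ y, (thickenedIndicator (hδ n) F y : ENNReal) ∂(m s : Measure (Td d)) =
        ENNReal.ofReal (∫ y, ((thickenedIndicator (hδ n) F y : NNReal) : ℝ) ∂(m s : Measure (Td d))) := by
      intro s
      rw [ofReal_integral_eq_lintegral_ofReal (integrable_cont _ hl.continuous) (ae_of_all _ fun y => NNReal.coe_nonneg _)]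
      simp
    simp only [he]
    exact ENNReal.measurable_ofReal.comp hc.measurable

lemma occ {d : ℕ} {T : ℝ} (hT : 1 ≤ T) {m : ℝ → PTd d} {α : ℝ → Td d → Vd d} (hm : W1ContOn m (Icc 0 T))
    (hα : Measurable (fun q : ℝ × Td d => α q.1 q.2))
    (h2 : (∫⁻ s in Set.Ioc (0:ℝ) T, ∫⁻ y, ENNReal.ofReal (sqnorm (α s y)) ∂(m s : Measure (Td d))) < ⊤) :
    ∃ γ : Measure (Td d × Vd d), IsProbabilityMeasure γ ∧ Integrable (fun q => sqnorm q.2) γ ∧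
      ∀ (f : Td d × Vd d → ℝ) (C : ℝ), Measurable f → (∀ q, |f q| ≤ C * (1 + sqnorm q.2)) →
        Integrable f γ ∧ IntervalIntegrable (fun s => ∫ y, f (y, α s y) ∂(m s : Measure (Td d))) volume 0 T ∧
        ∫ s in (0:ℝ)..T, ∫ y, f (y, α s y) ∂(m s : Measure (Td d)) = T * ∫ q, f q ∂γ := by
  have hT0 : (0:ℝ) ≤ T := by linarith
  have hTp : (0:ℝ) < T := by linarith
  set m' : ℝ → PTd d := fun s => m (projIcc 0 T hT0 s) with hm'
  have hmc : W1ContOn m' univ := by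
    intro t _ ε hε
    obtain ⟨η, hη, h⟩ := hm (projIcc 0 T hT0 t) (Subtype.coe_prop _) ε hε
    refine ⟨η, hη, fun s _ hst => h _ (Subtype.coe_prop _) ?_⟩
    refine lt_of_le_of_lt ?_ hst
    exact abs_projIcc_sub_projIcc hT0
  have hmm : ∀ s ∈ Ioc 0 T, m' s = m s := fun s hs => by
    simp only [hm', projIcc_of_mem hT0 (Ioc_subset_Icc_self hs)]
  let κ : ProbabilityTheory.Kernel ℝ (Td d) := ⟨fun s => (m' s : Measure (Td d)), kernel_meas hmc⟩
  have hκ : ∀ s, κ s = (m' s : Measure (Td d)) := fun s => rfl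
  have : ProbabilityTheory.IsMarkovKernel κ := ⟨fun s => by rw [hκ]; infer_instance⟩
  set ρ : Measure ℝ := ENNReal.ofReal T⁻¹ • volume.restrict (Ioc 0 T) with hρ
  have hρp : IsProbabilityMeasure ρ := by
    constructor
    simp only [hρ, Measure.smul_apply, Measure.restrict_apply MeasurableSet.univ, univ_inter, Real.volume_Ioc, smul_eq_mul]
    rw [← ENNReal.ofReal_mul (by positivity), sub_zero, inv_mul_cancel₀ hTp.ne', ENNReal.ofReal_one]
  have hmap : Measurable (fun q : ℝ × Td d => (q.2, α q.1 q.2)) := measurable_snd.prodMk hα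
  set γ := (ρ.compProd κ).map (fun q : ℝ × Td d => (q.2, α q.1 q.2)) with hγ
  have hγp : IsProbabilityMeasure γ := Measure.isProbabilityMeasure_map hmap.aemeasurable
  have hsq : Integrable (fun q : Td d × Vd d => sqnorm q.2) γ := by
    refine ⟨(sqnorm_cont.measurable.comp measurable_snd).aestronglyMeasurable, ?_⟩
    unfold HasFiniteIntegral
    have he : ∀ q : Td d × Vd d, ‖sqnorm q.2‖ₑ = ENNReal.ofReal (sqnorm q.2) := fun q =>
      Real.enorm_eq_ofReal (sqnorm_nonneg _)
    simp only [he]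
    have hme : Measurable (fun q : Td d × Vd d => ENNReal.ofReal (sqnorm q.2)) :=
      ENNReal.measurable_ofReal.comp (sqnorm_cont.measurable.comp measurable_snd)
    have hme2 : Measurable (fun q : ℝ × Td d => ENNReal.ofReal (sqnorm (α q.1 q.2))) :=
      ENNReal.measurable_ofReal.comp (sqnorm_cont.measurable.comp hα)
    rw [hγ, lintegral_map hme hmap]
    change ∫⁻ q : ℝ × Td d, ENNReal.ofReal (sqnorm (α q.1 q.2)) ∂(ρ.compProd κ) < ⊤
    rw [Measure.lintegral_compProd hme2, hρ, lintegral_smul_measure]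
    refine ENNReal.mul_lt_top ENNReal.ofReal_lt_top ?_
    rw [setLIntegral_congr_fun (g := fun s => ∫⁻ y, ENNReal.ofReal (sqnorm (α s y)) ∂(m s : Measure (Td d))) measurableSet_Ioc]
    · exact h2
    · intro s hs
      simp only [hκ, hmm s hs]
  refine ⟨γ, hγp, hsq, fun f C hf hb => ?_⟩
  have hfi : Integrable f γ := by
    refine Integrable.mono' (((integrable_const 1).add hsq).const_mul C) hf.aestronglyMeasurable (ae_of_all _ hb)
  have hfi2 : Integrable (fun q : ℝ × Td d => f (q.2, α q.1 q.2)) (ρ.compProd κ) :=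
    (integrable_map_measure hf.aestronglyMeasurable hmap.aemeasurable).1 hfi
  have hi3 : Integrable (fun s => ∫ y, f (y, α s y) ∂(κ s)) ρ :=
    MeasureTheory.Integrable.integral_compProd hfi2
  have hT' : ENNReal.ofReal T⁻¹ ≠ 0 := by
    rw [ne_eq, ENNReal.ofReal_eq_zero, not_le]; positivity
  have hi4 : IntegrableOn (fun s => ∫ y, f (y, α s y) ∂(κ s)) (Ioc 0 T) :=
    (integrable_smul_measure hT' ENNReal.ofReal_ne_top).1 hi3
  have heq : EqOn (fun s => ∫ y, f (y, α s y) ∂(κ s)) (fun s => ∫ y, f (y, α s y) ∂(m s : Measure (Td d))) (Ioc 0 T) := by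
    intro s hs
    simp only [hκ, hmm s hs]
  refine ⟨hfi, ?_, ?_⟩
  · rw [intervalIntegrable_iff_integrableOn_Ioc_of_le hT0]
    exact hi4.congr_fun heq measurableSet_Ioc
  · rw [intervalIntegral.integral_of_le hT0, ← setIntegral_congr_fun measurableSet_Ioc heq, hγ,
      integral_map hmap.aemeasurable hf.aestronglyMeasurable, Measure.integral_compProd hfi2, hρ, integral_smul_measure,
      ENNReal.toReal_ofReal (by positivity), smul_eq_mul, ← mul_assoc, mul_inv_cancel₀ hTp.ne', one_mul]

lemma abs_dotp_le {d : ℕ} (a b : Vd d) : |dotp a b| ≤ sqnorm a + sqnorm b := by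
  have h1 := dotp_le a b 1 one_pos
  have h2 := dotp_le (-a) b 1 one_pos
  have h3 : dotp (-a) b = - dotp a b := by simp [dotp]
  rw [h3, sqnorm_neg] at h2
  have := sqnorm_nonneg a
  have := sqnorm_nonneg b
  norm_num at h1 h2
  rw [abs_le]; constructor <;> linarith

lemma occ2 {d : ℕ} (S : MFGSetting d)
    (hmono : ∀ μ ν : PTd d,
      0 ≤ ((∫ y, (S.Fd (μ : Measure (Td d)) (secT y) - S.Fd (ν : Measure (Td d)) (secT y))
              ∂(μ : Measure (Td d))) -
            ∫ y, (S.Fd (μ : Measure (Td d)) (secT y) - S.Fd (ν : Measure (Td d)) (secT y))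
              ∂(ν : Measure (Td d)))) {T : ℝ} (hT : 1 ≤ T) {μ₀ : PTd d} {m : ℝ → PTd d} {α : ℝ → Td d → Vd d}
    (hadm : AdmOn S 1 μ₀ T m α) :
    ∃ γ : Measure (Td d × Vd d), IsProbabilityMeasure γ ∧ Integrable (fun q => sqnorm q.2) γ ∧
      (∀ μ : PTd d, T * ((∫ q, S.Hstar (secT q.1) q.2 ∂γ) + S.Fc μ + ∫ q, S.Fd (μ : Measure (Td d)) (secT q.1) ∂γ)
        ≤ costT S m α T) ∧
      (∀ g : Vd d → ℝ, ContDiff ℝ 2 g → (∀ (x : Vd d) (z : Fin d → ℤ), g (x + intVec z) = g x) →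
        ∀ M, (∀ x, |g x| ≤ M) → T * |∫ q, (lapl g (secT q.1) - dotp q.2 (gradv g (secT q.1))) ∂γ| ≤ 2 * M) := by
  obtain ⟨-, hm, hFP, hα, h2, hrc⟩ := hadm
  obtain ⟨γ, hγ, hsq, hocc⟩ := occ hT hm hα h2
  have hT0 : (0:ℝ) ≤ T := by linarith
  refine ⟨γ, hγ, hsq, fun μ => ?_, fun g hg hp M hM => ?_⟩
  · obtain ⟨c, C, hc, hC, hH⟩ := Hstar_bounds S
    obtain ⟨N, hN⟩ := S.Fd_bounded
    have hN0 : 0 ≤ N := (abs_nonneg _).trans (hN μ 0)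
    obtain ⟨-, i1, e1⟩ := hocc (fun q => S.Hstar (secT q.1) q.2) C
      ((Hstar_cont S).measurable.comp (((secT_meas d).comp measurable_fst).prodMk measurable_snd))
      (fun q => (hH _ _).2)
    obtain ⟨-, i2, e2⟩ := hocc (fun q => S.Fd (μ : Measure (Td d)) (secT q.1)) N
      ((Fd_cont S (μ : Measure (Td d))).measurable.comp measurable_fst)
      (fun q => (hN μ _).trans (by nlinarith [sqnorm_nonneg q.2]))
    have h3 : ∫ s in (0:ℝ)..T, ((∫ y, S.Hstar (secT y) (α s y) ∂(m s : Measure (Td d))) +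
        (S.Fc μ + ∫ y, S.Fd (μ : Measure (Td d)) (secT y) ∂(m s : Measure (Td d)))) ≤ costT S m α T := by
      refine intervalIntegral.integral_mono_on hT0 (i1.add (intervalIntegrable_const.add i2)) hrc fun s _ => ?_
      exact add_le_add_right (F_tangent S hmono μ (m s)) _
    rw [intervalIntegral.integral_add i1 (intervalIntegrable_const.add i2),
      intervalIntegral.integral_add intervalIntegrable_const i2, e1, e2] at h3
    refine le_trans (le_of_eq ?_) h3
    simp; ring
  · have h := hFP 0 T le_rfl hT0 le_rfl (fun _ x => g x) ⟨hg.comp contDiff_snd, fun _ => hp⟩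
    have hl := cont_secT (lapl_cont hg) (lapl_per hp)
    have hgr := cont_secT (gradv_cont hg) (gradv_per hp)
    obtain ⟨A, hA0, hA⟩ := per_bdd (lapl_cont hg) (lapl_per hp)
    obtain ⟨B, hB0, hB⟩ := per_bdd (f := fun x => sqnorm (gradv g x)) (sqnorm_cont.comp (gradv_cont hg))
      (fun x z => by simp only [gradv_per hp])
    obtain ⟨-, -, e⟩ := hocc (fun q => lapl g (secT q.1) - dotp q.2 (gradv g (secT q.1))) (A + B + 1)
      (((hl.comp continuous_fst).sub (dotp_cont.comp (continuous_snd.prodMk (hgr.comp continuous_fst)))).measurable)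
      (fun q => by
        have a1 := abs_sub (lapl g (secT q.1)) (dotp q.2 (gradv g (secT q.1)))
        have a2 := abs_dotp_le q.2 (gradv g (secT q.1))
        have a3 := hA (secT q.1)
        have a4 := (le_abs_self _).trans (hB (secT q.1))
        have a5 := sqnorm_nonneg q.2
        nlinarith)
    have ht : ∀ (s : ℝ) (x : Vd d), tderiv (fun _ x => g x) s x = 0 := fun s x => by simp [tderiv]
    simp only [ht, zero_add, one_mul] at h
    rw [e] at h
    have hb : ∀ ρ : PTd d, |∫ y, g (secT y) ∂(ρ : Measure (Td d))| ≤ M := by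
      intro ρ
      have := norm_integral_le_of_norm_le_const (μ := (ρ : Measure (Td d))) (f := fun y => g (secT y)) (C := M)
        (ae_of_all _ fun y => hM _)
      simpa using this
    rw [show T * |∫ q, (lapl g (secT q.1) - dotp q.2 (gradv g (secT q.1))) ∂γ| = |T * ∫ q, (lapl g (secT q.1) - dotp q.2 (gradv g (secT q.1))) ∂γ| by rw [abs_mul, abs_of_nonneg hT0], ← h]
    have b1 := abs_le.1 (hb (m T))
    have b2 := abs_le.1 (hb (m 0))
    rw [abs_le]; constructor <;> linarith [b1.1, b1.2, b2.1, b2.2]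

lemma cs_int {Ω : Type*} [MeasurableSpace Ω] (μ : Measure Ω) {f g : Ω → ℝ} (hf : MemLp f 2 μ) (hg : MemLp g 2 μ) :
    (∫ y, f y * g y ∂μ) ^ 2 ≤ (∫ y, f y ^ 2 ∂μ) * ∫ y, g y ^ 2 ∂μ := by
  have h1 := hf.integrable_sq
  have h2 := hg.integrable_sq
  have h3 : Integrable (fun y => f y * g y) μ := hf.integrable_mul hg
  have key : ∀ t : ℝ, 0 ≤ (∫ y, f y ^ 2 ∂μ) * (t * t) + (2 * ∫ y, f y * g y ∂μ) * t + ∫ y, g y ^ 2 ∂μ := by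
    intro t
    have h4 : 0 ≤ ∫ y, (f y * t + g y) ^ 2 ∂μ := integral_nonneg fun y => sq_nonneg _
    have h5 : ∀ y, (f y * t + g y) ^ 2 = (t * t) * f y ^ 2 + (2 * t) * (f y * g y) + g y ^ 2 := fun y => by ring
    simp only [h5] at h4
    have i1 : Integrable (fun y => (t * t) * f y ^ 2) μ := h1.const_mul _
    have i2 : Integrable (fun y => (2 * t) * (f y * g y)) μ := h3.const_mul _
    have i3 : Integrable (fun y => (t * t) * f y ^ 2 + (2 * t) * (f y * g y)) μ := i1.add i2
    rw [integral_add i3 h2, integral_add i1 i2, integral_const_mul, integral_const_mul] at h4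
    linarith
  have := discrim_le_zero key
  unfold discrim at this
  nlinarith

lemma lim_meas {d : ℕ} (γ : ℕ → Measure (Td d × Vd d)) [hγ : ∀ n, IsProbabilityMeasure (γ n)] :
    ∃ μ : PTd d, ∀ f : Td d → ℝ, Continuous f →
      Tendsto (fun n => ∫ q, f q.1 ∂(γ n)) (hyperfilter ℕ) (𝓝 (∫ y, f y ∂(μ : Measure (Td d)))) := by
  let ν : ℕ → PTd d := fun n => ⟨(γ n).map Prod.fst, Measure.isProbabilityMeasure_map measurable_fst.aemeasurable⟩
  obtain ⟨μ, -, hμ⟩ := isCompact_univ.ultrafilter_le_nhds' ((hyperfilter ℕ).map ν) univ_mem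
  refine ⟨μ, fun f hf => ?_⟩
  have h1 : Tendsto ν (hyperfilter ℕ) (𝓝 μ) := hμ
  have h2 := ProbabilityMeasure.tendsto_iff_forall_integral_tendsto.1 h1 (BoundedContinuousFunction.mkOfCompact ⟨f, hf⟩)
  refine (h2.congr fun n => ?_)
  change ∫ y, f y ∂((γ n).map Prod.fst) = _
  rw [integral_map measurable_fst.aemeasurable hf.measurable.aestronglyMeasurable]

lemma lim_vec {d : ℕ} (γ : ℕ → Measure (Td d × Vd d)) [hγ : ∀ n, IsProbabilityMeasure (γ n)]
    (hsq : ∀ n, Integrable (fun q => sqnorm q.2) (γ n)) {K : ℝ} (hK : ∀ n, ∫ q, sqnorm q.2 ∂(γ n) ≤ K)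
    (μ : PTd d) (hμ : ∀ f : Td d → ℝ, Continuous f →
      Tendsto (fun n => ∫ q, f q.1 ∂(γ n)) (hyperfilter ℕ) (𝓝 (∫ y, f y ∂(μ : Measure (Td d))))) (i : Fin d) :
    ∃ a : Td d → ℝ, Measurable a ∧ MemLp a 2 (μ : Measure (Td d)) ∧ ∀ f : Td d → ℝ, Continuous f →
      Tendsto (fun n => ∫ q, f q.1 * q.2 i ∂(γ n)) (hyperfilter ℕ) (𝓝 (∫ y, f y * a y ∂(μ : Measure (Td d)))) := by
  have hq2 : ∀ n, MemLp (fun q : Td d × Vd d => q.2 i) 2 (γ n) := by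
    intro n
    have hm : Measurable (fun q : Td d × Vd d => q.2 i) := (measurable_pi_apply i).comp measurable_snd
    rw [memLp_two_iff_integrable_sq hm.aestronglyMeasurable]
    refine (hsq n).mono' (hm.pow_const 2).aestronglyMeasurable (ae_of_all _ fun q => ?_)
    rw [Real.norm_eq_abs, abs_of_nonneg (sq_nonneg _)]
    exact abs_le_sqnorm _ _
  have hq3 : ∀ n, ∫ q, (q.2 i) ^ 2 ∂(γ n) ≤ K := fun n =>
    (integral_mono (hq2 n).integrable_sq (hsq n) fun q => abs_le_sqnorm _ _).trans (hK n)
  have hK0 : 0 ≤ K := (integral_nonneg fun q => sq_nonneg _).trans (hq3 0)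
  have hfm : ∀ n (f : C(Td d, ℝ)), MemLp (fun q : Td d × Vd d => f q.1) 2 (γ n) := by
    intro n f
    obtain ⟨C, hC⟩ := (isCompact_range f.continuous).isBounded.exists_norm_le
    exact MemLp.of_bound (f.continuous.comp continuous_fst).measurable.aestronglyMeasurable C
      (ae_of_all _ fun q => hC _ (mem_range_self _))
  have hcs : ∀ n (f : C(Td d, ℝ)), (∫ q, f q.1 * q.2 i ∂(γ n)) ^ 2 ≤ (∫ q, f q.1 ^ 2 ∂(γ n)) * K := fun n f =>
    (cs_int (γ n) (hfm n f) (hq2 n)).trans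
      (mul_le_mul_of_nonneg_left (hq3 n) (integral_nonneg fun q => sq_nonneg _))
  have hlim : ∀ f : C(Td d, ℝ), ∃ w : ℝ, Tendsto (fun n => ∫ q, f q.1 * q.2 i ∂(γ n)) (hyperfilter ℕ) (𝓝 w) := by
    intro f
    obtain ⟨C, hC⟩ := (isCompact_range f.continuous).isBounded.exists_norm_le
    have hb : ∀ n, |∫ q, f q.1 * q.2 i ∂(γ n)| ≤ Real.sqrt (C ^ 2 * K) := by
      intro n
      apply Real.abs_le_sqrt
      refine (hcs n f).trans (mul_le_mul_of_nonneg_right ?_ hK0)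
      have := integral_mono (μ := γ n) (hfm n f).integrable_sq (integrable_const (C ^ 2)) fun q => by
        have := hC _ (mem_range_self q.1)
        exact sq_le_sq' (by linarith [(abs_le.1 this).1]) (abs_le.1 this).2
      simpa using this
    obtain ⟨w, -, hw⟩ := (isCompact_Icc (a := -Real.sqrt (C ^ 2 * K)) (b := Real.sqrt (C ^ 2 * K))).ultrafilter_le_nhds'
      ((hyperfilter ℕ).map (fun n => ∫ q, f q.1 * q.2 i ∂(γ n)))
      (Ultrafilter.mem_map.2 (Filter.univ_mem' fun n => abs_le.1 (hb n)))
    exact ⟨w, hw⟩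
  choose W hW using hlim
  have hi : ∀ n (f : C(Td d, ℝ)), Integrable (fun q : Td d × Vd d => f q.1 * q.2 i) (γ n) := fun n f =>
    (hfm n f).integrable_mul (hq2 n)
  let L : C(Td d, ℝ) →ₗ[ℝ] ℝ :=
    { toFun := W
      map_add' := by
        intro f g
        refine tendsto_nhds_unique (hW (f + g)) (((hW f).add (hW g)).congr fun n => ?_)
        rw [← integral_add (hi n f) (hi n g)]
        exact integral_congr_ae (ae_of_all _ fun q => by simp [add_mul])
      map_smul' := by
        intro c f
        refine tendsto_nhds_unique (hW (c • f)) (((hW f).const_mul c).congr fun n => ?_)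
        rw [← integral_const_mul]
        exact integral_congr_ae (ae_of_all _ fun q => by simp [mul_assoc]) }
  let e : C(Td d, ℝ) →L[ℝ] Lp ℝ 2 (μ : Measure (Td d)) := ContinuousMap.toLp 2 (μ : Measure (Td d)) ℝ
  have he : ∀ f : C(Td d, ℝ), ‖e f‖ ^ 2 = ∫ y, f y ^ 2 ∂(μ : Measure (Td d)) := by
    intro f
    rw [← real_inner_self_eq_norm_sq, L2.inner_def]
    refine integral_congr_ae ?_
    filter_upwards [ContinuousMap.coeFn_toLp (p := 2) (μ : Measure (Td d)) (𝕜 := ℝ) f] with y hy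
    change inner ℝ (((ContinuousMap.toLp 2 (μ : Measure (Td d)) ℝ) f) y) (((ContinuousMap.toLp 2 (μ : Measure (Td d)) ℝ) f) y) = _
    rw [hy]; simp [sq]
  have hn : ∃ C, ∀ f, ‖L f‖ ≤ C * ‖e.toLinearMap f‖ := by
    refine ⟨Real.sqrt K, fun f => ?_⟩
    change |W f| ≤ Real.sqrt K * ‖e f‖
    have h1 : (W f) ^ 2 ≤ (∫ y, f y ^ 2 ∂(μ : Measure (Td d))) * K :=
      le_of_tendsto_of_tendsto' ((hW f).pow 2) ((hμ _ (f.continuous.pow 2)).mul_const K) fun n => hcs n f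
    rw [← he] at h1
    refine abs_le_of_sq_le_sq ?_ (by positivity)
    rw [mul_pow, Real.sq_sqrt hK0]; linarith
  have hd : DenseRange e.toLinearMap := ContinuousMap.toLp_denseRange ℝ (μ : Measure (Td d)) ℝ (by simp)
  let Φ : Lp ℝ 2 (μ : Measure (Td d)) →L[ℝ] ℝ := L.extendOfNorm e.toLinearMap
  let a₀ : Lp ℝ 2 (μ : Measure (Td d)) := (InnerProductSpace.toDual ℝ _).symm Φ
  have hWa : ∀ f : C(Td d, ℝ), W f = ∫ y, f y * a₀ y ∂(μ : Measure (Td d)) := by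
    intro f
    have h1 : Φ (e f) = W f := LinearMap.extendOfNorm_eq hd hn f
    have h2 : inner ℝ a₀ (e f) = Φ (e f) := InnerProductSpace.toDual_symm_apply
    rw [← h1, ← h2, L2.inner_def]
    refine integral_congr_ae ?_
    filter_upwards [ContinuousMap.coeFn_toLp (p := 2) (μ : Measure (Td d)) (𝕜 := ℝ) f] with y hy
    change inner ℝ (a₀ y) (((ContinuousMap.toLp 2 (μ : Measure (Td d)) ℝ) f) y) = _
    rw [hy]; simp
  refine ⟨a₀, (Lp.stronglyMeasurable a₀).measurable, Lp.memLp a₀, fun f hf => ?_⟩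
  have := hW ⟨f, hf⟩
  rw [hWa] at this
  exact this

lemma good_seq {d : ℕ} (S : MFGSetting d) {lam : ℝ} (hlam : IsLimitValueU S 1 lam)
    (hmono : ∀ μ ν : PTd d,
      0 ≤ ((∫ y, (S.Fd (μ : Measure (Td d)) (secT y) - S.Fd (ν : Measure (Td d)) (secT y))
              ∂(μ : Measure (Td d))) -
            ∫ y, (S.Fd (μ : Measure (Td d)) (secT y) - S.Fd (ν : Measure (Td d)) (secT y))
              ∂(ν : Measure (Td d)))) (n : ℕ) :
    ∃ γ : Measure (Td d × Vd d), IsProbabilityMeasure γ ∧ Integrable (fun q => sqnorm q.2) γ ∧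
      (∀ μ : PTd d, (∫ q, S.Hstar (secT q.1) q.2 ∂γ) + S.Fc μ + ∫ q, S.Fd (μ : Measure (Td d)) (secT q.1) ∂γ
        ≤ -lam + 1 / ((n:ℝ) + 1)) ∧
      (∀ g : Vd d → ℝ, ContDiff ℝ 2 g → (∀ (x : Vd d) (z : Fin d → ℤ), g (x + intVec z) = g x) →
        ∀ M, (∀ x, |g x| ≤ M) → |∫ q, (lapl g (secT q.1) - dotp q.2 (gradv g (secT q.1))) ∂γ| ≤ 2 * M * (1 / ((n:ℝ) + 1))) := by
  have hε : (0:ℝ) < 1 / ((n:ℝ) + 1) := by positivity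
  obtain ⟨T, m, α, hT1, hT, hadm, hcost⟩ := exists_good S hlam hε
  obtain ⟨γ, h1, h2, h3, h4⟩ := occ2 S hmono hT hadm
  have hT0 : 0 < T := by linarith
  refine ⟨γ, h1, h2, fun μ => ?_, fun g hg hp M hM => ?_⟩
  · exact le_of_mul_le_mul_left ((h3 μ).trans hcost) hT0
  · have := h4 g hg hp M hM
    have hM0 : 0 ≤ M := (abs_nonneg _).trans (hM 0)
    have h5 : |∫ q, (lapl g (secT q.1) - dotp q.2 (gradv g (secT q.1))) ∂γ| ≤ 2 * M * T⁻¹ := by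
      rw [← div_eq_mul_inv, le_div_iff₀ hT0]; linarith
    refine h5.trans (mul_le_mul_of_nonneg_left ?_ (by positivity))
    exact inv_le_of_inv_le₀ hε hT1

lemma Hstar_int {d : ℕ} (S : MFGSetting d) {Ω : Type*} [MeasurableSpace Ω] (μ : Measure Ω) [IsFiniteMeasure μ]
    {x a : Ω → Vd d} (hx : Measurable x) (ha : Measurable a) (h : Integrable (fun y => sqnorm (a y)) μ) :
    Integrable (fun y => S.Hstar (x y) (a y)) μ := by
  obtain ⟨c, C, hc, hC, hH⟩ := Hstar_bounds S
  exact Integrable.mono' (((integrable_const 1).add h).const_mul C)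
    ((Hstar_cont S).measurable.comp (hx.prodMk ha)).aestronglyMeasurable (ae_of_all _ fun y => (hH _ _).2)

lemma sq_unif {d : ℕ} (S : MFGSetting d) {lam : ℝ} : ∃ K : ℝ, ∀ γ : Measure (Td d × Vd d), IsProbabilityMeasure γ →
    Integrable (fun q => sqnorm q.2) γ →
      (∀ μ : PTd d, (∫ q, S.Hstar (secT q.1) q.2 ∂γ) + S.Fc μ + ∫ q, S.Fd (μ : Measure (Td d)) (secT q.1) ∂γ
        ≤ -lam + 1) → ∫ q, sqnorm q.2 ∂γ ≤ K := by
  obtain ⟨c, C, hc, hC, hH⟩ := Hstar_bounds S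
  obtain ⟨N, hN⟩ := S.Fd_bounded
  obtain ⟨N', hN'⟩ := S.Fc_bounded
  refine ⟨(-lam + 1 + N + N' + C) / c, fun γ hγ hsq hc' => ?_⟩
  have h1 := hc' (volT d)
  have h2 : -N ≤ ∫ q, S.Fd (volT d : Measure (Td d)) (secT q.1) ∂γ := by
    have := norm_integral_le_of_norm_le_const (μ := γ) (f := fun q => S.Fd (volT d : Measure (Td d)) (secT q.1)) (C := N)
      (ae_of_all _ fun q => hN (volT d) _)
    simp only [Real.norm_eq_abs, probReal_univ, mul_one] at this
    exact (abs_le.1 this).1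
  have h3 := (abs_le.1 (hN' (volT d))).1
  have h4 : ∫ q, (c * sqnorm q.2 - C) ∂γ ≤ ∫ q, S.Hstar (secT q.1) q.2 ∂γ :=
    integral_mono ((hsq.const_mul c).sub (integrable_const C))
      (Hstar_int S γ ((secT_meas d).comp measurable_fst) measurable_snd hsq) fun q => (hH _ _).1
  rw [integral_sub (hsq.const_mul c) (integrable_const C), integral_const_mul] at h4
  simp only [integral_const, probReal_univ, one_smul] at h4
  rw [le_div_iff₀ hc]
  linarith

lemma stat_limit {d : ℕ} (S : MFGSetting d) {lam : ℝ} (hlam : IsLimitValueU S 1 lam)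
    (hmono : ∀ μ ν : PTd d,
      0 ≤ ((∫ y, (S.Fd (μ : Measure (Td d)) (secT y) - S.Fd (ν : Measure (Td d)) (secT y))
              ∂(μ : Measure (Td d))) -
            ∫ y, (S.Fd (μ : Measure (Td d)) (secT y) - S.Fd (ν : Measure (Td d)) (secT y))
              ∂(ν : Measure (Td d)))) :
    ∃ (μ : PTd d) (a : Td d → Vd d), StatAdm 1 μ a ∧ Integrable (fun y => sqnorm (a y)) (μ : Measure (Td d)) ∧
      ∀ p : Td d → Vd d, Continuous p →
        S.Fc μ + ∫ y, (dotp (a y) (p y) - S.H (secT y) (p y)) ∂(μ : Measure (Td d)) ≤ -lam := by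
  choose γ hγ hsq hcost hfp using good_seq S hlam hmono
  obtain ⟨K, hK⟩ := sq_unif S (lam := lam)
  have hKn : ∀ n, ∫ q, sqnorm q.2 ∂(γ n) ≤ K := fun n => hK _ (hγ n) (hsq n) fun μ => (hcost n μ).trans (by
    have : 1 / ((n:ℝ) + 1) ≤ 1 := by
      rw [div_le_one (by positivity)]; linarith [Nat.cast_nonneg (α := ℝ) n]
    linarith)
  obtain ⟨μ, hμ⟩ := lim_meas γ
  choose a ham ha2 haW using lim_vec γ hsq hKn μ hμ
  have hA : ∀ i, MemLp (fun y => a i y) 2 (μ : Measure (Td d)) := ha2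
  have hai : Integrable (fun y => sqnorm (fun i => a i y)) (μ : Measure (Td d)) := by
    unfold sqnorm
    exact integrable_finsetSum _ fun i _ => (ha2 i).integrable_sq
  have h0 : Tendsto (fun n : ℕ => 1 / ((n:ℝ) + 1)) (hyperfilter ℕ) (𝓝 0) :=
    tendsto_one_div_add_atTop_nhds_zero_nat.mono_left Nat.hyperfilter_le_atTop
  have hqi : ∀ n (i : Fin d), MemLp (fun q : Td d × Vd d => q.2 i) 2 (γ n) := by
    intro n i
    have hm : Measurable (fun q : Td d × Vd d => q.2 i) := (measurable_pi_apply i).comp measurable_snd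
    rw [memLp_two_iff_integrable_sq hm.aestronglyMeasurable]
    refine (hsq n).mono' (hm.pow_const 2).aestronglyMeasurable (ae_of_all _ fun q => ?_)
    rw [Real.norm_eq_abs, abs_of_nonneg (sq_nonneg _)]
    exact abs_le_sqnorm _ _
  have hbm : ∀ n (f : Td d → ℝ), Continuous f → MemLp (fun q : Td d × Vd d => f q.1) 2 (γ n) := by
    intro n f hf
    obtain ⟨C, hC⟩ := (isCompact_range hf).isBounded.exists_norm_le
    exact MemLp.of_bound (hf.comp continuous_fst).measurable.aestronglyMeasurable C
      (ae_of_all _ fun q => hC _ (mem_range_self _))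
  have hdot : ∀ p : Td d → Vd d, Continuous p → (∀ n, Integrable (fun q : Td d × Vd d => dotp q.2 (p q.1)) (γ n)) ∧
      Tendsto (fun n => ∫ q, dotp q.2 (p q.1) ∂(γ n)) (hyperfilter ℕ)
        (𝓝 (∫ y, dotp (fun i => a i y) (p y) ∂(μ : Measure (Td d)))) := by
    intro p hp
    have hpi : ∀ i, Continuous (fun y => p y i) := fun i => (continuous_apply i).comp hp
    refine ⟨fun n => dotp_integrable (γ n) (hqi n) fun i => hbm n _ (hpi i), ?_⟩
    have h1 := tendsto_finsetSum (Finset.univ : Finset (Fin d)) fun i _ => haW i _ (hpi i)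
    have h2 : ∫ y, dotp (fun i => a i y) (p y) ∂(μ : Measure (Td d)) = ∑ i, ∫ y, p y i * a i y ∂(μ : Measure (Td d)) := by
      have hi : ∀ i ∈ (Finset.univ : Finset (Fin d)), Integrable (fun y => p y i * a i y) (μ : Measure (Td d)) :=
        fun i _ => (cont_memLp _ (hpi i)).integrable_mul (ha2 i)
      rw [← integral_finsetSum _ hi]
      exact integral_congr_ae (ae_of_all _ fun y => by simp [dotp, mul_comm])
    rw [h2]
    refine h1.congr fun n => ?_
    have hi : ∀ i ∈ (Finset.univ : Finset (Fin d)), Integrable (fun q : Td d × Vd d => p q.1 i * q.2 i) (γ n) :=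
      fun i _ => (hbm n _ (hpi i)).integrable_mul (hqi n i)
    rw [← integral_finsetSum _ hi]
    exact integral_congr_ae (ae_of_all _ fun y => by simp [dotp, mul_comm])
  refine ⟨μ, fun y i => a i y, ⟨measurable_pi_iff.2 ham, ?_, fun g hg hp => ?_⟩, hai, fun p hp => ?_⟩
  · have := hai.2
    unfold HasFiniteIntegral at this
    refine lt_of_le_of_lt (lintegral_mono fun y => ?_) this
    exact (Real.enorm_eq_ofReal (sqnorm_nonneg _)).ge
  · have hl := cont_secT (lapl_cont hg) (lapl_per hp)
    have hgr := cont_secT (gradv_cont hg) (gradv_per hp)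
    obtain ⟨M, hM0, hM⟩ := per_bdd hg.continuous hp
    obtain ⟨d1, d2⟩ := hdot _ hgr
    have h1 := (hμ _ hl).sub d2
    have hd : Integrable (fun y => dotp (fun i => a i y) (gradv g (secT y))) (μ : Measure (Td d)) :=
      dotp_integrable _ hA fun i => cont_memLp _ ((continuous_apply i).comp hgr)
    simp only [one_mul]
    rw [integral_sub (integrable_cont _ hl) hd]
    refine tendsto_nhds_unique h1 ?_
    have h2 : Tendsto (fun n : ℕ => 2 * M * (1 / ((n:ℝ) + 1))) (hyperfilter ℕ) (𝓝 0) := by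
      simpa using h0.const_mul (2 * M)
    refine squeeze_zero_norm (fun n => ?_) h2
    have h3 := hfp n g hg hp M hM
    rw [integral_sub ((hbm n _ hl).integrable (by norm_num)) (d1 n)] at h3
    exact h3
  · obtain ⟨d1, d2⟩ := hdot p hp
    have hHc : Continuous (fun y => S.H (secT y) (p y)) := by
      have h := cont_secT2 (f := fun x p => S.H x p) (H_cont S) (fun x z p => S.H_per x z p)
      exact h.comp (continuous_id.prodMk hp)
    have hF := hμ _ (Fd_cont S (μ : Measure (Td d)))
    rw [S.Fd_normalized] at hF
    have hd : Integrable (fun y => dotp (fun i => a i y) (p y)) (μ : Measure (Td d)) :=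
      dotp_integrable _ hA fun i => cont_memLp _ ((continuous_apply i).comp hp)
    rw [integral_sub hd (integrable_cont _ hHc)]
    have hL := ((d2.sub (hμ _ hHc)).const_add (S.Fc μ)).add hF
    have hR := h0.const_add (-lam)
    rw [add_zero] at hL hR
    refine le_of_tendsto_of_tendsto' hL hR fun n => ?_
    have i3 : Integrable (fun q : Td d × Vd d => S.H (secT q.1) (p q.1)) (γ n) := (hbm n _ hHc).integrable (by norm_num)
    have h4 := integral_mono (μ := γ n) ((d1 n).sub i3)
      (Hstar_int S (γ n) ((secT_meas d).comp measurable_fst) measurable_snd (hsq n))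
      fun q => Hstar_young S (secT q.1) q.2 (p q.1)
    have h5 := hcost n μ
    have h6 := integral_sub (d1 n) i3
    simp only [Pi.sub_apply, Function.comp_apply] at h4 h6
    linarith

lemma stat_opt {d : ℕ} (S : MFGSetting d) {lam : ℝ} (hlam : IsLimitValueU S 1 lam)
    (hmono : ∀ μ ν : PTd d,
      0 ≤ ((∫ y, (S.Fd (μ : Measure (Td d)) (secT y) - S.Fd (ν : Measure (Td d)) (secT y))
              ∂(μ : Measure (Td d))) -
            ∫ y, (S.Fd (μ : Measure (Td d)) (secT y) - S.Fd (ν : Measure (Td d)) (secT y))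
              ∂(ν : Measure (Td d)))) :
    ∃ (μ : PTd d) (a : Td d → Vd d), StatAdm 1 μ a ∧
      (∫ y, S.Hstar (secT y) (a y) ∂(μ : Measure (Td d))) + S.Fc μ ≤ -lam := by
  obtain ⟨μ, a, hst, hai, hp⟩ := stat_limit S hlam hmono
  refine ⟨μ, a, hst, ?_⟩
  obtain ⟨M, hM0, hM⟩ := G0_bdd S
  have hPm : Measurable (fun y => Pst S (secT y) (a y)) :=
    (Pst_cont S).measurable.comp ((secT_meas d).prodMk hst.1)
  have hPb : ∀ y, sqnorm (Pst S (secT y) (a y)) ≤ S.Cbar ^ 2 * (2 * sqnorm (a y) + 2 * M) := by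
    intro y
    have h1 := Pst_dist S (secT y) (a y) 0
    rw [sub_zero] at h1
    refine h1.trans (mul_le_mul_of_nonneg_left ?_ (sq_nonneg _))
    have h2 := sqnorm_sub_le (a y) (DpH S (secT y) 0)
    have h3 := hM (secT y)
    linarith
  have hPi : ∀ i, MemLp (fun y => Pst S (secT y) (a y) i) 2 (μ : Measure (Td d)) := by
    intro i
    have hm : Measurable (fun y => Pst S (secT y) (a y) i) := (measurable_pi_apply i).comp hPm
    rw [memLp_two_iff_integrable_sq hm.aestronglyMeasurable]
    refine Integrable.mono' (((hai.const_mul 2).add (integrable_const (2 * M))).const_mul (S.Cbar ^ 2))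
      (hm.pow_const 2).aestronglyMeasurable (ae_of_all _ fun y => ?_)
    rw [Real.norm_eq_abs, abs_of_nonneg (sq_nonneg _)]
    exact (abs_le_sqnorm _ _).trans (hPb y)
  have hAi := fun i => comp_memLp (μ : Measure (Td d)) hst.1 hst.2.1 i
  refine le_of_forall_pos_le_add fun ε hε => ?_
  have hC := S.Cbar_pos
  have hη : 0 < 2 * ε / (S.Cbar * ((d:ℝ) + 1)) := by positivity
  have happ : ∀ i, ∃ g : Td d → ℝ, Continuous g ∧
      ∫ y, (g y - Pst S (secT y) (a y) i) ^ 2 ∂(μ : Measure (Td d)) ≤ 2 * ε / (S.Cbar * ((d:ℝ) + 1)) := by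
    intro i
    have h2 : MemLp (fun y => Pst S (secT y) (a y) i) (ENNReal.ofReal 2) (μ : Measure (Td d)) := by
      simpa using hPi i
    obtain ⟨g, hg, -⟩ := h2.exists_boundedContinuous_integral_rpow_sub_le two_pos hη
    refine ⟨g, g.continuous, le_trans (le_of_eq ?_) hg⟩
    refine integral_congr_ae (ae_of_all _ fun y => ?_)
    simp only [Real.norm_eq_abs, Real.rpow_two, sq_abs]
    ring
  choose g hgc hg using happ
  have hgp : Continuous (fun y i => g i y : Td d → Vd d) := continuous_pi hgc
  have h1 := hp _ hgp
  have hsi : ∀ i, Integrable (fun y => (g i y - Pst S (secT y) (a y) i) ^ 2) (μ : Measure (Td d)) := fun i =>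
    ((cont_memLp _ (hgc i)).sub (hPi i)).integrable_sq
  have hsi2 : Integrable (fun y => sqnorm ((fun i => g i y) - Pst S (secT y) (a y))) (μ : Measure (Td d)) :=
    integrable_finsetSum _ fun i _ => hsi i
  have h2 : ∫ y, sqnorm ((fun i => g i y) - Pst S (secT y) (a y)) ∂(μ : Measure (Td d)) ≤ 2 * ε / S.Cbar := by
    have e1 : ∫ y, sqnorm ((fun i => g i y) - Pst S (secT y) (a y)) ∂(μ : Measure (Td d)) =
        ∑ i, ∫ y, (g i y - Pst S (secT y) (a y) i) ^ 2 ∂(μ : Measure (Td d)) := by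
      rw [← integral_finsetSum _ fun i _ => hsi i]; rfl
    rw [e1]
    refine (Finset.sum_le_sum fun i _ => hg i).trans ?_
    simp only [Finset.sum_const, Finset.card_univ, Fintype.card_fin, nsmul_eq_mul]
    rw [← mul_div_assoc, div_le_div_iff₀ (by positivity) hC]
    have : 0 ≤ ε * S.Cbar := by positivity
    nlinarith
  have hHi := Hstar_int S (μ : Measure (Td d)) (secT_meas d) hst.1 hai
  have hHc : Continuous (fun y => S.H (secT y) (fun i => g i y)) := by
    have h := cont_secT2 (f := fun x p => S.H x p) (H_cont S) (fun x z p => S.H_per x z p)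
    exact h.comp (continuous_id.prodMk hgp)
  have hd : Integrable (fun y => dotp (a y) (fun i => g i y)) (μ : Measure (Td d)) :=
    dotp_integrable _ hAi fun i => cont_memLp _ (hgc i)
  have h3 := integral_mono (μ := (μ : Measure (Td d))) (hHi.sub (hsi2.const_mul (S.Cbar / 2)))
    (hd.sub (integrable_cont _ hHc)) fun y => Hstar_young' S (secT y) (a y) (fun i => g i y)
  have h4 := integral_sub hHi (hsi2.const_mul (S.Cbar / 2))
  rw [integral_const_mul] at h4
  simp only [Pi.sub_apply] at h3 h4
  have h5 : S.Cbar / 2 * ∫ y, sqnorm ((fun i => g i y) - Pst S (secT y) (a y)) ∂(μ : Measure (Td d)) ≤ ε := by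
    have := mul_le_mul_of_nonneg_left h2 (by positivity : 0 ≤ S.Cbar / 2)
    refine this.trans (le_of_eq ?_)
    field_simp
  rw [h4] at h3
  linarith

lemma final_eq {d : ℕ} (S : MFGSetting d) {lam : ℝ} (hlam : IsLimitValueU S 1 lam)
    (hmono : ∀ μ ν : PTd d,
      0 ≤ ((∫ y, (S.Fd (μ : Measure (Td d)) (secT y) - S.Fd (ν : Measure (Td d)) (secT y))
              ∂(μ : Measure (Td d))) -
            ∫ y, (S.Fd (μ : Measure (Td d)) (secT y) - S.Fd (ν : Measure (Td d)) (secT y))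
              ∂(ν : Measure (Td d)))) : lam = -(ergInf S 1) := by
  obtain ⟨μ, a, hst, hle⟩ := stat_opt S hlam hmono
  have hlow : ∀ r ∈ { r | ∃ m α, StatAdm 1 m α ∧
    r = (∫ y, S.Hstar (secT y) (α y) ∂(m : Measure (Td d))) + S.Fc m }, -lam ≤ r := by
    rintro r ⟨m, α, h, rfl⟩
    exact dir1 S hlam h
  have h1 : -lam ≤ ergInf S 1 := le_csInf ⟨_, μ, a, hst, rfl⟩ hlow
  have h2 : ergInf S 1 ≤ _ := csInf_le ⟨-lam, hlow⟩ ⟨μ, a, hst, rfl⟩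
  linarith

/-- Proposition 3.1 of the paper.  If the coupling is monotone, i.e.
`∫ (F(x,m₁) - F(x,m₂)) d(m₁ - m₂) ≥ 0` for all `m₁, m₂ ∈ P(𝕋^d)`, then the limit value
equals the ergodic value: `λ = λ̄` (recall `-λ̄ = ergInf S 1`). -/
theorem monotone_implies_lambda_eq (d : ℕ) (S : MFGSetting d) (lam : ℝ)
    (hlam : IsLimitValueU S 1 lam)
    (hmono : ∀ μ ν : PTd d,
      0 ≤ ((∫ y, (S.Fd (μ : Measure (Td d)) (secT y) - S.Fd (ν : Measure (Td d)) (secT y))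
              ∂(μ : Measure (Td d))) -
            ∫ y, (S.Fd (μ : Measure (Td d)) (secT y) - S.Fd (ν : Measure (Td d)) (secT y))
              ∂(ν : Measure (Td d)))) :
    lam = -(ergInf S 1) := by
  exact final_eq S hlam hmono
end
end

section
/- In the non-convex example there exists σ₀ > 0 such that for every viscosity parameter σ ∈ (0, σ₀] one has −λ < −λ̄, i.e. the limit value is strictly greater than the ergodic value: λ > λ̄. More precisely, 0 ≤ −λ ≤ σ² (C₂/2) ∫_{𝕋^d} |Dm₀(x)|²/m₀(x) dx, while −λ̄ ≥ K for a constant K > 0 independent of σ. -/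
/- Common framework for "On the long time convergence of potential MFG" (M. Masoero).

We work on the flat torus `𝕋^d`, modeled as `Td d := Fin d → AddCircle 1`.
Smooth functions on the torus are represented by `ℤ^d`-periodic functions on
`Vd d := Fin d → ℝ`; a function on `Vd d` is transported to the torus through the
canonical (measurable) section `secT : Td d → Vd d`.  Probability measures on the
torus are `PTd d := ProbabilityMeasure (Td d)`, endowed with the 1-Wasserstein
distance `W1` defined through Kantorovich duality.  The Fokker--Planck equations
and their stationary analogues are stated in the sense of distributions, i.e.
against smooth periodic test functions; `σ` is the viscosity parameter
(everywhere `σ = 1` except in the non-convex example). -/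

open MeasureTheory Real Set Filter

noncomputable section

/-- The set `𝒜` of probability measures `μ` with `div(e_j μ) = 0` in the sense of
distributions (equivalently, of the form `μ' ⊗ dx_j`). -/
def setA (d : ℕ) (j : Fin d) : Set (PTd d) :=
  { μ | ∀ g : Vd d → ℝ, ContDiff ℝ 2 g →
      (∀ (x : Vd d) (z : Fin d → ℤ), g (x + intVec z) = g x) →
      (∫ y, gradv g (secT y) j ∂(μ : Measure (Td d))) = 0 }

/-- The set `ℬ` of the translates of the fixed density `ρ₀`. -/
def setB (d : ℕ) (ρ₀ : Vd d → ℝ) : Set (PTd d) :=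
  { μ | ∃ z : Vd d, (μ : Measure (Td d)) =
      (volume : Measure (Td d)).withDensity (fun y => ENNReal.ofReal (ρ₀ (secT y + z))) }


open scoped Topology

namespace NCG

def Per {d : ℕ} {β : Type*} (g : Vd d → β) : Prop :=
  ∀ (x : Vd d) (z : Fin d → ℤ), g (x + intVec z) = g x

def piT {d : ℕ} (x : Vd d) : Td d := fun i => ((x i : ℝ) : AddCircle (1:ℝ))

lemma secT_piT {d : ℕ} (x : Vd d) : ∃ z : Fin d → ℤ, secT (piT x) = x + intVec z := by
  refine ⟨fun i => -⌊x i⌋, ?_⟩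
  funext i
  have := AddCircle.coe_equivIco_mk_apply (p := (1:ℝ)) (x i)
  simp only [secT, piT, Pi.add_apply, intVec]
  refine this.trans ?_
  rw [div_one, mul_one, Int.fract]
  push_cast; ring

lemma piT_secT {d : ℕ} (y : Td d) : piT (secT y) = y := by
  funext i
  exact AddCircle.coe_equivIco

lemma piT_add {d : ℕ} (x a : Vd d) : piT (x + a) = piT x + piT a := by
  funext i; simp [piT]

lemma Per.secT_piT {d : ℕ} {β : Type*} {g : Vd d → β} (hg : Per g) (x : Vd d) :
    g (secT (piT x)) = g x := by
  obtain ⟨z, hz⟩ := NCG.secT_piT x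
  rw [hz, hg]

lemma Per.secT_add {d : ℕ} {β : Type*} {g : Vd d → β} (hg : Per g) (y : Td d) (a : Vd d) :
    g (secT (y + piT a)) = g (secT y + a) := by
  conv_lhs => rw [← piT_secT y, ← piT_add]
  exact hg.secT_piT _

lemma Per.shift {d : ℕ} {β : Type*} {g : Vd d → β} (hg : Per g) (a : Vd d) :
    Per (fun x => g (x + a)) := by
  intro x z
  show g (x + intVec z + a) = _
  rw [add_right_comm, hg]

lemma quot_piT {d : ℕ} : IsOpenQuotientMap (piT : Vd d → Td d) :=
  IsOpenQuotientMap.piMap (f := fun (_ : Fin d) (x : ℝ) => (x : AddCircle (1:ℝ)))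
    (fun _ => QuotientAddGroup.isOpenQuotientMap_mk)

lemma cont_secT {d : ℕ} {β : Type*} [TopologicalSpace β] {g : Vd d → β} (hg : Per g)
    (hc : Continuous g) : Continuous (fun y : Td d => g (secT y)) := by
  rw [quot_piT.isQuotientMap.continuous_iff]
  have : (fun y : Td d => g (secT y)) ∘ piT = g := funext fun x => hg.secT_piT x
  rwa [this]

lemma cont_secT2 {d : ℕ} {X β : Type*} [TopologicalSpace X] [TopologicalSpace β]
    {g : X → Vd d → β} (hg : ∀ t, Per (g t))
    (hc : Continuous (fun q : X × Vd d => g q.1 q.2)) :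
    Continuous (fun q : X × Td d => g q.1 (secT q.2)) := by
  rw [((IsOpenQuotientMap.id (X := X)).prodMap (quot_piT (d := d))).isQuotientMap.continuous_iff]
  have : (fun q : X × Td d => g q.1 (secT q.2)) ∘ (Prod.map id piT)
      = (fun q : X × Vd d => g q.1 q.2) := funext fun x => (hg x.1).secT_piT x.2
  rwa [this]

lemma meas_secT {d : ℕ} : Measurable (secT : Td d → Vd d) := by
  refine measurable_pi_lambda _ fun i => ?_
  have h : Measurable (fun x : AddCircle (1:ℝ) => ((AddCircle.equivIco 1 0) x).1) :=
    measurable_subtype_coe.comp (AddCircle.measurableEquivIco (1:ℝ) 0).measurable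
  exact h.comp (measurable_pi_apply i)

lemma integrable_secT {d : ℕ} {g : Vd d → ℝ} (hg : Per g)
    (hc : Continuous g) (μ : Measure (Td d)) [IsFiniteMeasure μ] :
    Integrable (fun y : Td d => g (secT y)) μ :=
  (cont_secT hg hc).integrable_of_hasCompactSupport (HasCompactSupport.of_compactSpace _)

lemma bdd_secT {d : ℕ} {g : Vd d → ℝ} (hg : Per g) (hc : Continuous g) :
    ∃ M : ℝ, 0 ≤ M ∧ ∀ x, |g x| ≤ M := by
  have h := isCompact_range (cont_secT hg hc)
  obtain ⟨M, hM⟩ := h.isBounded.exists_norm_le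
  refine ⟨|M|, abs_nonneg _, fun x => ?_⟩
  rw [← hg.secT_piT x]
  exact (hM _ ⟨piT x, rfl⟩).trans (le_abs_self _)

lemma int_trans {d : ℕ} {g : Vd d → ℝ} (hg : Per g) (a : Vd d) :
    ∫ y : Td d, g (secT y + a) = ∫ y : Td d, g (secT y) := by
  simp_rw [← hg.secT_add]
  exact integral_add_right_eq_self (fun y => g (secT y)) (piT a)

lemma int_diff {d : ℕ} {Ψ Ψ' : ℝ → Vd d → ℝ} (hp : ∀ t, Per (Ψ t)) (hp' : ∀ t, Per (Ψ' t))
    (hc : ∀ t, Continuous (Ψ t)) (hc' : Continuous (fun q : ℝ × Vd d => Ψ' q.1 q.2))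
    (hd : ∀ t x, HasDerivAt (fun s => Ψ s x) (Ψ' t x) t) (a b : ℝ) :
    (∫ y : Td d, Ψ b (secT y)) - ∫ y : Td d, Ψ a (secT y) =
      ∫ t in a..b, ∫ y : Td d, Ψ' t (secT y) := by
  have hcc := cont_secT2 hp' hc'
  rw [intervalIntegral_integral_swap]
  · rw [← integral_sub (integrable_secT (hp b) (hc b) _) (integrable_secT (hp a) (hc a) _)]
    congr 1
    funext y
    symm
    refine intervalIntegral.integral_eq_sub_of_hasDerivAt (fun t _ => hd t _) ?_
    apply Continuous.intervalIntegrable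
    exact hc'.comp (by fun_prop : Continuous fun t : ℝ => (t, secT y))
  · have h1 : IsCompact (uIcc a b ×ˢ (univ : Set (Td d))) := isCompact_uIcc.prod isCompact_univ
    have h2 := (hcc.continuousOn (s := uIcc a b ×ˢ (univ : Set (Td d)))).integrableOn_compact h1
      (μ := (volume : Measure ℝ).prod (volume : Measure (Td d)))
    have h3 := h2.mono_set (Set.prod_mono_left uIoc_subset_uIcc)
    rw [IntegrableOn, ← Measure.prod_restrict, Measure.restrict_univ] at h3
    exact h3

lemma int_deriv_zero {d : ℕ} {G : Vd d → ℝ} (hG : Per G) (hc : ContDiff ℝ 1 G) (v : Vd d) :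
    ∫ y : Td d, fderiv ℝ G (secT y) v = 0 := by
  have hcf : Continuous (fun x => fderiv ℝ G x v) :=
    (hc.continuous_fderiv (by norm_num)).clm_apply continuous_const
  have hpf : Per (fun x => fderiv ℝ G x v) := by
    intro x z
    have : fderiv ℝ (fun x => G (x + intVec z)) x = fderiv ℝ G (x + intVec z) :=
      fderiv_comp_add_right _
    show fderiv ℝ G (x + intVec z) v = _
    rw [← this]
    congr 2
    funext x; exact hG x z
  have h := int_diff (Ψ := fun t x => G (x + t • v)) (Ψ' := fun t x => fderiv ℝ G (x + t • v) v)
    (fun t => hG.shift _) (fun t => hpf.shift (t • v))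
    (fun t => hc.continuous.comp (by fun_prop))
    (hcf.comp (by fun_prop : Continuous fun q : ℝ × Vd d => q.2 + q.1 • v))
    (fun t x => by
      have h1 : HasDerivAt (fun s : ℝ => x + s • v) v t := by
        simpa using ((hasDerivAt_id t).smul_const v).const_add x
      exact ((hc.differentiable (by norm_num)) _).hasFDerivAt.comp_hasDerivAt t h1) 0 1
  rw [int_trans hG, int_trans hG, sub_self] at h
  simp_rw [int_trans hpf] at h
  simpa using h.symm

end NCG

namespace NCG

lemma sqnorm_nonneg {d : ℕ} (v : Vd d) : 0 ≤ sqnorm v := Finset.sum_nonneg fun _ _ => sq_nonneg _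

lemma sqnorm_pos {d : ℕ} {v : Vd d} (hv : v ≠ 0) : 0 < sqnorm v := by
  obtain ⟨i, hi⟩ := Function.ne_iff.mp hv
  refine Finset.sum_pos' (fun _ _ => sq_nonneg _) ⟨i, Finset.mem_univ _, ?_⟩
  have : v i ≠ 0 := hi
  positivity

lemma quad_bounds {d : ℕ} {f : Vd d → ℝ} (hf : ConvexOn ℝ univ f) {e : Vd d} (hfe : f e = 0)
    (hf0 : ∀ x, 0 ≤ f x) {C₁ C₂ : ℝ} (hC₁ : 0 < C₁)
    (hlow : ∀ p v : Vd d, C₁ * sqnorm v ≤ D2 f p v v)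
    (hup : ∀ p v : Vd d, D2 f p v v ≤ C₂ * sqnorm v) (v : Vd d) :
    C₁ / 2 * sqnorm v ≤ f (e + v) ∧ f (e + v) ≤ C₂ / 2 * sqnorm v := by
  rcases eq_or_ne v 0 with rfl | hv
  · simp [sqnorm, hfe]
  have hq := sqnorm_pos hv
  set q := sqnorm v
  have hcont : Continuous f := by
    rw [← continuousOn_univ]
    exact hf.continuousOn isOpen_univ
  have hgd : ∀ p, DifferentiableAt ℝ (fun y => fderiv ℝ f y v) p := by
    intro p
    by_contra h
    have h1 := hlow p v
    rw [D2, fderiv_zero_of_not_differentiableAt h] at h1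
    have : 0 < C₁ * q := mul_pos hC₁ hq
    simp at h1
    linarith
  have hline : ∀ t : ℝ, HasDerivAt (fun s : ℝ => e + s • v) v t := fun t => by
    simpa using ((hasDerivAt_id t).smul_const v).const_add e
  set γ : ℝ → ℝ := fun t => fderiv ℝ f (e + t • v) v with hγ
  have hγd : ∀ t, HasDerivAt γ (D2 f (e + t • v) v v) t := fun t =>
    ((hgd (e + t • v)).hasFDerivAt.comp_hasDerivAt t (hline t) :)
  have hγ0 : γ 0 = 0 := by
    have hm : IsLocalMin f e := Filter.Eventually.of_forall fun x => by rw [hfe]; exact hf0 x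
    simp [hγ, hm.fderiv_eq_zero]
  have hγdiff : Differentiable ℝ γ := fun t => (hγd t).differentiableAt
  have hγlow : ∀ t, 0 ≤ t → C₁ * q * t ≤ γ t := fun t ht => by
    have := mul_sub_le_image_sub_of_le_deriv hγdiff (C := C₁ * q)
      (fun x => by rw [(hγd x).deriv]; exact hlow _ _) ht
    simpa [hγ0] using this
  have hγup : ∀ t, 0 ≤ t → γ t ≤ C₂ * q * t := fun t ht => by
    have := image_sub_le_mul_sub_of_deriv_le hγdiff (C := C₂ * q)
      (fun x => by rw [(hγd x).deriv]; exact hup _ _) ht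
    simpa [hγ0] using this
  set φ : ℝ → ℝ := fun t => f (e + t • v) with hφ
  have hφc : Continuous φ := hcont.comp (by fun_prop)
  have hφd : ∀ t, 0 < t → HasDerivAt φ (γ t) t := by
    intro t ht
    have hpos : 0 < γ t := lt_of_lt_of_le (by positivity) (hγlow t ht.le)
    have hdf : DifferentiableAt ℝ f (e + t • v) := by
      by_contra h
      simp [hγ, fderiv_zero_of_not_differentiableAt h] at hpos
    exact hdf.hasFDerivAt.comp_hasDerivAt t (hline t)
  have hpoly : ∀ (C t : ℝ), HasDerivAt (fun t : ℝ => C / 2 * q * t ^ 2) (C * q * t) t := by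
    intro C t
    have := (hasDerivAt_pow 2 t).const_mul (C / 2 * q)
    have h2 : C * q * t = C / 2 * q * (((2:ℕ):ℝ) * t ^ (2 - 1)) := by norm_num; ring
    rw [h2]
    exact this
  have h0 : φ 0 = 0 := by simp [hφ, hfe]
  have h1 : φ 1 = f (e + v) := by simp [hφ]
  constructor
  · have hm : MonotoneOn (fun t => φ t - C₁ / 2 * q * t ^ 2) (Icc 0 1) := by
      apply monotoneOn_of_deriv_nonneg (convex_Icc 0 1)
      · exact (hφc.sub (by fun_prop)).continuousOn
      · intro t ht
        rw [interior_Icc] at ht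
        exact ((hφd t ht.1).sub (hpoly C₁ t)).differentiableAt.differentiableWithinAt
      · intro t ht
        rw [interior_Icc] at ht
        have hh : deriv (fun t => φ t - C₁ / 2 * q * t ^ 2) t = γ t - C₁ * q * t :=
          ((hφd t ht.1).sub (hpoly C₁ t)).deriv
        rw [hh]
        linarith [hγlow t ht.1.le]
    have := hm (left_mem_Icc.2 zero_le_one) (right_mem_Icc.2 zero_le_one) zero_le_one
    simp only [h0, h1] at this
    linarith
  · have hm : AntitoneOn (fun t => φ t - C₂ / 2 * q * t ^ 2) (Icc 0 1) := by
      apply antitoneOn_of_deriv_nonpos (convex_Icc 0 1)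
      · exact (hφc.sub (by fun_prop)).continuousOn
      · intro t ht
        rw [interior_Icc] at ht
        exact ((hφd t ht.1).sub (hpoly C₂ t)).differentiableAt.differentiableWithinAt
      · intro t ht
        rw [interior_Icc] at ht
        have hh : deriv (fun t => φ t - C₂ / 2 * q * t ^ 2) t = γ t - C₂ * q * t :=
          ((hφd t ht.1).sub (hpoly C₂ t)).deriv
        rw [hh]
        linarith [hγup t ht.1.le]
    have := hm (left_mem_Icc.2 zero_le_one) (right_mem_Icc.2 zero_le_one) zero_le_one
    simp only [h0, h1] at this
    linarith

lemma Hstar_convex {d : ℕ} (S : MFGSetting d) (x : Vd d) : ConvexOn ℝ univ (S.Hstar x) := by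
  refine ⟨convex_univ, fun p _ q _ a b ha hb hab => ?_⟩
  refine (S.Hstar_eq x _).2 ?_
  rintro _ ⟨r, rfl⟩
  have h1 := (S.Hstar_eq x p).1 ⟨r, rfl⟩
  have h2 := (S.Hstar_eq x q).1 ⟨r, rfl⟩
  have h3 : dotp (a • p + b • q) r = a * dotp p r + b * dotp q r := by
    simp only [dotp, Finset.mul_sum, ← Finset.sum_add_distrib]
    refine Finset.sum_congr rfl fun i _ => ?_
    simp; ring
  simp only [h3, smul_eq_mul] at *
  have hb' : b = 1 - a := by linarith
  subst hb'
  nlinarith [mul_le_mul_of_nonneg_left h1 ha, mul_le_mul_of_nonneg_left h2 hb]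

lemma Hstar_meas {d : ℕ} (S : MFGSetting d) :
    Measurable (fun q : Vd d × Vd d => S.Hstar q.1 q.2) := by
  have h : (fun q : Vd d × Vd d => S.Hstar q.1 q.2) =
      fun q : Vd d × Vd d => ⨆ p, (dotp q.2 p - S.H q.1 p) := by
    funext q
    exact ((S.Hstar_eq q.1 q.2).ciSup_eq).symm
  rw [h]
  apply LowerSemicontinuous.measurable
  apply lowerSemicontinuous_ciSup
  · intro q
    exact ⟨_, (S.Hstar_eq q.1 q.2).1⟩
  · intro p
    apply Continuous.lowerSemicontinuous
    unfold dotp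
    have h2 : Continuous fun q : Vd d × Vd d => S.H q.1 p :=
      S.H_smooth.continuous.comp (by fun_prop : Continuous fun q : Vd d × Vd d => (q.1, p))
    fun_prop

end NCG

namespace NCG

lemma Per.fderiv {d : ℕ} {g : Vd d → ℝ} (hg : Per g) : Per (fderiv ℝ g) := by
  intro x z
  have : _root_.fderiv ℝ (fun x => g (x + intVec z)) x = _root_.fderiv ℝ g (x + intVec z) :=
    fderiv_comp_add_right _
  rw [← this]
  congr 1
  funext x; exact hg x z

lemma Per.fderiv_apply {d : ℕ} {g : Vd d → ℝ} (hg : Per g) (v : Vd d) :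
    Per (fun x => _root_.fderiv ℝ g x v) := fun x z => by
  show (_root_.fderiv ℝ g (x + intVec z)) v = _
  rw [hg.fderiv x z]

lemma Per.gradv {d : ℕ} {g : Vd d → ℝ} (hg : Per g) : Per (gradv g) := fun x z => by
  funext i; exact hg.fderiv_apply _ x z

lemma Per.lapl {d : ℕ} {g : Vd d → ℝ} (hg : Per g) : Per (lapl g) := fun x z => by
  unfold _root_.lapl D2
  exact Finset.sum_congr rfl fun i _ => (hg.fderiv_apply _).fderiv_apply _ x z

lemma cd1 {d : ℕ} {g : Vd d → ℝ} (hg : ContDiff ℝ 2 g) (v : Vd d) :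
    ContDiff ℝ 1 (fun x => fderiv ℝ g x v) :=
  (hg.fderiv_right (m := 1) (by norm_num)).clm_apply contDiff_const

lemma cont_grad {d : ℕ} {g : Vd d → ℝ} (hg : ContDiff ℝ 2 g) : Continuous (gradv g) :=
  continuous_pi fun _ => (cd1 hg _).continuous

lemma cont_lapl {d : ℕ} {g : Vd d → ℝ} (hg : ContDiff ℝ 2 g) : Continuous (lapl g) := by
  unfold lapl D2
  exact continuous_finsetSum _ fun i _ =>
    ((cd1 hg _).continuous_fderiv (by norm_num)).clm_apply continuous_const

lemma sqnorm_cont {d : ℕ} : Continuous (sqnorm : Vd d → ℝ) := by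
  unfold sqnorm; fun_prop

lemma Fd_lip {d : ℕ} {f : Vd d → ℝ} (hp : Per f) (hc : ContDiff ℝ 2 f) {C : ℝ}
    (hD : ∀ x v w : Vd d, |D2 f x v w| ≤ C * ‖v‖ * ‖w‖) (hC : 0 ≤ C) (x x' : Vd d) :
    |f x - f x'| ≤ (d * C) * ‖x - x'‖ := by
  have hdf : Differentiable ℝ f := hc.differentiable (by norm_num)
  have h1 : ∀ (x : Vd d) (i : Fin d), |fderiv ℝ f x (Pi.single i 1)| ≤ C := by
    intro x i
    set e : Vd d := Pi.single i 1 with he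
    have hen : ‖e‖ = 1 := by rw [he, Pi.norm_single, norm_one]
    have hline : ∀ t : ℝ, HasDerivAt (fun s : ℝ => x + s • e) e t := fun t => by
      simpa using ((hasDerivAt_id t).smul_const e).const_add x
    have hφ : ∀ t : ℝ, HasDerivAt (fun s : ℝ => f (x + s • e)) (fderiv ℝ f (x + t • e) e) t :=
      fun t => ((hdf (x + t • e)).hasFDerivAt.comp_hasDerivAt t (hline t) :)
    have hγ : ∀ t : ℝ, HasDerivAt (fun s : ℝ => fderiv ℝ f (x + s • e) e)
        (D2 f (x + t • e) e e) t := fun t =>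
      ((((cd1 hc e).differentiable (by norm_num)) (x + t • e)).hasFDerivAt.comp_hasDerivAt t
        (hline t) :)
    have hend : f (x + (0:ℝ) • e) = f (x + (1:ℝ) • e) := by
      have hz : e = intVec (Pi.single i 1) := by
        funext k
        simp only [he, intVec]
        by_cases hk : k = i
        · subst hk; simp
        · simp [hk]
      rw [zero_smul, add_zero, one_smul, hz, hp]
    obtain ⟨t, ht, ht0⟩ := exists_hasDerivAt_eq_zero (f := fun s : ℝ => f (x + s • e))
      zero_lt_one
      (HasDerivAt.continuousOn fun t _ => hφ t) hend (fun t _ => hφ t)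
    have hb := (convex_Icc (0:ℝ) 1).norm_image_sub_le_of_norm_hasDerivWithin_le (C := C)
      (f := fun s : ℝ => fderiv ℝ f (x + s • e) e)
      (fun s _ => (hγ s).hasDerivWithinAt)
      (fun s _ => by simpa [hen] using hD (x + s • e) e e)
      (⟨ht.1.le, ht.2.le⟩ : t ∈ Icc (0:ℝ) 1) (⟨le_rfl, zero_le_one⟩ : (0:ℝ) ∈ Icc (0:ℝ) 1)
    simp only [ht0, zero_smul, add_zero, sub_zero, Real.norm_eq_abs, zero_sub, abs_neg] at hb
    rw [abs_of_pos ht.1] at hb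
    nlinarith [ht.2]
  have h2 : ∀ x ∈ (univ : Set (Vd d)), ‖fderiv ℝ f x‖ ≤ d * C := by
    intro x _
    refine ContinuousLinearMap.opNorm_le_bound _ (by positivity) fun v => ?_
    have hv : v = ∑ i, v i • (Pi.single i (1:ℝ) : Vd d) := by
      funext k; simp [Finset.sum_apply, Pi.single_apply]
    conv_lhs => rw [hv]
    rw [map_sum]
    refine (norm_sum_le _ _).trans ?_
    have : ∀ i ∈ (Finset.univ : Finset (Fin d)),
        ‖fderiv ℝ f x (v i • (Pi.single i (1:ℝ) : Vd d))‖ ≤ ‖v‖ * C := by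
      intro i _
      rw [map_smul, norm_smul]
      exact mul_le_mul (norm_le_pi_norm v i) (h1 x i) (norm_nonneg _) (norm_nonneg _)
    refine (Finset.sum_le_card_nsmul _ _ _ this).trans ?_
    simp; linarith
  have := convex_univ.norm_image_sub_le_of_norm_fderiv_le (fun x _ => hdf x) h2
    (mem_univ x') (mem_univ x)
  simpa using this

lemma lip_torus {d : ℕ} {f : Vd d → ℝ} (hp : Per f) {L : ℝ} (hL : 0 ≤ L)
    (h : ∀ x x', |f x - f x'| ≤ L * ‖x - x'‖) (y y' : Td d) :
    |f (secT y) - f (secT y')| ≤ L * dist y y' := by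
  set x := secT y
  set x' := secT y'
  let z : Fin d → ℤ := fun i => round (x i - x' i)
  have hx : f x' = f (x' + intVec z) := (hp _ _).symm
  rw [hx]
  refine (h _ _).trans (mul_le_mul_of_nonneg_left ?_ hL)
  refine (pi_norm_le_iff_of_nonneg dist_nonneg).2 fun i => ?_
  refine le_trans (le_of_eq ?_) (dist_le_pi_dist y y' i)
  have hy : y i = ((x i : ℝ) : AddCircle (1:ℝ)) := (congrFun (piT_secT y) i).symm
  have hy' : y' i = ((x' i : ℝ) : AddCircle (1:ℝ)) := (congrFun (piT_secT y') i).symm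
  rw [hy, hy', dist_eq_norm, ← AddCircle.coe_sub]
  have := UnitAddCircle.norm_eq (x := x i - x' i)
  refine Eq.trans ?_ this.symm
  simp only [Pi.sub_apply, Pi.add_apply, intVec, Real.norm_eq_abs, z]
  congr 1; ring

lemma unif_conv {d : ℕ} {ι : Type*} {l : Filter ι} {m : ι → PTd d} {m' : PTd d}
    (hm : Tendsto m l (𝓝 m')) (L M : ℝ) {ε : ℝ} (hε : 0 < ε) :
    ∀ᶠ n in l, ∀ f : Td d → ℝ, (∀ y y', |f y - f y'| ≤ L * dist y y') → (∀ y, |f y| ≤ M) →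
      |(∫ y, f y ∂(m n : Measure (Td d))) - ∫ y, f y ∂(m' : Measure (Td d))| ≤ ε := by
  let A : Set (BoundedContinuousFunction (Td d) ℝ) :=
    {f | (∀ y y', |f y - f y'| ≤ L * dist y y') ∧ ∀ y, |f y| ≤ M}
  have hA : IsCompact (closure A) := by
    refine BoundedContinuousFunction.arzela_ascoli (Icc (-M) M) isCompact_Icc A
      (fun f x hf => abs_le.1 (hf.2 x)) ?_
    refine UniformEquicontinuous.equicontinuous ?_
    refine LipschitzWith.uniformEquicontinuous _ (Real.toNNReal L) fun f => ?_
    refine LipschitzWith.of_dist_le_mul fun y y' => ?_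
    rw [Real.dist_eq]
    exact (f.2.1 y y').trans (mul_le_mul_of_nonneg_right (Real.le_coe_toNNReal L) dist_nonneg)
  have htb : TotallyBounded A := hA.totallyBounded.subset subset_closure
  obtain ⟨t, htf, ht⟩ := Metric.totallyBounded_iff.1 htb (ε / 3) (by positivity)
  rw [ProbabilityMeasure.tendsto_iff_forall_integral_tendsto] at hm
  have hev : ∀ᶠ n in l, ∀ g ∈ t,
      |(∫ y, g y ∂(m n : Measure (Td d))) - ∫ y, g y ∂(m' : Measure (Td d))| < ε / 3 := by
    rw [Filter.eventually_all_finite htf]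
    intro g _
    have := Metric.tendsto_nhds.1 (hm g) (ε / 3) (by positivity)
    simpa [Real.dist_eq] using this
  filter_upwards [hev] with n hn f hf1 hf2
  have hfc : Continuous f := by
    refine (LipschitzWith.of_dist_le_mul (K := Real.toNNReal L) fun y y' => ?_).continuous
    rw [Real.dist_eq]
    exact (hf1 y y').trans (mul_le_mul_of_nonneg_right (Real.le_coe_toNNReal L) dist_nonneg)
  let fb : BoundedContinuousFunction (Td d) ℝ := BoundedContinuousFunction.mkOfCompact ⟨f, hfc⟩
  have hfA : fb ∈ A := ⟨hf1, hf2⟩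
  obtain ⟨g, hg, hgd⟩ := Set.mem_iUnion₂.1 (ht hfA)
  have key : ∀ μ : PTd d, |(∫ y, f y ∂(μ : Measure (Td d))) - ∫ y, g y ∂(μ : Measure (Td d))|
      ≤ ε / 3 := by
    intro μ
    have e1 := fb.integrable (μ : Measure (Td d))
    have e2 := g.integrable (μ : Measure (Td d))
    have : (∫ y, f y ∂(μ : Measure (Td d))) = ∫ y, fb y ∂(μ : Measure (Td d)) := rfl
    rw [this, ← integral_sub e1 e2]
    have := norm_integral_le_of_norm_le_const (μ := (μ : Measure (Td d)))
      (f := fun y => fb y - g y) (C := ε / 3)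
      (Filter.Eventually.of_forall fun y => by
        rw [← dist_eq_norm]
        exact (BoundedContinuousFunction.dist_coe_le_dist y).trans (Metric.mem_ball.1 hgd).le)
    simpa using this
  have k1 := abs_le.1 (key (m n))
  have k2 := abs_le.1 (key m')
  have k3 := abs_lt.1 (hn g hg)
  rw [abs_le]
  constructor <;> linarith [k1.1, k1.2, k2.1, k2.2, k3.1, k3.2]

lemma Fc_tendsto {d : ℕ} (S : MFGSetting d) {ι : Type*} {l : Filter ι} {m : ι → PTd d}
    {m' : PTd d} (hm : Tendsto m l (𝓝 m')) :
    Tendsto (fun n => S.Fc (m n)) l (𝓝 (S.Fc m')) := by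
  obtain ⟨M, hM⟩ := S.Fd_bounded
  rw [Metric.tendsto_nhds]
  intro ε hε
  have := unif_conv hm (d * |S.CF|) M (half_pos hε)
  filter_upwards [this] with n hn
  rw [Real.dist_eq, S.flat_deriv m' (m n)]
  have hb := norm_setIntegral_le_of_norm_le_const (μ := (volume : Measure ℝ)) (s := Icc (0:ℝ) 1)
    (f := fun t => (∫ y, S.Fd (lineComb t m' (m n)) (secT y) ∂(m n : Measure (Td d))) -
        ∫ y, S.Fd (lineComb t m' (m n)) (secT y) ∂(m' : Measure (Td d))) (C := ε / 2)
    (by simp) ?_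
  · simp only [Real.norm_eq_abs] at hb
    refine lt_of_le_of_lt hb ?_
    simp; linarith
  · intro t ht
    have hprob : IsProbabilityMeasure (lineComb t m' (m n)) := by
      constructor
      simp only [lineComb, Measure.add_apply, Measure.smul_apply, measure_univ, smul_eq_mul,
        mul_one]
      rw [← ENNReal.ofReal_add (by linarith [ht.2]) ht.1]
      simp
    have hper : Per (S.Fd (lineComb t m' (m n))) := S.Fd_per _
    refine hn _ ?_ ?_
    · exact lip_torus hper (by positivity) (Fd_lip hper (S.Fd_smooth _ hprob)
        (fun x v w => (S.Fd_D2_bound _ hprob x v w).trans (by gcongr; exact le_abs_self _))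
        (abs_nonneg _))
    · intro y
      exact hM ⟨_, hprob⟩ (secT y)

end NCG

namespace NCG

lemma sqnorm_integrable {d : ℕ} {μ : Measure (Td d)} {α : Td d → Vd d}
    (hα : Measurable α) (hfin : (∫⁻ y, ENNReal.ofReal (sqnorm (α y)) ∂μ) < ⊤) :
    Integrable (fun y => sqnorm (α y)) μ := by
  refine ⟨(sqnorm_cont.measurable.comp hα).aestronglyMeasurable, ?_⟩
  rw [hasFiniteIntegral_iff_ofReal (Filter.Eventually.of_forall fun y => sqnorm_nonneg _)]
  exact hfin

lemma sqnorm_sub_le {d : ℕ} (a e : Vd d) : sqnorm (a - e) ≤ 2 * sqnorm a + 2 * sqnorm e := by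
  simp only [sqnorm, Finset.mul_sum, ← Finset.sum_add_distrib]
  refine Finset.sum_le_sum fun i _ => ?_
  simp only [Pi.sub_apply]
  nlinarith [sq_nonneg (a i + e i)]

lemma dotp_le {d : ℕ} (a b : Vd d) {δ : ℝ} (hδ : 0 < δ) :
    |dotp a b| ≤ δ⁻¹ * sqnorm a + δ * sqnorm b := by
  simp only [sqnorm, dotp, Finset.mul_sum, ← Finset.sum_add_distrib]
  refine (Finset.abs_sum_le_sum_abs _ _).trans (Finset.sum_le_sum fun i _ => ?_)
  rw [abs_mul]
  have h1 : δ⁻¹ * a i ^ 2 + δ * b i ^ 2 - |a i| * |b i| =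
      δ⁻¹ * ((|a i| - δ / 2 * |b i|) ^ 2 + 3 / 4 * (δ * |b i|) ^ 2) := by
    rw [← sq_abs (a i), ← sq_abs (b i)]
    field_simp
    ring
  have h2 : 0 ≤ δ⁻¹ * ((|a i| - δ / 2 * |b i|) ^ 2 + 3 / 4 * (δ * |b i|) ^ 2) := by positivity
  linarith

/-- quadratic two sided bound on the Lagrangian -/
def QB {d : ℕ} (S : MFGSetting d) (e : Vd d) (C₁ C₂ : ℝ) : Prop :=
  ∀ x p : Vd d, C₁ / 2 * sqnorm (p - e) ≤ S.Hstar x p ∧ S.Hstar x p ≤ C₂ / 2 * sqnorm (p - e)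

lemma stat_est {d : ℕ} (S : MFGSetting d) (j : Fin d) {C₁ C₂ : ℝ} (hC₁ : 0 < C₁)
    (hQ : QB S (-(Pi.single j 1)) C₁ C₂) {σ : ℝ} (hσ : 0 < σ) {m : PTd d} {α : Td d → Vd d}
    (h : StatAdm σ m α) :
    0 ≤ (∫ y, S.Hstar (secT y) (α y) ∂(m : Measure (Td d))) ∧
    ∀ g : Vd d → ℝ, ContDiff ℝ 2 g → Per g → ∀ G L : ℝ, (∀ x, sqnorm (gradv g x) ≤ G) →
      (∀ x, |lapl g x| ≤ L) → ∀ δ > 0,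
      |∫ y, gradv g (secT y) j ∂(m : Measure (Td d))| ≤
        δ⁻¹ * (2 / C₁ * ∫ y, S.Hstar (secT y) (α y) ∂(m : Measure (Td d))) + δ * G + σ * L := by
  obtain ⟨hα, hfin, hst⟩ := h
  set e : Vd d := -(Pi.single j 1) with he
  have hαi := sqnorm_integrable hα hfin
  have hβm : Measurable (fun y => sqnorm (α y - e)) :=
    sqnorm_cont.measurable.comp (hα.sub_const e)
  have hβi : Integrable (fun y => sqnorm (α y - e)) (m : Measure (Td d)) := by
    refine Integrable.mono' ((hαi.const_mul 2).add (integrable_const (2 * sqnorm e)))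
      hβm.aestronglyMeasurable (Filter.Eventually.of_forall fun y => ?_)
    rw [Real.norm_eq_abs, abs_of_nonneg (sqnorm_nonneg _)]
    exact sqnorm_sub_le _ _
  have hH0 : ∀ y, 0 ≤ S.Hstar (secT y) (α y) := fun y =>
    le_trans (mul_nonneg (by positivity) (sqnorm_nonneg _)) (hQ _ _).1
  have hHi : Integrable (fun y => S.Hstar (secT y) (α y)) (m : Measure (Td d)) := by
    refine Integrable.mono' (hβi.const_mul (C₂ / 2))
      ((Hstar_meas S).comp (meas_secT.prodMk hα)).aestronglyMeasurable
      (Filter.Eventually.of_forall fun y => ?_)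
    rw [Real.norm_eq_abs, abs_of_nonneg (hH0 y)]
    exact (hQ _ _).2
  refine ⟨integral_nonneg hH0, fun g hg hgp G L hG hL δ hδ => ?_⟩
  have hβle : ∫ y, sqnorm (α y - e) ∂(m : Measure (Td d)) ≤
      2 / C₁ * ∫ y, S.Hstar (secT y) (α y) ∂(m : Measure (Td d)) := by
    rw [← integral_const_mul]
    refine integral_mono hβi (hHi.const_mul _) fun y => ?_
    have := (hQ (secT y) (α y)).1
    show sqnorm (α y - e) ≤ 2 / C₁ * S.Hstar (secT y) (α y)
    have h3 := mul_le_mul_of_nonneg_left this (by positivity : 0 ≤ 2 / C₁)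
    have h4 : 2 / C₁ * (C₁ / 2 * sqnorm (α y - e)) = sqnorm (α y - e) := by field_simp
    linarith
  have hdot_m : Measurable (fun y => dotp (α y - e) (gradv g (secT y))) := by
    have hgm : Measurable (fun y : Td d => gradv g (secT y)) :=
      (cont_grad hg).measurable.comp meas_secT
    unfold dotp
    refine Finset.measurable_sum _ fun i _ => ?_
    exact ((measurable_pi_apply i).comp (hα.sub_const e)).mul ((measurable_pi_apply i).comp hgm)
  have hbd : ∀ y, |dotp (α y - e) (gradv g (secT y))| ≤ δ⁻¹ * sqnorm (α y - e) + δ * G :=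
    fun y => (dotp_le _ _ hδ).trans (by gcongr; exact hG _)
  have hdi : Integrable (fun y => dotp (α y - e) (gradv g (secT y))) (m : Measure (Td d)) :=
    Integrable.mono' ((hβi.const_mul δ⁻¹).add (integrable_const (δ * G)))
      hdot_m.aestronglyMeasurable (Filter.Eventually.of_forall hbd)
  have hli : Integrable (fun y => lapl g (secT y)) (m : Measure (Td d)) :=
    integrable_secT hgp.lapl (cont_lapl hg) _
  have hgi : Integrable (fun y => gradv g (secT y) j) (m : Measure (Td d)) :=
    integrable_secT (g := fun x => gradv g x j) (fun x z => congrFun (hgp.gradv x z) j)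
      ((continuous_apply j).comp (cont_grad hg)) _
  have h0 := hst g hg hgp
  have heq : ∀ y, σ * lapl g (secT y) - dotp (α y) (gradv g (secT y)) =
      σ * lapl g (secT y) - dotp (α y - e) (gradv g (secT y)) + gradv g (secT y) j := by
    intro y
    have h5 : dotp e (gradv g (secT y)) = - gradv g (secT y) j := by
      simp [dotp, he, Pi.single_apply]
    have h6 : dotp (α y - e) (gradv g (secT y)) =
        dotp (α y) (gradv g (secT y)) - dotp e (gradv g (secT y)) := by
      simp only [dotp, ← Finset.sum_sub_distrib, Pi.sub_apply, sub_mul]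
    rw [h6, h5]; ring
  simp_rw [heq] at h0
  have hsub : Integrable (fun y => σ * lapl g (secT y) - dotp (α y - e) (gradv g (secT y)))
    (m : Measure (Td d)) := (hli.const_mul σ).sub hdi
  rw [integral_add hsub hgi, integral_sub (hli.const_mul σ) hdi,
    integral_const_mul] at h0
  have h7 : |∫ y, lapl g (secT y) ∂(m : Measure (Td d))| ≤ L := by
    have := norm_integral_le_of_norm_le_const (μ := (m : Measure (Td d)))
      (f := fun y => lapl g (secT y)) (C := L) (Filter.Eventually.of_forall fun y => hL _)
    simpa using this
  have h8 : |∫ y, dotp (α y - e) (gradv g (secT y)) ∂(m : Measure (Td d))| ≤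
      δ⁻¹ * (∫ y, sqnorm (α y - e) ∂(m : Measure (Td d))) + δ * G := by
    refine (abs_integral_le_integral_abs).trans ?_
    refine (integral_mono hdi.abs ((hβi.const_mul δ⁻¹).add (integrable_const (δ * G))) hbd).trans ?_
    simp only [Pi.add_apply]
    rw [integral_add (hβi.const_mul δ⁻¹) (integrable_const _), integral_const_mul]
    simp
  have h9 : (∫ y, gradv g (secT y) j ∂(m : Measure (Td d))) =
      (∫ y, dotp (α y - e) (gradv g (secT y)) ∂(m : Measure (Td d))) -
        σ * ∫ y, lapl g (secT y) ∂(m : Measure (Td d)) := by linarith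
  rw [h9]
  refine (abs_sub _ _).trans ?_
  rw [abs_mul, abs_of_pos hσ]
  have h10 := mul_le_mul_of_nonneg_left hβle (inv_nonneg.2 hδ.le)
  have h11 := mul_le_mul_of_nonneg_left h7 hσ.le
  linarith

lemma erg_lower {d : ℕ} (S : MFGSetting d) (j : Fin d) {C₁ C₂ : ℝ} (hC₁ : 0 < C₁)
    (hQ : QB S (-(Pi.single j 1)) C₁ C₂)
    (hFnonneg : ∀ μ : PTd d, 0 ≤ S.Fc μ)
    (hFA : ∀ μ ∈ setA d j, S.Fc μ = 2) :
    ∃ σ₀ > (0:ℝ), ∃ K > (0:ℝ), ∀ σ : ℝ, 0 < σ → σ ≤ σ₀ → ∀ m α, StatAdm (d := d) σ m α →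
      K ≤ (∫ y, S.Hstar (secT y) (α y) ∂(m : Measure (Td d))) + S.Fc m := by
  by_contra! hcon
  have hn : ∀ n : ℕ, (0:ℝ) < 1 / ((n:ℝ) + 1) := fun n => by positivity
  have hcon' := fun n : ℕ => hcon (1 / ((n:ℝ) + 1)) (hn n) (1 / ((n:ℝ) + 1)) (hn n)
  choose σ hσ hσ' m α hadm hlt using hcon'
  let U : Ultrafilter ℕ := Filter.hyperfilter ℕ
  have hU : (U : Filter ℕ) ≤ atTop := Nat.hyperfilter_le_atTop
  obtain ⟨m', -, hm'⟩ := (isCompact_univ (X := PTd d)).ultrafilter_le_nhds (U.map m) (by simp)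
  have hm : Tendsto m U (𝓝 m') := hm'
  have hε : Tendsto (fun n : ℕ => 1 / ((n:ℝ) + 1)) U (𝓝 0) :=
    tendsto_one_div_add_atTop_nhds_zero_nat.mono_left hU
  have hest := fun n => stat_est S j hC₁ hQ (hσ n) (hadm n)
  have hF0 : Tendsto (fun n => S.Fc (m n)) U (𝓝 0) :=
    squeeze_zero (fun n => hFnonneg _) (fun n => by linarith [hlt n, (hest n).1]) hε
  have hF : S.Fc m' = 0 := tendsto_nhds_unique (Fc_tendsto S hm) hF0
  have hA : m' ∈ setA d j := by
    intro g hg hgp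
    obtain ⟨G, hG0, hG⟩ := bdd_secT (g := fun x => sqnorm (gradv g x))
      (fun x z => congrArg sqnorm (Per.gradv hgp x z)) (sqnorm_cont.comp (cont_grad hg))
    obtain ⟨L, hL0, hL⟩ := bdd_secT (g := lapl g) (Per.lapl hgp) (cont_lapl hg)
    have hcg : Continuous (fun y : Td d => gradv g (secT y) j) :=
      cont_secT (g := fun x => gradv g x j) (fun x z => congrFun (Per.gradv hgp x z) j)
        ((continuous_apply j).comp (cont_grad hg))
    have hlim := (ProbabilityMeasure.tendsto_iff_forall_integral_tendsto.1 hm)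
      (BoundedContinuousFunction.mkOfCompact ⟨_, hcg⟩)
    simp only [BoundedContinuousFunction.mkOfCompact_apply, ContinuousMap.coe_mk] at hlim
    have hb : ∀ δ > 0, |∫ y, gradv g (secT y) j ∂(m' : Measure (Td d))| ≤ δ * G := by
      intro δ hδ
      have hR : Tendsto (fun n : ℕ => δ⁻¹ * (2 / C₁ * (1 / ((n:ℝ) + 1))) + δ * G
          + (1 / ((n:ℝ) + 1)) * L) U (𝓝 (δ⁻¹ * (2 / C₁ * 0) + δ * G + 0 * L)) :=
        (((hε.const_mul _).const_mul _).add_const _).add (hε.mul_const _)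
      have := le_of_tendsto_of_tendsto' hlim.abs hR fun n => by
        refine ((hest n).2 g hg hgp G L (fun x => (le_abs_self _).trans (hG x)) hL δ hδ).trans ?_
        have h1 : (∫ y, S.Hstar (secT y) (α n y) ∂(m n : Measure (Td d))) ≤ 1 / ((n:ℝ) + 1) := by
          linarith [hlt n, hFnonneg (m n)]
        have h2 := hσ' n
        gcongr
      simpa using this
    have h0 : |∫ y, gradv g (secT y) j ∂(m' : Measure (Td d))| ≤ 0 := by
      have hR : Tendsto (fun n : ℕ => (1 / ((n:ℝ) + 1)) * G) U (𝓝 (0 * G)) := hε.mul_const _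
      rw [zero_mul] at hR
      exact ge_of_tendsto' hR fun n => hb _ (hn n)
    exact abs_nonpos_iff.1 h0
  have := hFA m' hA
  linarith

instance volProb {d : ℕ} : IsProbabilityMeasure (volume : Measure (Td d)) := by
  constructor
  rw [volume_pi, Measure.pi_univ]
  refine Finset.prod_eq_one fun i _ => ?_
  rw [AddCircle.measure_univ]; simp

lemma stat_nonempty {d : ℕ} (σ : ℝ) :
    StatAdm (d := d) σ ⟨volume, inferInstance⟩ (fun _ => 0) := by
  refine ⟨measurable_const, by simp [sqnorm], fun g hg hgp => ?_⟩
  have hp : Per g := hgp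
  have h1 : ∀ y : Td d, σ * lapl g (secT y) - dotp (0 : Vd d) (gradv g (secT y)) =
    σ * ∑ i, fderiv ℝ (fun y => fderiv ℝ g y (Pi.single i 1)) (secT y) (Pi.single i 1) := by
    intro y; simp [dotp, lapl, D2]
  simp_rw [h1]
  rw [integral_const_mul]
  show σ * ∫ y : Td d, _ = 0
  rw [integral_finsetSum]
  · rw [Finset.sum_eq_zero, mul_zero]
    intro i _
    exact int_deriv_zero (hp.fderiv_apply _) (cd1 hg _) _
  · intro i _
    exact integrable_secT ((hp.fderiv_apply _).fderiv_apply _)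
      (((cd1 hg _).continuous_fderiv (by norm_num)).clm_apply continuous_const) _

end NCG

namespace NCG

lemma piT_cont {d : ℕ} : Continuous (piT : Vd d → Td d) := quot_piT.continuous

/-- translate of a measure -/
def mcurve {d : ℕ} (μ₀ : PTd d) (e : Vd d) (s : ℝ) : PTd d :=
  ⟨(μ₀ : Measure (Td d)).map (fun y => y + piT (s • e)),
    Measure.isProbabilityMeasure_map (measurable_add_const _).aemeasurable⟩

lemma int_mcurve {d : ℕ} (μ₀ : PTd d) (e : Vd d) (s : ℝ) (f : Td d → ℝ) :
    ∫ y, f y ∂(mcurve μ₀ e s : Measure (Td d)) =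
      ∫ y, f (y + piT (s • e)) ∂(μ₀ : Measure (Td d)) :=
  (measurableEmbedding_addRight (piT (s • e))).integral_map f

/-- the drift profile -/
def Adr {d : ℕ} (ρ : Vd d → ℝ) (e : Vd d) (σ : ℝ) (x : Vd d) : Vd d :=
  -e - (σ / ρ x) • gradv ρ x

lemma Adr_per {d : ℕ} {ρ : Vd d → ℝ} (hρ : Per ρ) (e : Vd d) (σ : ℝ) : Per (Adr ρ e σ) :=
  fun x z => by
  unfold Adr
  rw [hρ, hρ.gradv]

lemma Adr_cont {d : ℕ} {ρ : Vd d → ℝ} (hc : ContDiff ℝ 2 ρ) (hpos : ∀ x, 0 < ρ x)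
    (e : Vd d) (σ : ℝ) : Continuous (Adr ρ e σ) := by
  unfold Adr
  have h1 := cont_grad hc
  have h2 := hc.continuous
  exact continuous_const.sub ((continuous_const.div h2 fun x => (hpos x).ne').smul h1)

/-- the control -/
def actl {d : ℕ} (ρ : Vd d → ℝ) (e : Vd d) (σ : ℝ) (s : ℝ) (y : Td d) : Vd d :=
  Adr ρ e σ (secT y + -(s • e))

lemma actl_shift {d : ℕ} {ρ : Vd d → ℝ} (hρ : Per ρ) (e : Vd d) (σ s : ℝ) (y : Td d) :
    actl ρ e σ s (y + piT (s • e)) = Adr ρ e σ (secT y) := by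
  unfold actl
  have := ((Adr_per hρ e σ).shift (-(s • e))).secT_add y (s • e)
  rw [this]
  simp

lemma int_mu0 {d : ℕ} {ρ : Vd d → ℝ} (hc : Continuous ρ) (hpos : ∀ x, 0 < ρ x) {μ₀ : PTd d}
    (hμ₀ : (μ₀ : Measure (Td d)) =
      (volume : Measure (Td d)).withDensity (fun y => ENNReal.ofReal (ρ (secT y))))
    (f : Td d → ℝ) :
    ∫ y, f y ∂(μ₀ : Measure (Td d)) = ∫ y : Td d, ρ (secT y) * f y := by
  rw [hμ₀, integral_withDensity_eq_integral_toReal_smul]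
  · simp [ENNReal.toReal_ofReal (hpos _).le]
  · exact (hc.measurable.comp meas_secT).ennreal_ofReal
  · simp

lemma mcurve_setB {d : ℕ} {ρ : Vd d → ℝ} (hρ : Per ρ) (hc : Continuous ρ) {μ₀ : PTd d}
    (hμ₀ : (μ₀ : Measure (Td d)) =
      (volume : Measure (Td d)).withDensity (fun y => ENNReal.ofReal (ρ (secT y))))
    (e : Vd d) (s : ℝ) : mcurve μ₀ e s ∈ setB d ρ := by
  refine ⟨-(s • e), ?_⟩
  show (μ₀ : Measure (Td d)).map (fun y => y + piT (s • e)) = _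
  ext E hE
  have hmE : MeasurableSet ((fun y : Td d => y + piT (s • e)) ⁻¹' E) :=
    measurable_add_const _ hE
  rw [Measure.map_apply (measurable_add_const _) hE, hμ₀, withDensity_apply _ hmE,
    withDensity_apply _ hE, ← lintegral_indicator hmE, ← lintegral_indicator hE,
    ← lintegral_add_right_eq_self (E.indicator _) (piT (s • e))]
  congr 1
  funext y
  have h := (hρ.shift (-(s • e))).secT_add y (s • e)
  simp only [add_neg_cancel_right] at h
  by_cases hy : y + piT (s • e) ∈ E
  · have hy' : y ∈ (fun y : Td d => y + piT (s • e)) ⁻¹' E := hy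
    rw [indicator_of_mem hy, indicator_of_mem hy', h]
  · have hy' : y ∉ (fun y : Td d => y + piT (s • e)) ⁻¹' E := hy
    rw [indicator_of_notMem hy, indicator_of_notMem hy']

lemma mcurve_W1 {d : ℕ} (μ₀ : PTd d) (j : Fin d) (s t : ℝ) :
    W1 (mcurve μ₀ (Pi.single j 1) s) (mcurve μ₀ (Pi.single j 1) t) ≤ |s - t| := by
  unfold W1
  refine csSup_le ⟨0, fun _ => 0, (LipschitzWith.const (0:ℝ)).weaken zero_le_one, by simp⟩ ?_
  rintro r ⟨φ, hφ, rfl⟩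
  set e : Vd d := Pi.single j 1 with he
  rw [int_mcurve, int_mcurve]
  have hi : ∀ a : Td d, Integrable (fun y => φ (y + a)) (μ₀ : Measure (Td d)) := fun a =>
    (hφ.continuous.comp (continuous_add_right a)).integrable_of_hasCompactSupport
      (HasCompactSupport.of_compactSpace _)
  rw [← integral_sub (hi _) (hi _)]
  have := norm_integral_le_of_norm_le_const (μ := (μ₀ : Measure (Td d)))
    (f := fun y => φ (y + piT (s • e)) - φ (y + piT (t • e))) (C := |s - t|)
    (Filter.Eventually.of_forall fun y => by
      rw [← dist_eq_norm]
      refine (hφ.dist_le_mul _ _).trans ?_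
      rw [NNReal.coe_one, one_mul, dist_add_left]
      refine (dist_pi_le_iff (abs_nonneg _)).2 fun i => ?_
      simp only [piT]
      rw [dist_eq_norm, ← AddCircle.coe_sub]
      refine (UnitAddCircle.norm_eq (x := (s • e) i - (t • e) i)).le.trans ?_
      refine (round_le _ 0).trans ?_
      by_cases hk : i = j
      · subst hk; simp [he]
      · simp [he, hk])
  refine (le_abs_self _).trans ?_
  simpa using this

lemma ibp {d : ℕ} {ρ ψ : Vd d → ℝ} (hρ : Per ρ) (hρc : ContDiff ℝ 2 ρ) (hψ : Per ψ)
    (hψc : ContDiff ℝ 2 ψ) :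
    ∫ y : Td d, (ρ (secT y) * lapl ψ (secT y) + dotp (gradv ρ (secT y)) (gradv ψ (secT y))) = 0 := by
  have hG : ∀ i : Fin d, ContDiff ℝ 1 (fun x => ρ x * fderiv ℝ ψ x (Pi.single i 1)) := fun i =>
    (hρc.of_le (by norm_num)).mul (cd1 hψc _)
  have hP : ∀ i : Fin d, Per (fun x => ρ x * fderiv ℝ ψ x (Pi.single i 1)) := fun i x z => by
    show ρ (x + intVec z) * fderiv ℝ ψ (x + intVec z) _ = _
    rw [hρ, hψ.fderiv]
  have h1 : ∀ x, ρ x * lapl ψ x + dotp (gradv ρ x) (gradv ψ x) =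
      ∑ i, fderiv ℝ (fun x => ρ x * fderiv ℝ ψ x (Pi.single i 1)) x (Pi.single i 1) := by
    intro x
    simp only [lapl, dotp, D2, gradv, Finset.mul_sum, ← Finset.sum_add_distrib]
    refine Finset.sum_congr rfl fun i _ => ?_
    rw [fderiv_fun_mul (hρc.differentiable (by norm_num) x)
      ((cd1 hψc _).differentiable (by norm_num) x)]
    simp; ring
  simp_rw [h1]
  rw [integral_finsetSum]
  · exact Finset.sum_eq_zero fun i _ => int_deriv_zero (hP i) (hG i) _
  · intro i _
    exact integrable_secT ((hP i).fderiv_apply _)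
      (((hG i).continuous_fderiv (by norm_num)).clm_apply continuous_const) _

lemma FP_mcurve {d : ℕ} {ρ : Vd d → ℝ} (hρ : Per ρ) (hρc : ContDiff ℝ 2 ρ)
    (hpos : ∀ x, 0 < ρ x) {μ₀ : PTd d}
    (hμ₀ : (μ₀ : Measure (Td d)) =
      (volume : Measure (Td d)).withDensity (fun y => ENNReal.ofReal (ρ (secT y))))
    (e : Vd d) (j : Fin d) (he : e = Pi.single j 1) (σ s₁ s₂ : ℝ) :
    FPeq σ (mcurve μ₀ e) (actl ρ e σ) s₁ s₂ := by
  rintro φ ⟨hφc, hφp⟩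
  have hφp' : ∀ t, Per (φ t) := hφp
  set Φ : ℝ × Vd d → ℝ := fun q => φ q.1 q.2 with hΦ
  have hΦd : Differentiable ℝ Φ := hφc.differentiable (by norm_num)
  have hφt : ∀ t, ContDiff ℝ 2 (φ t) := fun t =>
    hφc.comp (contDiff_const.prodMk contDiff_id : ContDiff ℝ 2 fun x : Vd d => (t, x))
  have hd1 : ∀ t x, tderiv φ t x = fderiv ℝ Φ (t, x) (1, 0) := fun t x => by
    have h1 : HasDerivAt (fun s : ℝ => (s, x)) ((1:ℝ), (0 : Vd d)) t :=
      (hasDerivAt_id t).prodMk (hasDerivAt_const t x)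
    exact ((hΦd (t, x)).hasFDerivAt.comp_hasDerivAt t h1 :).deriv
  have hd2 : ∀ t x v, fderiv ℝ (φ t) x v = fderiv ℝ Φ (t, x) (0, v) := fun t x v => by
    have h1 : HasFDerivAt (fun x : Vd d => (t, x)) (ContinuousLinearMap.inr ℝ ℝ (Vd d)) x :=
      hasFDerivAt_prodMk_right t x
    have h2 := ((hΦd (t, x)).hasFDerivAt.comp x h1).fderiv
    have h3 : fderiv ℝ (φ t) x = _ := h2
    rw [h3]; simp
  have htp : ∀ t, Per (tderiv φ t) := fun t x z => by
    unfold tderiv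
    congr 1
    funext s; exact hφp s x z
  have hL : ∀ s, ∫ y, φ s (secT y) ∂(mcurve μ₀ e s : Measure (Td d)) =
      ∫ y : Td d, ρ (secT y) * φ s (secT y + s • e) := fun s => by
    rw [int_mcurve, int_mu0 hρc.continuous hpos hμ₀]
    simp_rw [(hφp' s).secT_add]
  rw [hL, hL]
  have hcΦ' : Continuous (fderiv ℝ Φ) := hφc.continuous_fderiv (by norm_num)
  have hperΨ' : ∀ t, Per (fun x => ρ x * (tderiv φ t (x + t • e) +
      fderiv ℝ (φ t) (x + t • e) e)) := by
    intro t x z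
    show ρ (x + intVec z) * (tderiv φ t (x + intVec z + t • e) +
      fderiv ℝ (φ t) (x + intVec z + t • e) e) = _
    rw [hρ, add_right_comm, htp, (hφp' t).fderiv]
  have hcΨ' : Continuous (fun q : ℝ × Vd d => ρ q.2 * (tderiv φ q.1 (q.2 + q.1 • e) +
      fderiv ℝ (φ q.1) (q.2 + q.1 • e) e)) := by
    simp only [hd1, hd2]
    have hρc' := hρc.continuous
    have h5 : Continuous (fun q : ℝ × Vd d => fderiv ℝ Φ (q.1, q.2 + q.1 • e)) :=
      hcΦ'.comp (by fun_prop)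
    exact (hρc'.comp continuous_snd).mul
      ((h5.clm_apply continuous_const).add (h5.clm_apply continuous_const))
  have hmain := int_diff (Ψ := fun t x => ρ x * φ t (x + t • e))
    (Ψ' := fun t x => ρ x * (tderiv φ t (x + t • e) + fderiv ℝ (φ t) (x + t • e) e))
    (fun t x z => by
      show ρ (x + intVec z) * φ t (x + intVec z + t • e) = _
      rw [hρ, add_right_comm, hφp])
    hperΨ'
    (fun t => hρc.continuous.mul ((hφt t).continuous.comp (by fun_prop)))
    hcΨ'
    (fun t x => by
      have h1 : HasDerivAt (fun s : ℝ => (s, x + s • e)) ((1:ℝ), e) t := by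
        refine (hasDerivAt_id t).prodMk ?_
        simpa using ((hasDerivAt_id t).smul_const e).const_add x
      have h2 := ((hΦd (t, x + t • e)).hasFDerivAt.comp_hasDerivAt t h1).const_mul (ρ x)
      have h3 : ((1:ℝ), e) = ((1:ℝ), (0 : Vd d)) + ((0:ℝ), e) := by simp
      rw [h3, map_add, ← hd1, ← hd2] at h2
      exact h2) s₁ s₂
  rw [hmain]
  congr 1
  funext s
  rw [int_mcurve, int_mu0 hρc.continuous hpos hμ₀]
  set ψ : Vd d → ℝ := fun x => φ s (x + s • e) with hψ
  have hψp : Per ψ := (hφp' s).shift _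
  have hψc : ContDiff ℝ 2 ψ := (hφt s).comp (by fun_prop)
  have hψ1 : ∀ x, fderiv ℝ ψ x = fderiv ℝ (φ s) (x + s • e) := fun x => fderiv_comp_add_right _
  have hψg : ∀ x, gradv ψ x = gradv (φ s) (x + s • e) := fun x => by
    funext i; simp only [gradv, hψ1]
  have hψl : ∀ x, lapl ψ x = lapl (φ s) (x + s • e) := fun x => by
    simp only [lapl, D2, hψ1]
    refine Finset.sum_congr rfl fun i _ => ?_
    rw [fderiv_comp_add_right (f := fun y => fderiv ℝ (φ s) y (Pi.single i 1)) (s • e)]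
  have hint1 : Integrable (fun y : Td d => ρ (secT y) * (tderiv φ s (secT y + s • e) +
      fderiv ℝ (φ s) (secT y + s • e) e)) :=
    integrable_secT (hperΨ' s)
      (hcΨ'.comp (by fun_prop : Continuous fun x : Vd d => (s, x))) _
  have hint2 : Integrable (fun y : Td d => σ * (ρ (secT y) * lapl ψ (secT y) +
      dotp (gradv ρ (secT y)) (gradv ψ (secT y)))) := by
    refine Integrable.const_mul (integrable_secT
      (g := fun x => ρ x * lapl ψ x + dotp (gradv ρ x) (gradv ψ x)) ?_ ?_ _) σ
    · intro x z
      show ρ (x + intVec z) * lapl ψ (x + intVec z) +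
        dotp (gradv ρ (x + intVec z)) (gradv ψ (x + intVec z)) = _
      rw [hρ, hψp.lapl, hρ.gradv, hψp.gradv]
    · have h1 := cont_grad hρc
      have h2 := cont_grad hψc
      have h3 := cont_lapl hψc
      have h4 := hρc.continuous
      unfold dotp
      fun_prop
  have hpt : ∀ y : Td d, ρ (secT y) * (tderiv φ s (secT (y + piT (s • e))) +
      σ * lapl (φ s) (secT (y + piT (s • e))) -
      dotp (actl ρ e σ s (y + piT (s • e))) (gradv (φ s) (secT (y + piT (s • e))))) =
      ρ (secT y) * (tderiv φ s (secT y + s • e) + fderiv ℝ (φ s) (secT y + s • e) e) +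
      σ * (ρ (secT y) * lapl ψ (secT y) + dotp (gradv ρ (secT y)) (gradv ψ (secT y))) := by
    intro y
    rw [actl_shift hρ, (htp s).secT_add, (hφp' s).lapl.secT_add, (hφp' s).gradv.secT_add,
      ← hψl, ← hψg]
    have h1 : dotp (Adr ρ e σ (secT y)) (gradv ψ (secT y)) =
        - fderiv ℝ (φ s) (secT y + s • e) e
          - σ / ρ (secT y) * dotp (gradv ρ (secT y)) (gradv ψ (secT y)) := by
      have h2 : fderiv ℝ (φ s) (secT y + s • e) e = ∑ i, e i * gradv ψ (secT y) i := by
        rw [← hψ1, he]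
        simp [gradv, Pi.single_apply]
      rw [h2]
      simp only [dotp, Adr, Finset.mul_sum, ← Finset.sum_neg_distrib, ← Finset.sum_sub_distrib]
      refine Finset.sum_congr rfl fun i _ => ?_
      simp; ring
    rw [h1]
    have := (hpos (secT y)).ne'
    field_simp
    ring
  simp_rw [hpt]
  rw [integral_add hint1 hint2, integral_const_mul, ibp hρ hρc hψp hψc, mul_zero, add_zero]

end NCG

namespace NCG

lemma sqnorm_Adr {d : ℕ} {ρ : Vd d → ℝ} (e : Vd d) (σ : ℝ) (x : Vd d) :
    sqnorm (Adr ρ e σ x - -e) = σ ^ 2 * sqnorm (gradv ρ x) / ρ x ^ 2 := by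
  simp only [sqnorm, Adr, Finset.mul_sum, Finset.sum_div]
  refine Finset.sum_congr rfl fun i _ => ?_
  simp [div_mul_eq_mul_div]
  ring

lemma runCost_bound {d : ℕ} (S : MFGSetting d) (j : Fin d) {C₁ C₂ : ℝ} (hC₁ : 0 < C₁)
    (hQ : QB S (-(Pi.single j 1)) C₁ C₂) {ρ : Vd d → ℝ} (hρ : Per ρ) (hρc : ContDiff ℝ 2 ρ)
    (hpos : ∀ x, 0 < ρ x) {μ₀ : PTd d}
    (hμ₀ : (μ₀ : Measure (Td d)) =
      (volume : Measure (Td d)).withDensity (fun y => ENNReal.ofReal (ρ (secT y))))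
    (hFB : ∀ μ ∈ setB d ρ, S.Fc μ = 0) (σ : ℝ) :
    Measurable (runCost S (mcurve μ₀ (Pi.single j 1)) (actl ρ (Pi.single j 1) σ)) ∧
    ∀ s, 0 ≤ runCost S (mcurve μ₀ (Pi.single j 1)) (actl ρ (Pi.single j 1) σ) s ∧
      runCost S (mcurve μ₀ (Pi.single j 1)) (actl ρ (Pi.single j 1) σ) s ≤
        σ ^ 2 * (C₂ / 2) * ∫ y : Td d, sqnorm (gradv ρ (secT y)) / ρ (secT y) := by
  set e : Vd d := Pi.single j 1
  have heq : ∀ s, runCost S (mcurve μ₀ e) (actl ρ e σ) s =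
      ∫ y, S.Hstar (secT (y + piT (s • e))) (Adr ρ e σ (secT y)) ∂(μ₀ : Measure (Td d)) := by
    intro s
    unfold runCost
    rw [hFB _ (mcurve_setB hρ hρc.continuous hμ₀ e s), add_zero, int_mcurve]
    simp_rw [actl_shift hρ]
  have hAc := Adr_cont hρc hpos e σ
  have hAm : Measurable (fun y : Td d => Adr ρ e σ (secT y)) := hAc.measurable.comp meas_secT
  have hH0 : ∀ x p, 0 ≤ S.Hstar x p := fun x p =>
    le_trans (mul_nonneg (by positivity) (sqnorm_nonneg _)) (hQ x p).1
  have hshift : Measurable (fun q : ℝ × Td d => secT (q.2 + piT (q.1 • e))) := by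
    refine meas_secT.comp (Continuous.measurable ?_)
    exact continuous_snd.add (piT_cont.comp (by fun_prop))
  have hjm : Measurable (fun q : ℝ × Td d =>
      S.Hstar (secT (q.2 + piT (q.1 • e))) (Adr ρ e σ (secT q.2))) :=
    (Hstar_meas S).comp (hshift.prodMk (hAm.comp measurable_snd))
  refine ⟨?_, fun s => ?_⟩
  · rw [funext heq]
    exact (hjm.stronglyMeasurable.integral_prod_right' (ν := (μ₀ : Measure (Td d)))).measurable
  · rw [heq]
    refine ⟨integral_nonneg fun y => hH0 _ _, ?_⟩
    set B : Vd d → ℝ := fun x => C₂ / 2 * sqnorm (Adr ρ e σ x - -e) with hB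
    have hBp : Per B := fun x z => by simp only [hB]; rw [Adr_per hρ]
    have hBc : Continuous B := continuous_const.mul (sqnorm_cont.comp (hAc.sub continuous_const))
    have hBi := integrable_secT hBp hBc (μ₀ : Measure (Td d))
    have hle : ∀ y : Td d, S.Hstar (secT (y + piT (s • e))) (Adr ρ e σ (secT y)) ≤ B (secT y) :=
      fun y => (hQ _ _).2
    have h1 : ∫ y, S.Hstar (secT (y + piT (s • e))) (Adr ρ e σ (secT y)) ∂(μ₀ : Measure (Td d))
        ≤ ∫ y, B (secT y) ∂(μ₀ : Measure (Td d)) :=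
      integral_mono_of_nonneg (Filter.Eventually.of_forall fun y => hH0 _ _) hBi
        (Filter.Eventually.of_forall hle)
    refine h1.trans (le_of_eq ?_)
    rw [int_mu0 hρc.continuous hpos hμ₀, ← integral_const_mul]
    congr 1
    funext y
    simp only [hB, sqnorm_Adr]
    have := (hpos (secT y)).ne'
    field_simp

lemma adm_mcurve {d : ℕ} (S : MFGSetting d) (j : Fin d) {C₁ C₂ : ℝ} (hC₁ : 0 < C₁)
    (hQ : QB S (-(Pi.single j 1)) C₁ C₂) {ρ : Vd d → ℝ} (hρ : Per ρ) (hρc : ContDiff ℝ 2 ρ)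
    (hpos : ∀ x, 0 < ρ x) {μ₀ : PTd d}
    (hμ₀ : (μ₀ : Measure (Td d)) =
      (volume : Measure (Td d)).withDensity (fun y => ENNReal.ofReal (ρ (secT y))))
    (hFB : ∀ μ ∈ setB d ρ, S.Fc μ = 0) (σ T : ℝ) :
    AdmOn S σ μ₀ T (mcurve μ₀ (Pi.single j 1)) (actl ρ (Pi.single j 1) σ) := by
  obtain ⟨hm, hb⟩ := runCost_bound S j hC₁ hQ hρ hρc hpos hμ₀ hFB σ
  refine ⟨?_, ?_, ?_, ?_, ?_, ?_⟩
  · apply Subtype.ext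
    show (μ₀ : Measure (Td d)).map (fun y => y + piT ((0:ℝ) • (Pi.single j 1 : Vd d))) = _
    have : (fun y : Td d => y + piT ((0:ℝ) • (Pi.single j 1 : Vd d))) = id := by
      funext y i; simp [piT]
    rw [this, Measure.map_id]
    rfl
  · intro t _ ε hε
    exact ⟨ε, hε, fun s _ hs => (mcurve_W1 μ₀ j s t).trans_lt hs⟩
  · intro s₁ s₂ _ _ _
    exact FP_mcurve hρ hρc hpos hμ₀ _ j rfl σ s₁ s₂
  · have hAc := Adr_cont hρc hpos (Pi.single j 1) σ
    unfold actl
    refine hAc.measurable.comp ?_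
    refine (meas_secT.comp measurable_snd).add ?_
    exact (Continuous.measurable (by fun_prop))
  · obtain ⟨M, hM0, hM⟩ := bdd_secT (g := fun x => sqnorm (Adr ρ (Pi.single j 1) σ x))
      (fun x z => congrArg sqnorm (Adr_per hρ _ _ x z))
      (sqnorm_cont.comp (Adr_cont hρc hpos (Pi.single j 1) σ))
    have h1 : ∀ s, ∫⁻ y, ENNReal.ofReal (sqnorm (actl ρ (Pi.single j 1) σ s y))
        ∂(mcurve μ₀ (Pi.single j 1) s : Measure (Td d)) ≤ ENNReal.ofReal M := by
      intro s
      calc _ ≤ ∫⁻ _, ENNReal.ofReal M ∂(mcurve μ₀ (Pi.single j 1) s : Measure (Td d)) :=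
            lintegral_mono fun y => ENNReal.ofReal_le_ofReal ((le_abs_self _).trans (hM _))
        _ = ENNReal.ofReal M := by simp
    refine lt_of_le_of_lt (lintegral_mono h1) ?_
    simp only [lintegral_const, Measure.restrict_apply MeasurableSet.univ, univ_inter,
      Real.volume_Ioc]
    exact ENNReal.mul_lt_top ENNReal.ofReal_lt_top ENNReal.ofReal_lt_top
  · refine IntervalIntegrable.mono_fun (intervalIntegrable_const (c := σ ^ 2 * (C₂ / 2) *
      ∫ y : Td d, sqnorm (gradv ρ (secT y)) / ρ (secT y))) hm.aestronglyMeasurable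
      (Filter.Eventually.of_forall fun s => ?_)
    beta_reduce
    rw [Real.norm_eq_abs, Real.norm_eq_abs, abs_of_nonneg (hb s).1]
    exact (hb s).2.trans (le_abs_self _)

end NCG

theorem nonconvex_gap (d : ℕ) (S : MFGSetting d) (j : Fin d)
    (C₁ C₂ : ℝ) (hC₁ : 0 < C₁) (hC₂ : 0 < C₂)
    (hHstar0 : ∀ x : Vd d, S.Hstar x (-(Pi.single j 1)) = 0)
    (hHstarpos : ∀ x p : Vd d, p ≠ -(Pi.single j 1) → 0 < S.Hstar x p)
    (hDpp_low : ∀ x p v : Vd d, C₁ * sqnorm v ≤ D2 (fun p' => S.Hstar x p') p v v)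
    (hDpp_up : ∀ x p v : Vd d, D2 (fun p' => S.Hstar x p') p v v ≤ C₂ * sqnorm v)
    (ρ₀ : Vd d → ℝ) (hρ₀smooth : ContDiff ℝ (⊤ : ℕ∞) ρ₀)
    (hρ₀per : ∀ (x : Vd d) (z : Fin d → ℤ), ρ₀ (x + intVec z) = ρ₀ x)
    (hρ₀pos : ∀ x : Vd d, 0 < ρ₀ x)
    (μ₀ : PTd d)
    (hμ₀ : (μ₀ : Measure (Td d)) =
      (volume : Measure (Td d)).withDensity (fun y => ENNReal.ofReal (ρ₀ (secT y))))
    (hμ₀notA : μ₀ ∉ setA d j)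
    (hFnonneg : ∀ μ : PTd d, 0 ≤ S.Fc μ)
    (hFA : ∀ μ ∈ setA d j, S.Fc μ = 2)
    (hFB : ∀ μ ∈ setB d ρ₀, S.Fc μ = 0)
    (lam : ℝ → ℝ)
    (hlam : ∀ σ : ℝ, 0 < σ → IsLimitValueU S σ (lam σ)) :
    ∃ σ₀ > (0:ℝ), ∃ K > (0:ℝ), ∀ σ : ℝ, 0 < σ → σ ≤ σ₀ →
      (0 ≤ -(lam σ) ∧
       -(lam σ) ≤ σ^2 * (C₂ / 2) *
          ∫ y, sqnorm (gradv ρ₀ (secT y)) / ρ₀ (secT y) ∂(volume : Measure (Td d)) ∧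
       K ≤ ergInf S σ ∧
       -(lam σ) < ergInf S σ) := by
  have hH0 : ∀ x p : Vd d, 0 ≤ S.Hstar x p := by
    intro x p
    by_cases hp : p = -(Pi.single j 1)
    · rw [hp, hHstar0]
    · exact (hHstarpos x p hp).le
  have hQ : NCG.QB S (-(Pi.single j 1)) C₁ C₂ := by
    intro x p
    have := NCG.quad_bounds (NCG.Hstar_convex S x) (hHstar0 x) (hH0 x) hC₁ (hDpp_low x)
      (hDpp_up x) (p - -(Pi.single j 1))
    rwa [add_sub_cancel] at this
  have hρ : NCG.Per ρ₀ := hρ₀per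
  have hρc : ContDiff ℝ 2 ρ₀ := contDiff_infty.1 hρ₀smooth 2
  obtain ⟨σ₁, hσ₁, K, hK, hE⟩ := NCG.erg_lower S j hC₁ hQ hFnonneg hFA
  set I : ℝ := ∫ y, sqnorm (gradv ρ₀ (secT y)) / ρ₀ (secT y) ∂(volume : Measure (Td d)) with hI
  have hI0 : 0 ≤ I := integral_nonneg fun y =>
    div_nonneg (NCG.sqnorm_nonneg _) (hρ₀pos _).le
  have hU0 : ∀ σ T : ℝ, 0 ≤ T → ∀ μ : PTd d, ∀ r ∈ { r | ∃ m α, AdmOn S σ μ T m α ∧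
      r = costT S m α T }, 0 ≤ r := by
    rintro σ T hT μ r ⟨m, α, -, rfl⟩
    exact intervalIntegral.integral_nonneg hT fun s _ =>
      add_nonneg (integral_nonneg fun y => hH0 _ _) (hFnonneg _)
  have hlow : ∀ σ : ℝ, 0 < σ → 0 ≤ -(lam σ) := by
    intro σ hσ
    by_contra hneg
    push Not at hneg
    obtain ⟨T₀, hT₀⟩ := hlam σ hσ (-(-(lam σ))) (by linarith)
    have h1 := (abs_lt.1 (hT₀ (max T₀ 1) (le_max_left _ _) μ₀)).2
    have hT : 0 ≤ max T₀ 1 := le_trans zero_le_one (le_max_right _ _)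
    have h2 : 0 ≤ Ufun S σ (max T₀ 1) μ₀ := Real.sInf_nonneg (hU0 σ _ hT μ₀)
    have h3 := div_nonneg h2 hT
    linarith
  have hup : ∀ σ : ℝ, 0 < σ → -(lam σ) ≤ σ^2 * (C₂ / 2) * I := by
    intro σ hσ
    refine le_of_forall_pos_le_add fun ε hε => ?_
    obtain ⟨T₀, hT₀⟩ := hlam σ hσ ε hε
    have h1 := (abs_lt.1 (hT₀ (max T₀ 1) (le_max_left _ _) μ₀)).1
    set T := max T₀ 1
    have hT : 0 < T := lt_of_lt_of_le zero_lt_one (le_max_right _ _)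
    have hadm := NCG.adm_mcurve S j hC₁ hQ hρ hρc hρ₀pos hμ₀ hFB σ T
    obtain ⟨hm, hb⟩ := NCG.runCost_bound S j hC₁ hQ hρ hρc hρ₀pos hμ₀ hFB σ
    have h2 : Ufun S σ T μ₀ ≤ costT S (NCG.mcurve μ₀ (Pi.single j 1))
        (NCG.actl ρ₀ (Pi.single j 1) σ) T :=
      csInf_le ⟨0, fun r hr => hU0 σ T hT.le μ₀ r hr⟩ ⟨_, _, hadm, rfl⟩
    have h3 : costT S (NCG.mcurve μ₀ (Pi.single j 1))
        (NCG.actl ρ₀ (Pi.single j 1) σ) T ≤ T * (σ^2 * (C₂ / 2) * I) := by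
      have h4 := intervalIntegral.integral_mono_on hT.le hadm.2.2.2.2.2
        (intervalIntegrable_const (c := σ^2 * (C₂ / 2) * I)) (fun s _ => (hb s).2)
      refine h4.trans (le_of_eq ?_)
      simp
      ring
    have h5 : Ufun S σ T μ₀ / T ≤ σ^2 * (C₂ / 2) * I := by
      rw [div_le_iff₀ hT]; linarith
    linarith
  have hne : 0 < C₂ / 2 * I + 1 := by positivity
  refine ⟨min σ₁ (min 1 (K / 2 / (C₂ / 2 * I + 1))), by positivity, K, hK, fun σ hσ hσle => ?_⟩
  have hs1 : σ ≤ σ₁ := hσle.trans (min_le_left _ _)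
  have hs2 : σ ≤ 1 := hσle.trans ((min_le_right _ _).trans (min_le_left _ _))
  have hs3 : σ ≤ K / 2 / (C₂ / 2 * I + 1) :=
    hσle.trans ((min_le_right _ _).trans (min_le_right _ _))
  have herg : K ≤ ergInf S σ := by
    refine le_csInf ⟨_, _, _, NCG.stat_nonempty σ, rfl⟩ ?_
    rintro r ⟨m, α, hadm, rfl⟩
    exact hE σ hσ hs1 m α hadm
  refine ⟨hlow σ hσ, hup σ hσ, herg, ?_⟩
  have h1 : σ^2 * (C₂ / 2) * I < K := by
    rw [le_div_iff₀ hne] at hs3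
    have h2 : σ ^ 2 ≤ σ := by nlinarith
    have h3 : 0 ≤ C₂ / 2 * I := by positivity
    nlinarith [mul_le_mul_of_nonneg_right h2 h3]
  linarith [hup σ hσ]
end
end
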